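/- Let (c_F)_F be a family indexed by the totally real subfields F of ℂ of finite degree over ℚ, where c_F lies in the ideal class group Cl(𝓞_F), and suppose the family is norm-compatible: whenever F ⊆ L are two such fields, Nm_{L/F}(c_L) = c_F under the norm-induced homomorphism on class groups. Then c_F is the trivial class for every F. (Equivalently, the inverse limit over totally real fields of the ideal class groups under the norm maps is zero.) -/

import Mathlib

open NumberField IntermediateField
open scoped nonZeroDivisors

/-- A subfield of `ℂ` is totally real if every field embedding of it into `ℂ`
has image contained in `ℝ`. -/
def TotallyReal (F : IntermediateField ℚ ℂ) : Prop :=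
  ∀ φ : F →+* ℂ, ∀ x : F, (φ x).im = 0

instance (F : IntermediateField ℚ ℂ) [FiniteDimensional ℚ F] : NumberField F :=
  NumberField.of_module_finite ℚ F

/-- The relative ideal norm `Nm_{L/F}` for subfields `F ⊆ L` of `ℂ`: the ideal of `𝓞 F`
generated by the field norms `Nm_{L/F}(x)` of the elements `x` of the given ideal of
`𝓞 L`. -/
noncomputable def idealNorm (F L : IntermediateField ℚ ℂ) (h : F ≤ L)
    (I : Ideal (𝓞 L)) : Ideal (𝓞 F) :=
  letI : Algebra F L := (IntermediateField.inclusion h).toRingHom.toAlgebra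
  Ideal.span {y : 𝓞 F | ∃ x ∈ I, (y : F) = Algebra.norm F (x : L)}


open Module in
/-- `(1-X)^(ℓ-1) = 1 + X + ... + X^(ℓ-1) + ℓ g`. -/
theorem HCF.poly_identity (ℓ : ℕ) [hl : Fact ℓ.Prime] :
    ∃ g : Polynomial ℤ, (1 - Polynomial.X) ^ (ℓ - 1) =
      (∑ i ∈ Finset.range ℓ, Polynomial.X ^ i) + (ℓ : Polynomial ℤ) * g := by
  have h : (Polynomial.C (ℓ : ℤ)) ∣ (1 - Polynomial.X) ^ (ℓ - 1) -
      (∑ i ∈ Finset.range ℓ, Polynomial.X ^ i) := by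
    rw [Polynomial.C_dvd_iff_dvd_coeff]
    intro i
    rw [← ZMod.intCast_zmod_eq_zero_iff_dvd _ ℓ] 
    have key : Polynomial.map (Int.castRingHom (ZMod ℓ)) ((1 - Polynomial.X) ^ (ℓ - 1) -
      (∑ i ∈ Finset.range ℓ, Polynomial.X ^ i)) = 0 := by
      simp only [Polynomial.map_sub, Polynomial.map_pow, Polynomial.map_one, Polynomial.map_X,
        Polynomial.map_sum]
      have h1 : (1 - Polynomial.X : Polynomial (ZMod ℓ)) ≠ 0 := by
        intro h
        have := congrArg (fun p => Polynomial.coeff p 0) h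
        simp at this
      apply mul_left_cancel₀ h1
      rw [mul_sub, mul_neg_geom_sum, mul_zero, ← pow_succ', Nat.sub_add_cancel hl.out.one_le,
        sub_pow_char, one_pow, sub_self]
    have := congrArg (fun p => Polynomial.coeff p i) key
    rw [Polynomial.coeff_map] at this
    simpa using this
  obtain ⟨g, hg⟩ := h
  refine ⟨g, ?_⟩
  have : (ℓ : Polynomial ℤ) = Polynomial.C (ℓ : ℤ) := by simp
  rw [this, ← hg]; ring

namespace HCF
open Module AddSubgroup

variable {M : Type*} [AddCommGroup M]

theorem index_pow_inj (D : Module.End ℤ M) (hinj : Function.Injective D) (k : ℕ) :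
    (LinearMap.range (D ^ k)).toAddSubgroup.index = (LinearMap.range D).toAddSubgroup.index ^ k := by
  induction k with
  | zero =>
    rw [pow_zero, pow_zero, AddSubgroup.index_eq_one]
    ext x; simp
  | succ k ih =>
    have e : (LinearMap.range (D ^ (k+1))).toAddSubgroup =
        (LinearMap.range (D ^ k)).toAddSubgroup.map D.toAddMonoidHom := by
      ext x
      simp [pow_succ']
    rw [e, AddSubgroup.index_map_of_injective _ (f := D.toAddMonoidHom) hinj, ih, pow_succ]
    congr 1

/-- If `s^ℓ = 1` and the norm of `s` vanishes on `M`, then `1-s` has index at least `ℓ^n`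
on `M` of rank `(ℓ-1)n`. -/
theorem index_one_sub (ℓ : ℕ) [hl : Fact ℓ.Prime] [Module.Finite ℤ M] [Module.IsTorsionFree ℤ M]
    (s : Module.End ℤ M) (hN : ∑ i ∈ Finset.range ℓ, s ^ i = 0) (n : ℕ)
    (hn : finrank ℤ M = (ℓ - 1) * n) :
    (LinearMap.range (1 - s)).toAddSubgroup.index ≠ 0 ∧
    ℓ ^ n ≤ (LinearMap.range (1 - s)).toAddSubgroup.index := by
  have hl1 : ℓ - 1 ≠ 0 := by have := hl.out.two_le; omega
  have hidx : (nsmulAddMonoidHom (α := M) ℓ).range.index = ℓ ^ finrank ℤ M :=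
    index_range_nsmul M ℓ
  have hpos : ℓ ^ finrank ℤ M ≠ 0 := pow_ne_zero _ hl.out.ne_zero
  -- `ℓ = (1 - s) * t`
  obtain ⟨t, ht⟩ : ∃ t : Module.End ℤ M, (ℓ : Module.End ℤ M) = (1 - s) * t := by
    refine ⟨∑ i ∈ Finset.range ℓ, ∑ j ∈ Finset.range i, s ^ j, ?_⟩
    rw [Finset.mul_sum]
    simp_rw [mul_neg_geom_sum]
    rw [Finset.sum_sub_distrib, hN]
    simp
  have hle : (nsmulAddMonoidHom (α := M) ℓ).range ≤ (LinearMap.range (1 - s)).toAddSubgroup := by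
    rintro _ ⟨x, rfl⟩
    refine ⟨t x, ?_⟩
    rw [← Module.End.mul_apply, ← ht]
    simp
  have hne : (LinearMap.range (1 - s)).toAddSubgroup.index ≠ 0 := fun h => by
    have := AddSubgroup.index_dvd_of_le hle
    rw [h, hidx] at this
    exact hpos (zero_dvd_iff.mp this)
  refine ⟨hne, ?_⟩
  have hinj : Function.Injective (1 - s : Module.End ℤ M) := by
    rw [← LinearMap.ker_eq_bot, LinearMap.ker_eq_bot']
    intro x hx
    have hsx : s x = x := by
      have := hx; simp [sub_eq_zero] at this; exact this.symm
    have h2 : ∀ i : ℕ, (s ^ i) x = x := by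
      intro i
      induction i with
      | zero => simp
      | succ k ih => rw [pow_succ, Module.End.mul_apply, hsx, ih]
    have h3 : (∑ i ∈ Finset.range ℓ, s ^ i) x = 0 := by rw [hN]; rfl
    rw [LinearMap.sum_apply] at h3
    simp only [h2, Finset.sum_const, Finset.card_range] at h3
    rw [← natCast_zsmul] at h3
    exact (smul_eq_zero.mp h3).resolve_left (by exact_mod_cast hl.out.ne_zero)
  obtain ⟨g, hg⟩ := poly_identity ℓ
  have hg' : (1 - s) ^ (ℓ - 1) = (ℓ : Module.End ℤ M) * Polynomial.aeval s g := by
    have := congrArg (Polynomial.aeval s) hg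
    simpa [hN] using this
  have hle2 : (LinearMap.range ((1 - s) ^ (ℓ - 1))).toAddSubgroup ≤
      (nsmulAddMonoidHom (α := M) ℓ).range := by
    rintro _ ⟨x, rfl⟩
    refine ⟨Polynomial.aeval s g x, ?_⟩
    rw [hg']
    simp
  have hdvd := AddSubgroup.index_dvd_of_le hle2
  rw [index_pow_inj _ hinj, hidx, hn, mul_comm, pow_mul] at hdvd
  have h4 := Nat.le_of_dvd (Nat.pos_of_ne_zero (pow_ne_zero _ hne)) hdvd
  exact (Nat.pow_le_pow_iff_left hl1).mp h4

/-- Herbrand quotient of units (inequality form). -/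
theorem herbrand_units {E : Type*} [AddCommGroup E] (ℓ : ℕ) [hl : Fact ℓ.Prime]
    [Module.Finite ℤ E] [Module.IsTorsionFree ℤ E]
    (s : Module.End ℤ E) (hs : s ^ ℓ = 1) (n : ℕ) (hn : 0 < n)
    (hE : finrank ℤ E + 1 = ℓ * n) (hZ : finrank ℤ (LinearMap.ker (1 - s)) + 1 = n) :
    (LinearMap.range (∑ i ∈ Finset.range ℓ, s ^ i)).toAddSubgroup.relIndex
        (LinearMap.ker (1 - s)).toAddSubgroup ≠ 0 ∧
    ℓ * (LinearMap.range (∑ i ∈ Finset.range ℓ, s ^ i)).toAddSubgroup.relIndex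
        (LinearMap.ker (1 - s)).toAddSubgroup ≤
      (LinearMap.range (1 - s)).toAddSubgroup.relIndex
        (LinearMap.ker (∑ i ∈ Finset.range ℓ, s ^ i)).toAddSubgroup := by
  set N : Module.End ℤ E := ∑ i ∈ Finset.range ℓ, s ^ i with hNdef
  set D : Module.End ℤ E := 1 - s with hDdef
  set M := LinearMap.ker N with hM
  set Z := LinearMap.ker D with hZdef
  have hND : N * D = 0 := by rw [hNdef, hDdef, geom_sum_mul_neg, hs, sub_self]
  have hDN : D * N = 0 := by rw [hNdef, hDdef, mul_neg_geom_sum, hs, sub_self]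
  have hNZ : ∀ z ∈ Z, N z = ℓ • z := by
    intro x hx
    have hsx : s x = x := by
      have : x - s x = 0 := hx
      exact (sub_eq_zero.mp this).symm
    have h2 : ∀ i : ℕ, (s ^ i) x = x := by
      intro i
      induction i with
      | zero => simp
      | succ k ih => rw [pow_succ, Module.End.mul_apply, hsx, ih]
    rw [hNdef, LinearMap.sum_apply]
    simp [h2]
  -- subgroups
  let aM := M.toAddSubgroup
  let aZ := Z.toAddSubgroup
  let aDE := (LinearMap.range D).toAddSubgroup
  let aNE := (LinearMap.range N).toAddSubgroup
  let lZ := aZ.map (nsmulAddMonoidHom (α := E) ℓ)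
  have hlZ : lZ = aZ.map N.toAddMonoidHom := by
    ext x
    constructor
    · rintro ⟨z, hz, rfl⟩; exact ⟨z, hz, hNZ z hz⟩
    · rintro ⟨z, hz, rfl⟩; exact ⟨z, hz, (hNZ z hz).symm⟩
  have hDE : aDE ≤ aM := by
    rintro _ ⟨x, rfl⟩
    change (N * D) x = 0
    rw [hND]; rfl
  have hNE : aNE ≤ aZ := by
    rintro _ ⟨x, rfl⟩
    change (D * N) x = 0
    rw [hDN]; rfl
  have hlZNE : lZ ≤ aNE := by
    rw [hlZ]; rintro _ ⟨z, hz, rfl⟩; exact ⟨z, rfl⟩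
  have eDE : aDE = (⊤ : AddSubgroup E).map D.toAddMonoidHom := by
    ext x; simp [aDE]
  have eNE : aNE = (⊤ : AddSubgroup E).map N.toAddMonoidHom := by
    ext x; simp [aNE]
  have kD : D.toAddMonoidHom.ker = aZ := rfl
  have kN : N.toAddMonoidHom.ker = aM := rfl
  let aDM := aM.map D.toAddMonoidHom
  have hDMDE : aDM ≤ aDE := by
    rw [eDE]; exact AddSubgroup.map_mono le_top
  have i1 : aDM.relIndex aDE = lZ.relIndex aNE := by
    rw [hlZ, eDE, eNE, relIndex_map_map, relIndex_map_map, kD, kN, sup_comm aM aZ]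
    simp
  have i2 : aDM.relIndex aDE * aDE.relIndex aM = aDM.relIndex aM :=
    relIndex_mul_relIndex _ _ _ hDMDE hDE
  have i3 : lZ.relIndex aNE * aNE.relIndex aZ = lZ.relIndex aZ :=
    relIndex_mul_relIndex _ _ _ hlZNE hNE
  have i4 : lZ.relIndex aZ = ℓ ^ (n - 1) := by
    have := relIndex_map_nsmul ℓ aZ
    rw [this]
    congr 1
    have : finrank ℤ aZ = finrank ℤ Z := rfl
    omega
  have hlZ0 : lZ.relIndex aZ ≠ 0 := by rw [i4]; exact pow_ne_zero _ hl.out.ne_zero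
  -- rank of M
  have rNE : finrank ℤ (LinearMap.range N) = finrank ℤ Z := by
    have : aNE.IsFiniteRelIndex aZ := ⟨fun h => hlZ0 (by rw [← i3, h, mul_zero])⟩
    have hf : Module.Finite ℤ aZ := inferInstanceAs (Module.Finite ℤ Z)
    have ht : Module.IsTorsionFree ℤ aZ := inferInstanceAs (Module.IsTorsionFree ℤ Z)
    exact finrank_eq_of_isFiniteRelIndex hNE
  have rM : finrank ℤ M = (ℓ - 1) * n := by
    have h1 : finrank ℤ (LinearMap.range N) + finrank ℤ (LinearMap.ker N) = finrank ℤ E := by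
      rw [← (LinearMap.quotKerEquivRange N).finrank_eq]
      exact Submodule.finrank_quotient_add_finrank _
    have h2 := hl.out.two_le
    obtain ⟨k, rfl⟩ : ∃ k, ℓ = k + 1 := ⟨ℓ - 1, by omega⟩
    simp only [Nat.add_sub_cancel]
    rw [add_mul] at hE
    have : finrank ℤ M = finrank ℤ (LinearMap.ker N) := rfl
    omega
  -- restriction to M
  have hsM : ∀ x ∈ M, s x ∈ M := by
    intro x hx
    have hc : N * s = s * N := by
      rw [hNdef, Finset.sum_mul, Finset.mul_sum]
      exact Finset.sum_congr rfl fun i _ => by rw [← pow_succ, ← pow_succ']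
    change (N * s) x = 0
    rw [hc, Module.End.mul_apply, show N x = 0 from hx, map_zero]
  let sM : Module.End ℤ M := s.restrict hsM
  have hpow : ∀ (i : ℕ) (x : M), (((sM ^ i) x : M) : E) = (s ^ i) x := by
    intro i
    induction i with
    | zero => intro x; simp
    | succ k ih =>
      intro x
      rw [pow_succ, pow_succ, Module.End.mul_apply, Module.End.mul_apply, ih]; rfl
  have hNM : ∑ i ∈ Finset.range ℓ, sM ^ i = 0 := by
    ext x
    have : N x = 0 := x.2
    rw [LinearMap.sum_apply, LinearMap.zero_apply, AddSubmonoidClass.coe_finsetSum]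
    simp only [hpow]
    rw [hNdef, LinearMap.sum_apply] at this
    simpa using this
  obtain ⟨j1, j2⟩ := index_one_sub ℓ sM hNM n rM
  have i5 : (LinearMap.range (1 - sM)).toAddSubgroup.index = aDM.relIndex aM := by
    rw [AddSubgroup.relIndex]
    congr 1
    ext x
    rw [AddSubgroup.mem_addSubgroupOf]
    constructor
    · rintro ⟨y, rfl⟩; exact ⟨y, y.2, rfl⟩
    · rintro ⟨y, hy, h⟩; exact ⟨⟨y, hy⟩, Subtype.ext h⟩
  rw [i5] at j1 j2
  have h0 : aNE.relIndex aZ ≠ 0 := fun h => hlZ0 (by rw [← i3, h, mul_zero])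
  have h1 : lZ.relIndex aNE ≠ 0 := fun h => hlZ0 (by rw [← i3, h, zero_mul])
  refine ⟨h0, ?_⟩
  change ℓ * aNE.relIndex aZ ≤ aDE.relIndex aM
  rw [← i2, i1] at j2
  have : lZ.relIndex aNE * (ℓ * aNE.relIndex aZ) ≤ lZ.relIndex aNE * aDE.relIndex aM := by
    calc _ = ℓ * (lZ.relIndex aNE * aNE.relIndex aZ) := by ring
      _ = ℓ ^ n := by rw [i3, i4, ← pow_succ', Nat.sub_add_cancel hn]
      _ ≤ _ := j2
  exact Nat.le_of_mul_le_mul_left this (Nat.pos_of_ne_zero h1)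

end HCF


namespace HCF
open Module AddSubgroup

theorem relIndex_le_of_fiber {G A Z : Type*} [AddCommGroup G] [AddCommGroup A] [AddCommGroup Z]
    (p : G →+ A) (q : G →+ Z) (B A' : AddSubgroup A) (C Z' : AddSubgroup Z)
    (hp : A' ≤ p.range) (hq : q.range ≤ Z') (h : C.comap q ≤ B.comap p)
    (h0 : C.relIndex Z' ≠ 0) : B.relIndex A' ≤ C.relIndex Z' := by
  have h1 : C.relIndex q.range ≤ C.relIndex Z' := relIndex_le_of_le_right hq h0
  have h1' : C.relIndex q.range ≠ 0 := fun h => h0 (relIndex_eq_zero_of_le_right hq h)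
  have h2 : B.relIndex p.range ∣ C.relIndex q.range := by
    rw [← index_comap, ← index_comap]
    exact index_dvd_of_le h
  have h2' : B.relIndex p.range ≠ 0 := fun h => h1' (by rw [h] at h2; exact zero_dvd_iff.mp h2)
  exact ((relIndex_le_of_le_right hp h2').trans (Nat.le_of_dvd (Nat.pos_of_ne_zero h1') h2)).trans h1

theorem ambiguous {X I J : Type*} [AddCommGroup X] [AddCommGroup I] [AddCommGroup J]
    (ℓ : ℕ) [hl : Fact ℓ.Prime] (s : Module.End ℤ X) (r : Module.End ℤ I)
    (hs : s ^ ℓ = 1) (hr : r ^ ℓ = 1)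
    (dv : X →ₗ[ℤ] I) (hdv : ∀ x, dv (s x) = r (dv x))
    (j : J →ₗ[ℤ] I) (hj : Function.Injective j) (hjr : ∀ a, r a = a → ∃ b, j b = a)
    (hrj : ∀ b, r (j b) = j b)
    (Nm : I →ₗ[ℤ] J) (hNm : ∀ a, j (Nm a) = (∑ i ∈ Finset.range ℓ, r ^ i) a)
    (h90 : ∀ x, (∑ i ∈ Finset.range ℓ, s ^ i) x = 0 → ∃ y, x = s y - y)
    (hfin : dv.range.toAddSubgroup.index ≠ 0)
    [Module.Finite ℤ (LinearMap.ker dv)] [Module.IsTorsionFree ℤ (LinearMap.ker dv)]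
    (n : ℕ) (hn : 0 < n)
    (hE : finrank ℤ (LinearMap.ker dv) + 1 = ℓ * n)
    (hZ : finrank ℤ ↥(LinearMap.ker dv ⊓ LinearMap.ker (1 - s)) + 1 = n)
    (PF : AddSubgroup J) (hPF : ∀ b, b ∈ PF ↔ ∃ x, s x = x ∧ dv x = j b) (hPF0 : PF.index ≠ 0)
    (hsurj : ∀ b, ∃ a, b - Nm a ∈ PF) : False := by
  -- the unit module
  have hsE : ∀ x ∈ LinearMap.ker dv, s x ∈ LinearMap.ker dv := by
    intro x hx
    rw [LinearMap.mem_ker] at hx ⊢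
    rw [hdv, hx, map_zero]
  let sE : Module.End ℤ (LinearMap.ker dv) := s.restrict hsE
  have hpow : ∀ (i : ℕ) (x : LinearMap.ker dv), (((sE ^ i) x : LinearMap.ker dv) : X) = (s ^ i) x := by
    intro i
    induction i with
    | zero => intro x; simp
    | succ k ih =>
      intro x
      rw [pow_succ, pow_succ, Module.End.mul_apply, Module.End.mul_apply, ih]; rfl
  have hsE1 : sE ^ ℓ = 1 := by
    ext x
    rw [hpow, hs]; rfl
  have hNE : ∀ x : LinearMap.ker dv, (((∑ i ∈ Finset.range ℓ, sE ^ i) x : LinearMap.ker dv) : X)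
      = (∑ i ∈ Finset.range ℓ, s ^ i) (x : X) := by
    intro x
    rw [LinearMap.sum_apply, LinearMap.sum_apply, AddSubmonoidClass.coe_finsetSum]
    simp only [hpow]
  have hZ' : finrank ℤ (LinearMap.ker (1 - sE)) + 1 = n := by
    rw [← hZ]
    congr 1
    let f : LinearMap.ker (1 - sE) →ₗ[ℤ] ↥(LinearMap.ker dv ⊓ LinearMap.ker (1 - s)) :=
      { toFun := fun x => ⟨x.1.1, x.1.2, congrArg Subtype.val x.2⟩
        map_add' := fun _ _ => rfl
        map_smul' := fun _ _ => rfl }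
    refine (LinearEquiv.ofBijective f ⟨?_, ?_⟩).finrank_eq
    · intro x y h
      have h' : (f x).1 = (f y).1 := congrArg Subtype.val h
      exact Subtype.ext (Subtype.ext h')
    · rintro ⟨x, hx1, hx2⟩
      exact ⟨⟨⟨x, hx1⟩, Subtype.ext hx2⟩, rfl⟩
  obtain ⟨e0, e1⟩ := herbrand_units ℓ sE hsE1 n hn hE hZ'
  set N : Module.End ℤ X := ∑ i ∈ Finset.range ℓ, s ^ i with hNdef
  set NI : Module.End ℤ I := ∑ i ∈ Finset.range ℓ, r ^ i with hNIdef
  set D : Module.End ℤ I := 1 - r with hDdef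
  have hND : NI * D = 0 := by rw [hNIdef, hDdef, geom_sum_mul_neg, hr, sub_self]
  have hdvpow : ∀ (i : ℕ) x, dv ((s ^ i) x) = (r ^ i) (dv x) := by
    intro i
    induction i with
    | zero => intro x; simp
    | succ k ih => intro x; rw [pow_succ, pow_succ, Module.End.mul_apply, Module.End.mul_apply, ih, hdv]
  have hdvN : ∀ x, dv (N x) = NI (dv x) := by
    intro x
    rw [hNdef, hNIdef, LinearMap.sum_apply, LinearMap.sum_apply, map_sum]
    simp only [hdvpow]
  have hsN : ∀ x, s (N x) = N x := by
    intro x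
    have h : (1 - s) * N = 0 := by rw [hNdef, mul_neg_geom_sum, hs, sub_self]
    have : ((1 - s) * N) x = 0 := by rw [h]; rfl
    exact (sub_eq_zero.mp this).symm
  let PX := dv.range.toAddSubgroup
  let DI := (LinearMap.range D).toAddSubgroup
  let jI := (LinearMap.range j).toAddSubgroup
  let A1 := PX.comap D.toAddMonoidHom
  let B := jI ⊔ PX
  let PJ := PX.comap j.toAddMonoidHom
  have hPFPJ : PF ≤ PJ := by
    intro b hb
    obtain ⟨x, _, hx⟩ := (hPF b).1 hb
    exact ⟨x, hx⟩
  have hNmPX : DI ⊔ PX ≤ PF.comap Nm.toAddMonoidHom := by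
    rw [sup_le_iff]
    constructor
    · rintro _ ⟨x, rfl⟩
      have : Nm (D x) = 0 := by
        apply hj
        rw [hNm, map_zero, ← Module.End.mul_apply, hND]; rfl
      change Nm (D x) ∈ PF
      rw [this]; exact zero_mem _
    · rintro _ ⟨x, rfl⟩
      change Nm (dv x) ∈ PF
      rw [hPF]
      exact ⟨N x, hsN x, by rw [hdvN, hNm]⟩
  have hPXA1 : PX ≤ A1 := by
    rintro _ ⟨x, rfl⟩
    refine ⟨x - s x, ?_⟩
    rw [map_sub, hdv]; rfl
  have hBA1 : B ≤ A1 := by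
    refine sup_le ?_ hPXA1
    rintro _ ⟨b, rfl⟩
    have : D (j b) = 0 := by
      change j b - r (j b) = 0
      rw [hrj, sub_self]
    change D (j b) ∈ PX
    rw [this]; exact zero_mem _
  -- step 1
  have st1 : PF.index ∣ (DI ⊔ PX).index := by
    have h1 : (PF.comap Nm.toAddMonoidHom).index = PF.index := by
      rw [index_comap, ← relIndex_sup_right, ← relIndex_top_right]
      congr 1
      rw [eq_top_iff]
      intro b _
      obtain ⟨a, ha⟩ := hsurj b
      rw [← add_sub_cancel (Nm a) b]
      exact add_mem (mem_sup_left ⟨a, rfl⟩) (mem_sup_right ha)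
    rw [← h1]
    exact index_dvd_of_le hNmPX
  -- step 2
  have st2 : (DI ⊔ PX).index = PX.relIndex A1 := by
    have h1 : A1.index = PX.relIndex (DI ⊔ PX) := by
      rw [relIndex_sup_right, index_comap]; rfl
    have h2 := relIndex_mul_index hPXA1
    have h3 := relIndex_mul_index (le_sup_right : PX ≤ DI ⊔ PX)
    have h4 : A1.index ≠ 0 := fun h => hfin (by rw [← h2, h, mul_zero])
    rw [← h1] at h3
    rw [mul_comm] at h2
    exact Nat.eq_of_mul_eq_mul_left (Nat.pos_of_ne_zero h4) (h3.trans h2.symm)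
  have st3 : PX.relIndex A1 = PJ.index * B.relIndex A1 := by
    rw [← relIndex_mul_relIndex PX B A1 le_sup_right hBA1]
    congr 1
    rw [relIndex_sup_right, index_comap]; rfl
  have st3' : PF.relIndex PJ * PJ.index = PF.index := relIndex_mul_index hPFPJ
  -- step 4
  have st4 : B.relIndex A1 ≤ (LinearMap.range (∑ i ∈ Finset.range ℓ, sE ^ i)).toAddSubgroup.relIndex
        (LinearMap.ker (1 - sE)).toAddSubgroup := by
    let G : AddSubgroup (I × X) :=
      { carrier := {p | D p.1 = dv p.2}
        zero_mem' := by simp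
        add_mem' := by
          intro a b ha hb
          simp only [Set.mem_ofPred_eq, Prod.fst_add, Prod.snd_add, map_add] at *
          rw [ha, hb]
        neg_mem' := by
          intro a ha
          simp only [Set.mem_ofPred_eq, Prod.fst_neg, Prod.snd_neg, map_neg] at *
          rw [ha] }
    have hG : ∀ g : G, dv (N g.1.2) = 0 := by
      intro g
      have : D g.1.1 = dv g.1.2 := g.2
      rw [hdvN, ← this, ← Module.End.mul_apply, hND]; rfl
    let q : G →+ LinearMap.ker dv :=
      { toFun := fun g => ⟨N g.1.2, hG g⟩
        map_zero' := by apply Subtype.ext; simp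
        map_add' := by intro a b; apply Subtype.ext; simp }
    refine relIndex_le_of_fiber ((AddMonoidHom.fst I X).comp G.subtype) q _ _ _ _ ?_ ?_ ?_ e0
    · rintro a ⟨x, hx⟩
      exact ⟨⟨(a, x), hx.symm⟩, rfl⟩
    · rintro _ ⟨g, rfl⟩
      apply Subtype.ext
      change N g.1.2 - s (N g.1.2) = 0
      rw [hsN, sub_self]
    · rintro g ⟨e, he⟩
      have he' : N (e : X) = N g.1.2 := by
        rw [← hNE]; exact congrArg Subtype.val he
      obtain ⟨y, hy⟩ := h90 (g.1.2 - e) (by rw [map_sub, he', sub_self])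
      have h1 : D g.1.1 = dv g.1.2 := g.2
      have h2 : dv (e : X) = 0 := e.2
      have h3 : dv g.1.2 = r (dv y) - dv y := by
        rw [← hdv, ← map_sub, ← hy, map_sub, h2, sub_zero]
      have h4 : r (g.1.1 + dv y) = g.1.1 + dv y := by
        have : g.1.1 - r g.1.1 = r (dv y) - dv y := by rw [← h3, ← h1]; rfl
        rw [map_add]
        rw [sub_eq_sub_iff_add_eq_add] at this
        rw [this, add_comm]
      obtain ⟨b, hb⟩ := hjr _ h4
      change g.1.1 ∈ jI ⊔ PX
      rw [← add_sub_cancel_right g.1.1 (dv y)]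
      exact sub_mem (mem_sup_left ⟨b, hb⟩) (mem_sup_right ⟨y, rfl⟩)
  -- step 5
  have hPJ0 : PF.relIndex PJ ≠ 0 := fun h => hPF0 (by rw [← st3', h, zero_mul])
  have st5 : (LinearMap.range (1 - sE)).toAddSubgroup.relIndex
        (LinearMap.ker (∑ i ∈ Finset.range ℓ, sE ^ i)).toAddSubgroup ≤ PF.relIndex PJ := by
    let G : AddSubgroup (X × J) :=
      { carrier := {p | dv p.1 = j p.2}
        zero_mem' := by simp
        add_mem' := by
          intro a b ha hb
          simp only [Set.mem_ofPred_eq, Prod.fst_add, Prod.snd_add, map_add] at *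
          rw [ha, hb]
        neg_mem' := by
          intro a ha
          simp only [Set.mem_ofPred_eq, Prod.fst_neg, Prod.snd_neg, map_neg] at *
          rw [ha] }
    have hG : ∀ g : G, dv (s g.1.1 - g.1.1) = 0 := by
      intro g
      have : dv g.1.1 = j g.1.2 := g.2
      rw [map_sub, hdv, this, hrj, sub_self]
    let p : G →+ LinearMap.ker dv :=
      { toFun := fun g => ⟨s g.1.1 - g.1.1, hG g⟩
        map_zero' := by apply Subtype.ext; simp
        map_add' := by intro a b; apply Subtype.ext; simp; abel }
    refine relIndex_le_of_fiber p ((AddMonoidHom.snd X J).comp G.subtype) _ _ _ _ ?_ ?_ ?_ hPJ0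
    · rintro e he
      have he' : N (e : X) = 0 := by
        rw [← hNE]; exact congrArg Subtype.val he
      obtain ⟨y, hy⟩ := h90 _ he'
      have h2 : dv (e : X) = 0 := e.2
      obtain ⟨b, hb⟩ := hjr (dv y) (by
        rw [← sub_eq_zero, ← hdv, ← map_sub, ← hy, h2])
      exact ⟨⟨(y, b), hb.symm⟩, Subtype.ext hy.symm⟩
    · rintro _ ⟨g, rfl⟩
      exact ⟨g.1.1, g.2⟩
    · intro g hg
      obtain ⟨x0, hx0, hx1⟩ := (hPF _).1 (show g.1.2 ∈ PF from hg)
      have h1 : dv g.1.1 = j g.1.2 := g.2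
      refine ⟨⟨x0 - g.1.1, ?_⟩, ?_⟩
      · rw [LinearMap.mem_ker, map_sub, hx1, h1, sub_self]
      · apply Subtype.ext
        change (x0 - g.1.1) - s (x0 - g.1.1) = s g.1.1 - g.1.1
        rw [map_sub, hx0]; abel
  have hPJi : PJ.index ≠ 0 := fun h => hPF0 (by rw [← st3', h, mul_zero])
  have hA : (DI ⊔ PX).index ≠ 0 := fun h => by
    have := relIndex_mul_index (le_sup_right : PX ≤ DI ⊔ PX)
    rw [h, mul_zero] at this
    exact hfin this.symm
  have f1 := Nat.le_of_dvd (Nat.pos_of_ne_zero hA) st1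
  rw [st2, st3, ← st3', mul_comm] at f1
  have f2 := Nat.le_of_mul_le_mul_left f1 (Nat.pos_of_ne_zero hPJi)
  have f3 := hl.out.two_le
  have f4 := Nat.pos_of_ne_zero e0
  have f5 := (e1.trans st5).trans (f2.trans st4)
  nlinarith

end HCF


namespace HCF
open Module NumberField IsDedekindDomain WithZero
open scoped nonZeroDivisors

abbrev Pl (K : Type*) [Field K] [NumberField K] := HeightOneSpectrum (𝓞 K)

section
variable {K : Type*} [Field K] [NumberField K]

/-- order at v -/
noncomputable def ord (v : Pl K) (x : K) : ℤ := - log (v.valuation K x)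

theorem val_ne_zero (v : Pl K) {x : K} (hx : x ≠ 0) : v.valuation K x ≠ 0 :=
  (Valuation.ne_zero_iff _).2 hx

theorem val_eq_exp (v : Pl K) {x : K} (hx : x ≠ 0) : v.valuation K x = exp (- ord v x) := by
  simp [ord, exp_log (val_ne_zero v hx)]

theorem ord_eq_zero_iff (v : Pl K) {x : K} (hx : x ≠ 0) : ord v x = 0 ↔ v.valuation K x = 1 := by
  rw [val_eq_exp v hx, exp_eq_one, neg_eq_zero]

theorem ord_mul (v : Pl K) {x y : K} (hx : x ≠ 0) (hy : y ≠ 0) :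
    ord v (x * y) = ord v x + ord v y := by
  simp [ord, log_mul (val_ne_zero v hx) (val_ne_zero v hy)]; ring

theorem finite_ord (x : K) (hx : x ≠ 0) : {v : Pl K | ord v x ≠ 0}.Finite := by
  refine ((HeightOneSpectrum.Support.finite (𝓞 K) x).union
    (HeightOneSpectrum.Support.finite (𝓞 K) x⁻¹)).subset ?_
  intro v hv
  have hv : v.valuation K x ≠ 1 := fun h => hv ((ord_eq_zero_iff v hx).2 h)
  rcases lt_or_gt_of_ne hv with h | h
  · right
    change 1 < v.valuation K x⁻¹
    rw [map_inv₀]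
    exact (one_lt_inv₀ (zero_lt_iff.2 (val_ne_zero v hx))).2 h
  · left; exact h

/-- principal divisors -/
noncomputable def dv (K : Type*) [Field K] [NumberField K] : Additive Kˣ →+ (Pl K →₀ ℤ) where
  toFun x := Finsupp.ofSupportFinite (fun v => ord v (x.toMul : K)) (finite_ord _ (Units.ne_zero _))
  map_zero' := by ext v; simp [Finsupp.ofSupportFinite, ord]
  map_add' x y := by
    ext v
    simp only [Finsupp.ofSupportFinite, Finsupp.coe_mk, Finsupp.add_apply, toMul_add, Units.val_mul]
    exact ord_mul v (Units.ne_zero _) (Units.ne_zero _)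

theorem dv_apply (x : Kˣ) (v : Pl K) : dv K (.ofMul x) v = ord v (x : K) := rfl

theorem ord_algebraMap (v : Pl K) {r : 𝓞 K} (hr : r ≠ 0) :
    ord v (r : K) = FractionalIdeal.count K v (Ideal.span {r} : Ideal (𝓞 K)) := by
  rw [FractionalIdeal.count_coe K v (by simpa using hr), ord, HeightOneSpectrum.valuation_of_algebraMap,
    HeightOneSpectrum.intValuation_if_neg _ hr]
  simp

theorem count_span (v : Pl K) {x : K} (hx : x ≠ 0) :
    FractionalIdeal.count K v (FractionalIdeal.spanSingleton (𝓞 K)⁰ x) = ord v x := by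
  obtain ⟨a, b, hb, rfl⟩ := IsFractionRing.div_surjective (A := 𝓞 K) x
  have hb0 : b ≠ 0 := nonZeroDivisors.ne_zero hb
  have ha0 : a ≠ 0 := by rintro rfl; simp at hx
  have hbK : (b : K) ≠ 0 := by simpa using hb0
  have haK : (a : K) ≠ 0 := by simpa using ha0
  have e : (Ideal.span {a} : FractionalIdeal (𝓞 K)⁰ K) =
    FractionalIdeal.spanSingleton (𝓞 K)⁰ ((a : K) / b) * (Ideal.span {b} : FractionalIdeal (𝓞 K)⁰ K) := by
    rw [FractionalIdeal.coeIdeal_span_singleton, FractionalIdeal.coeIdeal_span_singleton,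
      FractionalIdeal.spanSingleton_mul_spanSingleton, div_mul_cancel₀ _ hbK]
  have h1 := ord_mul v hx hbK
  rw [div_mul_cancel₀ _ hbK, ord_algebraMap v ha0, ord_algebraMap v hb0, e,
    FractionalIdeal.count_mul] at h1
  · exact add_right_cancel h1
  · simpa [FractionalIdeal.spanSingleton_eq_zero_iff] using hx
  · simpa [FractionalIdeal.spanSingleton_eq_zero_iff] using hb0

noncomputable def plUnit (v : Pl K) : (FractionalIdeal (𝓞 K)⁰ K)ˣ :=
  FractionalIdeal.mk0 K ⟨v.asIdeal, mem_nonZeroDivisors_of_ne_zero v.ne_bot⟩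

noncomputable def fid (K : Type*) [Field K] [NumberField K] :
    (Pl K →₀ ℤ) →+ Additive (FractionalIdeal (𝓞 K)⁰ K)ˣ :=
  Finsupp.liftAddHom (fun v => zmultiplesHom _ (Additive.ofMul (plUnit v)))

theorem count_fid (D : Pl K →₀ ℤ) (v : Pl K) :
    FractionalIdeal.count K v ((fid K D).toMul : (FractionalIdeal (𝓞 K)⁰ K)ˣ) = D v := by
  classical
  induction D using Finsupp.induction_linear with
  | zero => simp [FractionalIdeal.count_one]
  | add f g hf hg =>
    rw [map_add, toMul_add, Units.val_mul, FractionalIdeal.count_mul, hf, hg, Finsupp.add_apply]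
    exacts [Units.ne_zero _, Units.ne_zero _]
  | single w n =>
    simp only [fid, Finsupp.liftAddHom_apply_single, zmultiplesHom_apply, toMul_zsmul, toMul_ofMul]
    rw [Units.val_zpow_eq_zpow_val, FractionalIdeal.count_zpow]
    simp only [plUnit, FractionalIdeal.coe_mk0, FractionalIdeal.count_maximal, Finsupp.single_apply]
    simp [eq_comm]

theorem frac_ext {I J : (FractionalIdeal (𝓞 K)⁰ K)ˣ}
    (h : ∀ v : Pl K, FractionalIdeal.count K v (I : FractionalIdeal (𝓞 K)⁰ K)
      = FractionalIdeal.count K v (J : FractionalIdeal (𝓞 K)⁰ K)) : I = J := by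
  ext1
  rw [← FractionalIdeal.finprod_heightOneSpectrum_factorization' K (Units.ne_zero I),
    ← FractionalIdeal.finprod_heightOneSpectrum_factorization' K (Units.ne_zero J)]
  simp_rw [h]

theorem fid_dv (x : Kˣ) : (fid K (dv K (.ofMul x))).toMul = toPrincipalIdeal (𝓞 K) K x := by
  apply frac_ext
  intro v
  rw [count_fid, coe_toPrincipalIdeal, count_span v (Units.ne_zero x), dv_apply]

/-- class map -/
noncomputable def clD (K : Type*) [Field K] [NumberField K] :
    (Pl K →₀ ℤ) →+ Additive (ClassGroup (𝓞 K)) :=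
  (MonoidHom.toAdditive (ClassGroup.mk (R := 𝓞 K) K)).comp (fid K)

theorem clD_single (v : Pl K) : clD K (Finsupp.single v 1) =
    .ofMul (ClassGroup.mk0 ⟨v.asIdeal, mem_nonZeroDivisors_of_ne_zero v.ne_bot⟩) := by
  rw [← ClassGroup.mk_mk0 K]
  simp [clD, fid, plUnit]

theorem clD_eq_zero_iff (D : Pl K →₀ ℤ) : clD K D = 0 ↔ ∃ x : Kˣ, dv K (.ofMul x) = D := by
  have : clD K D = 0 ↔ (fid K D).toMul ∈ (toPrincipalIdeal (𝓞 K) K).range := by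
    change Additive.ofMul (ClassGroup.mk K (fid K D).toMul) = 0 ↔ _
    rw [ofMul_eq_zero, ClassGroup.mk_eq_one_iff, mem_principal_ideals_iff]
    refine (Submodule.isPrincipal_iff _).trans ?_
    constructor
    · rintro ⟨a, ha⟩
      refine ⟨a, ?_⟩
      rw [← FractionalIdeal.coeToSubmodule_inj, ha, FractionalIdeal.coe_spanSingleton]
    · rintro ⟨a, ha⟩
      exact ⟨a, by rw [← ha, FractionalIdeal.coe_spanSingleton]⟩
  rw [this]
  constructor
  · rintro ⟨x, hx⟩
    refine ⟨x, ?_⟩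
    ext v
    rw [← count_fid D v, ← hx, coe_toPrincipalIdeal, count_span v (Units.ne_zero x), dv_apply]
  · rintro ⟨x, rfl⟩
    exact ⟨x, (fid_dv x).symm⟩

end
end HCF


namespace HCF
open Module NumberField IsDedekindDomain WithZero
open scoped nonZeroDivisors

section
variable {K : Type*} [Field K] [NumberField K]

theorem exists_b (n : Ideal (𝓞 K)) (x : K) (hx : ∀ v : Pl K, n ≤ v.asIdeal → v.valuation K x ≤ 1) :
    ∃ b a : 𝓞 K, b - 1 ∈ n ∧ (algebraMap (𝓞 K) K b) * x = algebraMap (𝓞 K) K a := by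
  let D : Ideal (𝓞 K) :=
    { carrier := {b | ∃ a : 𝓞 K, (algebraMap (𝓞 K) K b) * x = algebraMap (𝓞 K) K a}
      add_mem' := by
        rintro b c ⟨a, ha⟩ ⟨a', ha'⟩
        exact ⟨a + a', by simp [add_mul, ha, ha']⟩
      zero_mem' := ⟨0, by simp⟩
      smul_mem' := by
        rintro c b ⟨a, ha⟩
        exact ⟨c * a, by simp [mul_assoc, ha]⟩ }
  have h1 : D ⊔ n = ⊤ := by
    by_contra hne
    obtain ⟨m, hm, hle⟩ := Ideal.exists_le_maximal _ hne
    have hD0 : D ≠ ⊥ := by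
      obtain ⟨a, b, hb, rfl⟩ := IsFractionRing.div_surjective (A := 𝓞 K) x
      have hb0 : b ≠ 0 := nonZeroDivisors.ne_zero hb
      intro h
      have : b ∈ D := ⟨a, by rw [mul_div_cancel₀]; simpa using hb0⟩
      rw [h] at this
      exact hb0 this
    let v : Pl K := ⟨m, hm.isPrime, fun h => hD0 (by
      rw [eq_bot_iff, ← h]; exact le_sup_left.trans hle)⟩
    obtain ⟨b, a, hab⟩ := v.exists_primeCompl_mul_eq_of_integer x (hx v (le_sup_right.trans hle))
    have : (a : 𝓞 K) ∈ D := ⟨b, by rw [mul_comm]; exact hab⟩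
    exact a.2 (hle (Ideal.mem_sup_left this))
  obtain ⟨b, ⟨a, ha⟩, c, hc, hbc⟩ := Submodule.mem_sup.1 (h1 ▸ Submodule.mem_top : (1 : 𝓞 K) ∈ D ⊔ n)
  refine ⟨b, a, ?_, ha⟩
  have : b - 1 = - c := by rw [← hbc]; ring
  rw [this]; exact n.neg_mem hc

/-- semilocal ring at n -/
def Rn (n : Ideal (𝓞 K)) : Subring K where
  carrier := {x | ∀ v : Pl K, n ≤ v.asIdeal → v.valuation K x ≤ 1}
  mul_mem' hx hy v hv := by rw [map_mul]; exact mul_le_one' (hx v hv) (hy v hv)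
  one_mem' v hv := by simp
  add_mem' hx hy v hv := (Valuation.map_add_le _ (hx v hv) (hy v hv))
  zero_mem' v hv := by simp
  neg_mem' hx v hv := by rw [Valuation.map_neg]; exact hx v hv

noncomputable def redFun (n : Ideal (𝓞 K)) (x : Rn n) : 𝓞 K ⧸ n :=
  Ideal.Quotient.mk n (exists_b n x x.2).choose_spec.choose

theorem redFun_eq (n : Ideal (𝓞 K)) (x : Rn n) (b a : 𝓞 K) (hb : b - 1 ∈ n) (h : (algebraMap (𝓞 K) K b) * x = algebraMap (𝓞 K) K a) :
    redFun n x = Ideal.Quotient.mk n a := by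
  obtain ⟨h1, h2⟩ := (exists_b n x x.2).choose_spec.choose_spec
  set b' := (exists_b n x x.2).choose
  change Ideal.Quotient.mk n _ = _
  set a' := (exists_b n x x.2).choose_spec.choose
  have e : b * a' = b' * a := by
    apply RingOfIntegers.coe_injective
    simp only [map_mul]
    rw [← h, ← h2]; ring
  have hb1 : Ideal.Quotient.mk n b = 1 := by
    rw [← map_one (Ideal.Quotient.mk n)]; exact Ideal.Quotient.eq.2 hb
  have hb1' : Ideal.Quotient.mk n b' = 1 := by
    rw [← map_one (Ideal.Quotient.mk n)]; exact Ideal.Quotient.eq.2 h1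
  have := congrArg (Ideal.Quotient.mk n) e
  simpa [hb1, hb1'] using this

/-- reduction -/
noncomputable def red (n : Ideal (𝓞 K)) : Rn n →+* 𝓞 K ⧸ n where
  toFun := redFun n
  map_one' := by rw [redFun_eq n 1 1 1 (by simp) (by simp)]; simp
  map_zero' := by rw [redFun_eq n 0 1 0 (by simp) (by simp)]; simp
  map_mul' x y := by
    obtain ⟨b, a, hb, h⟩ := exists_b n x x.2
    obtain ⟨c, d, hc, h'⟩ := exists_b n y y.2
    rw [redFun_eq n x b a hb h, redFun_eq n y c d hc h', ← map_mul]
    apply redFun_eq n _ (b * c) (a * d)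
    · have : b * c - 1 = (b - 1) * c + (c - 1) := by ring
      rw [this]; exact n.add_mem (n.mul_mem_right _ hb) hc
    · simp only [map_mul, Subring.coe_mul]; rw [← h, ← h']; ring
  map_add' x y := by
    obtain ⟨b, a, hb, h⟩ := exists_b n x x.2
    obtain ⟨c, d, hc, h'⟩ := exists_b n y y.2
    have h1 : b * c - 1 ∈ n := by
      have : b * c - 1 = (b - 1) * c + (c - 1) := by ring
      rw [this]; exact n.add_mem (n.mul_mem_right _ hb) hc
    rw [redFun_eq n x (b * c) (a * c) h1 (by simp only [map_mul]; rw [← h]; ring),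
      redFun_eq n y (b * c) (b * d) h1 (by simp only [map_mul]; rw [← h']; ring), ← map_add]
    apply redFun_eq n _ (b * c) _ h1
    simp only [map_mul, map_add, Subring.coe_add]; rw [← h, ← h']; ring

theorem mem_Rn (n : Ideal (𝓞 K)) (a : 𝓞 K) : (algebraMap (𝓞 K) K a) ∈ Rn n := fun v _ => v.valuation_le_one a

theorem red_coe (n : Ideal (𝓞 K)) (a : 𝓞 K) : red n ⟨a, mem_Rn n a⟩ = Ideal.Quotient.mk n a :=
  redFun_eq n _ 1 a (by simp) (by simp)

theorem red_eq_zero {n : Ideal (𝓞 K)} {x : Rn n} (h : red n x = 0) :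
    ∃ a ∈ n, ∀ v : Pl K, n ≤ v.asIdeal → v.valuation K (x : K) = v.valuation K (algebraMap (𝓞 K) K a) := by
  obtain ⟨b, a, hb, hab⟩ := exists_b n x x.2
  refine ⟨a, ?_, fun v hv => ?_⟩
  · rw [← Ideal.Quotient.eq_zero_iff_mem, ← redFun_eq n x b a hb hab]; exact h
  · rw [← hab, map_mul]
    have : v.valuation K (algebraMap (𝓞 K) K b) = 1 := by
      rw [HeightOneSpectrum.valuation_eq_one_iff_notMem]
      intro hbv
      apply v.isPrime.ne_top
      rw [Ideal.eq_top_iff_one]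
      have := v.asIdeal.sub_mem hbv (hv hb)
      simpa using this
    rw [this, one_mul]

/-- units at n -/
def Yn (n : Ideal (𝓞 K)) : Subgroup Kˣ where
  carrier := {x | ∀ v : Pl K, n ≤ v.asIdeal → v.valuation K (x : K) = 1}
  mul_mem' hx hy v hv := by rw [Units.val_mul, map_mul, hx v hv, hy v hv, one_mul]
  one_mem' v hv := by simp
  inv_mem' hx v hv := by rw [Units.val_inv_eq_inv_val, map_inv₀, hx v hv, inv_one]

def YnR (n : Ideal (𝓞 K)) : Yn n →* Rn n where
  toFun x := ⟨(x : Kˣ), fun v hv => (x.2 v hv).le⟩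
  map_one' := rfl
  map_mul' _ _ := rfl

noncomputable def redU (n : Ideal (𝓞 K)) : Yn n →* (𝓞 K ⧸ n)ˣ :=
  ((red n : Rn n →* 𝓞 K ⧸ n).comp (YnR n)).toHomUnits

theorem redU_coe (n : Ideal (𝓞 K)) (x : Yn n) : (redU n x : 𝓞 K ⧸ n) = red n (YnR n x) := rfl

theorem val_sub_lt_of_red_eq {v : Pl K} {x y : Rn v.asIdeal} (h : red _ x = red _ y) :
    v.valuation K ((x : K) - y) < 1 := by
  have : red _ (x - y) = 0 := by rw [map_sub, h, sub_self]
  obtain ⟨a, ha, h'⟩ := red_eq_zero this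
  rw [← AddSubgroupClass.coe_sub, h' v le_rfl, HeightOneSpectrum.valuation_lt_one_iff_mem]
  exact ha

theorem red_eq_of_val_sub_lt {v : Pl K} {x y : Rn v.asIdeal} (h : v.valuation K ((x : K) - y) < 1) :
    red _ x = red _ y := by
  rw [← sub_eq_zero, ← map_sub]
  obtain ⟨b, a, hb, hab⟩ := exists_b _ ((x - y : Rn v.asIdeal) : K) (x - y).2
  change redFun _ _ = _
  rw [redFun_eq _ _ b a hb hab, Ideal.Quotient.eq_zero_iff_mem,
    ← v.valuation_lt_one_iff_mem (K := K)]
  change v.valuation K (algebraMap (𝓞 K) K a) < 1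
  rw [← hab, map_mul]
  exact lt_of_le_of_lt (mul_le_of_le_one_left' (v.valuation_le_one b)) h

instance (v : Pl K) : Finite (𝓞 K ⧸ v.asIdeal) :=
  Ideal.finiteQuotientOfFreeOfNeBot _ v.ne_bot

end
end HCF


namespace HCF
open Module NumberField IsDedekindDomain WithZero
open scoped nonZeroDivisors Pointwise

section
set_option linter.unusedSectionVars false
variable {F L : Type*} [Field F] [Field L] [NumberField F] [NumberField L] [Algebra F L]

instance plAction : MulAction (L ≃ₐ[F] L) (Pl L) where
  smul g Q := ⟨g • Q.asIdeal, inferInstance, fun h => Q.ne_bot (by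
    rw [← inv_smul_smul g Q.asIdeal, h]; simp [Ideal.pointwise_smul_def, Ideal.map_bot])⟩
  one_smul Q := HeightOneSpectrum.ext (one_smul _ _)
  mul_smul g h Q := HeightOneSpectrum.ext (mul_smul _ _ _)

theorem smul_asIdeal (g : L ≃ₐ[F] L) (Q : Pl L) : (g • Q).asIdeal = g • Q.asIdeal := rfl

theorem coe_smul_int (g : L ≃ₐ[F] L) (x : 𝓞 L) :
    algebraMap (𝓞 L) L (g • x) = g (algebraMap (𝓞 L) L x) := rfl

theorem eq_of_le_exp {a b : ℤᵐ⁰} (ha : a ≤ 1) (hb : b ≤ 1) (ha0 : a ≠ 0) (hb0 : b ≠ 0)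
    (h : ∀ n : ℕ, a ≤ exp (-(n : ℤ)) ↔ b ≤ exp (-(n : ℤ))) : a = b := by
  obtain ⟨x, rfl⟩ : ∃ x, exp x = a := ⟨_, exp_log ha0⟩
  obtain ⟨y, rfl⟩ : ∃ x, exp x = b := ⟨_, exp_log hb0⟩
  rw [← exp_zero, exp_le_exp] at ha hb
  simp only [exp_le_exp] at h
  obtain ⟨m, hm⟩ := Int.eq_ofNat_of_zero_le (neg_nonneg.2 ha)
  obtain ⟨k, hk⟩ := Int.eq_ofNat_of_zero_le (neg_nonneg.2 hb)
  have h1 := (h m).1 (by omega)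
  have h2 := (h k).2 (by omega)
  congr 1
  omega

theorem smul_val_int (g : L ≃ₐ[F] L) (Q : Pl L) (x : 𝓞 L) :
    (g • Q).intValuation (g • x) = Q.intValuation x := by
  by_cases hx : x = 0
  · simp [hx]
  have hgx : g • x ≠ 0 := fun h => hx (by rw [← inv_smul_smul g x, h, smul_zero])
  refine eq_of_le_exp (HeightOneSpectrum.intValuation_le_one _ _)
    (HeightOneSpectrum.intValuation_le_one _ _) (HeightOneSpectrum.intValuation_ne_zero _ _ hgx)
    (HeightOneSpectrum.intValuation_ne_zero _ _ hx) fun n => ?_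
  rw [HeightOneSpectrum.intValuation_le_pow_iff_mem, HeightOneSpectrum.intValuation_le_pow_iff_mem,
    smul_asIdeal, ← smul_pow', Ideal.smul_mem_pointwise_smul_iff]

theorem smul_val (g : L ≃ₐ[F] L) (Q : Pl L) (x : L) :
    (g • Q).valuation L (g x) = Q.valuation L x := by
  obtain ⟨a, b, hb, rfl⟩ := IsFractionRing.div_surjective (A := 𝓞 L) x
  rw [map_div₀, map_div₀, map_div₀, ← coe_smul_int, ← coe_smul_int,
    HeightOneSpectrum.valuation_of_algebraMap, HeightOneSpectrum.valuation_of_algebraMap,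
    HeightOneSpectrum.valuation_of_algebraMap, HeightOneSpectrum.valuation_of_algebraMap,
    smul_val_int, smul_val_int]

variable (F) in
noncomputable abbrev und (Q : Pl L) : Pl F := Q.under (𝓞 F)

instance : SMulCommClass (L ≃ₐ[F] L) (𝓞 F) (𝓞 L) where
  smul_comm g a x := by
    apply RingOfIntegers.coe_injective
    change g (algebraMap (𝓞 L) L (a • x)) = algebraMap (𝓞 L) L (a • (g • x))
    rw [Algebra.smul_def, Algebra.smul_def, map_mul, map_mul, map_mul, coe_smul_int,
      ← IsScalarTower.algebraMap_apply, IsScalarTower.algebraMap_apply (𝓞 F) F L, AlgEquiv.commutes]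

instance (Q : Pl L) : Q.asIdeal.LiesOver (und F Q).asIdeal := ⟨rfl⟩

theorem und_smul (g : L ≃ₐ[F] L) (Q : Pl L) : und F (g • Q) = und F Q :=
  HeightOneSpectrum.ext (Ideal.under_smul (𝓞 F) Q.asIdeal g)

theorem exists_smul [IsGalois F L] {P Q : Pl L} (h : und F P = und F Q) :
    ∃ g : L ≃ₐ[F] L, g • P = Q := by
  obtain ⟨g, hg⟩ := Algebra.IsInvariant.exists_smul_of_under_eq (𝓞 F) (𝓞 L) (L ≃ₐ[F] L) P.asIdeal
    Q.asIdeal (congrArg HeightOneSpectrum.asIdeal h)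
  exact ⟨g, HeightOneSpectrum.ext hg.symm⟩

variable (F L) in
theorem und_surj : Function.Surjective (und F : Pl L → Pl F) := by
  intro v
  obtain ⟨P, hP, h⟩ := v.asIdeal.exists_ideal_over_prime_of_isIntegral_of_isDomain (S := 𝓞 L)
    (by simp)
  refine ⟨⟨P, hP, ?_⟩, HeightOneSpectrum.ext h⟩
  rintro rfl
  apply v.ne_bot
  rw [← h]
  exact Ideal.comap_bot_of_injective _ (FaithfulSMul.algebraMap_injective (𝓞 F) (𝓞 L))

/-- valuation comparision -/
theorem und_val_pow (Q : Pl L) (x : F) :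
    ∃ e : ℕ, 0 < e ∧ ∀ x : F, Q.valuation L (algebraMap F L x) = (und F Q).valuation F x ^ e :=
  ⟨_, Nat.pos_of_ne_zero (Ideal.IsDedekindDomain.ramificationIdx'_ne_zero_of_liesOver Q.asIdeal
    (und F Q).ne_bot), fun x => (HeightOneSpectrum.valuation_liesOver L (und F Q) Q x).symm⟩

theorem und_val_eq_one (Q : Pl L) (x : F) :
    Q.valuation L (algebraMap F L x) = 1 ↔ (und F Q).valuation F x = 1 := by
  obtain ⟨e, he, h⟩ := und_val_pow Q x
  rw [h, pow_eq_one_iff_of_nonneg zero_le he.ne']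

theorem und_val_lt_one (Q : Pl L) (x : F) :
    Q.valuation L (algebraMap F L x) < 1 ↔ (und F Q).valuation F x < 1 := by
  obtain ⟨e, he, h⟩ := und_val_pow Q x
  rw [h, pow_lt_one_iff_of_nonneg zero_le he.ne']

theorem und_val_le_one (Q : Pl L) (x : F) :
    Q.valuation L (algebraMap F L x) ≤ 1 ↔ (und F Q).valuation F x ≤ 1 := by
  obtain ⟨e, he, h⟩ := und_val_pow Q x
  rw [h, pow_le_one_iff_of_nonneg zero_le he.ne']

theorem finite_fiber (u : Pl F) : {Q : Pl L | und F Q = u}.Finite := by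
  have h := IsDedekindDomain.primesOver_finite u.asIdeal (𝓞 L)
  refine Set.Finite.of_finite_image (f := HeightOneSpectrum.asIdeal) (h.subset ?_)
    (fun a _ b _ h => HeightOneSpectrum.ext h)
  rintro _ ⟨Q, rfl, rfl⟩
  exact ⟨Q.isPrime, ⟨rfl⟩⟩

end
end HCF


namespace HCF
open Module

section
variable {I0 J0 : Type*}

noncomputable def pull (p : I0 → J0) (hfib : ∀ u, {a | p a = u}.Finite) :
    (J0 →₀ ℤ) →ₗ[ℤ] (I0 →₀ ℤ) where
  toFun b := Finsupp.ofSupportFinite (fun a => b (p a)) (by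
    refine (b.support.finite_toSet.biUnion (fun u _ => hfib u)).subset ?_
    intro a ha
    simp only [Set.mem_iUnion]
    exact ⟨p a, by simpa using ha, rfl⟩)
  map_add' a b := by ext; rfl
  map_smul' a b := by ext; rfl

theorem pull_apply (p : I0 → J0) (hfib : ∀ u, {a | p a = u}.Finite) (b : J0 →₀ ℤ) (a : I0) :
    pull p hfib b a = b (p a) := rfl

theorem ambiguous2 {X : Type*} [AddCommGroup X]
    (ℓ : ℕ) [hl : Fact ℓ.Prime] (s : Module.End ℤ X) (hs : s ^ ℓ = 1)
    (e : Equiv.Perm I0) (he : e ^ ℓ = 1) (p : I0 → J0) (hp : Function.Surjective p)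
    (hfib : ∀ u, {a | p a = u}.Finite) (hpe : ∀ a, p (e a) = p a)
    (htr : ∀ a b, p a = p b → ∃ k : ℕ, (e ^ k) a = b)
    (dv : X →ₗ[ℤ] (I0 →₀ ℤ)) (hdv : ∀ x a, dv (s x) (e a) = dv x a)
    (h90 : ∀ x, (∑ i ∈ Finset.range ℓ, s ^ i) x = 0 → ∃ y, x = s y - y)
    (hfin : dv.range.toAddSubgroup.index ≠ 0)
    [Module.Finite ℤ (LinearMap.ker dv)] [Module.IsTorsionFree ℤ (LinearMap.ker dv)]
    (n : ℕ) (hn : 0 < n)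
    (hE : finrank ℤ (LinearMap.ker dv) + 1 = ℓ * n)
    (hZ : finrank ℤ ↥(LinearMap.ker dv ⊓ LinearMap.ker (1 - s)) + 1 = n)
    (PF : AddSubgroup (J0 →₀ ℤ)) (hPF : ∀ b, b ∈ PF ↔ ∃ x, s x = x ∧ ∀ a, dv x a = b (p a))
    (hPF0 : PF.index ≠ 0)
    (hsurj : ∀ u, Finsupp.single u (1 : ℤ) ∈ AddSubgroup.closure
      ({D | ∃ u, D = (ℓ : ℤ) • Finsupp.single u (1 : ℤ)} ∪
       {D | ∃ a, (∀ k : ℕ, (e ^ k) a = a → ℓ ∣ k) ∧ D = Finsupp.single (p a) (1 : ℤ)} ∪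
       (PF : Set (J0 →₀ ℤ)))) : False := by
  classical
  set r : Module.End ℤ (I0 →₀ ℤ) := (Finsupp.domLCongr e : (I0 →₀ ℤ) ≃ₗ[ℤ] (I0 →₀ ℤ)).toLinearMap with hrdef
  have hr1 : ∀ (f : I0 →₀ ℤ) a, r f (e a) = f a := by
    intro f a; simp [hrdef, Finsupp.domLCongr_apply, Finsupp.domCongr]
  have hrk : ∀ (k : ℕ) (f : I0 →₀ ℤ) a, (r ^ k) f ((e ^ k) a) = f a := by
    intro k
    induction k with
    | zero => intro f a; simp
    | succ k ih => intro f a; rw [pow_succ', pow_succ', Module.End.mul_apply, Equiv.Perm.mul_apply, hr1, ih]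
  have hrs : ∀ (k : ℕ) (a : I0) (c : ℤ), (r ^ k) (Finsupp.single a c) = Finsupp.single ((e ^ k) a) c := by
    intro k a c
    ext b
    obtain ⟨b, rfl⟩ := (e ^ k).surjective b
    rw [hrk, Finsupp.single_apply, Finsupp.single_apply]
    simp
  have hr : r ^ ℓ = 1 := by
    ext a b
    simp [hrs, he]
  have hpk : ∀ (k : ℕ) a, p ((e ^ k) a) = p a := by
    intro k
    induction k with
    | zero => intro a; simp
    | succ k ih => intro a; rw [pow_succ', Equiv.Perm.mul_apply, hpe, ih]
  set j := pull p hfib with hjdef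
  have hj : Function.Injective j := by
    intro b c h
    ext u
    obtain ⟨a, rfl⟩ := hp u
    exact DFunLike.congr_fun h a
  have hjr : ∀ a, r a = a → ∃ b, j b = a := by
    intro f hf
    have hinv : ∀ k a, f ((e ^ k) a) = f a := by
      intro k
      induction k with
      | zero => intro a; simp
      | succ k ih =>
        intro a
        rw [pow_succ', Equiv.Perm.mul_apply, ← ih a]
        conv_lhs => rw [← hf]
        rw [hr1]
    choose q hq using hp
    have hfq : ∀ a, f (q (p a)) = f a := by
      intro a
      obtain ⟨k, hk⟩ := htr a (q (p a)) (hq _).symm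
      rw [← hk, hinv]
    refine ⟨Finsupp.ofSupportFinite (fun u => f (q u)) ?_, ?_⟩
    · refine (f.support.finite_toSet.image p).subset ?_
      intro u hu
      exact ⟨q u, by simpa using hu, hq u⟩
    · ext a
      exact hfq a
  have hrj : ∀ b, r (j b) = j b := by
    intro b
    ext a
    obtain ⟨a, rfl⟩ := e.surjective a
    rw [hr1]
    simp [hjdef, pull_apply, hpe]
  set Sr : Module.End ℤ (I0 →₀ ℤ) := ∑ i ∈ Finset.range ℓ, r ^ i with hSr
  have hrS : ∀ a, r (Sr a) = Sr a := by
    intro a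
    have h1 : r * Sr = Sr := by
      have h2 : (r - 1) * Sr = 0 := by
        have := mul_geom_sum r ℓ
        rw [hSr, this, hr, sub_self]
      rw [sub_mul, one_mul] at h2
      exact sub_eq_zero.1 h2
    exact LinearMap.congr_fun h1 a
  have hrange : ∀ a, Sr a ∈ LinearMap.range j := fun a => by
    obtain ⟨b, hb⟩ := hjr _ (hrS a); exact ⟨b, hb⟩
  set Nm : (I0 →₀ ℤ) →ₗ[ℤ] (J0 →₀ ℤ) :=
    (LinearEquiv.ofInjective j hj).symm.toLinearMap ∘ₗ (Sr.codRestrict (LinearMap.range j) hrange) with hNmd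
  have hNm : ∀ a, j (Nm a) = Sr a := by
    intro a
    have := LinearEquiv.apply_symm_apply (LinearEquiv.ofInjective j hj) (Sr.codRestrict (LinearMap.range j) hrange a)
    exact congrArg Subtype.val this
  refine ambiguous ℓ s r hs hr dv ?_ j hj hjr hrj Nm hNm h90 hfin n hn hE hZ PF ?_ hPF0 ?_
  · intro x
    ext a
    obtain ⟨a, rfl⟩ := e.surjective a
    rw [hr1, hdv]
  · intro b
    rw [hPF]
    constructor
    · rintro ⟨x, h1, h2⟩; exact ⟨x, h1, by ext a; exact h2 a⟩
    · rintro ⟨x, h1, h2⟩; exact ⟨x, h1, fun a => by rw [h2]; rfl⟩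
  · set H : AddSubgroup (J0 →₀ ℤ) := PF ⊔ Nm.range.toAddSubgroup with hH
    have hcl : AddSubgroup.closure
      ({D | ∃ u, D = (ℓ : ℤ) • Finsupp.single u (1 : ℤ)} ∪
       {D | ∃ a, (∀ k : ℕ, (e ^ k) a = a → ℓ ∣ k) ∧ D = Finsupp.single (p a) (1 : ℤ)} ∪
       (PF : Set (J0 →₀ ℤ))) ≤ H := by
      rw [AddSubgroup.closure_le]
      rintro D ((⟨u, rfl⟩ | ⟨a, ha, rfl⟩) | hD)
      · apply AddSubgroup.mem_sup_right
        refine ⟨j (Finsupp.single u 1), ?_⟩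
        apply hj
        rw [hNm, map_smul]
        have hk : ∀ k : ℕ, (r ^ k) (j (Finsupp.single u 1)) = j (Finsupp.single u 1) := by
          intro k
          induction k with
          | zero => simp
          | succ k ih => rw [pow_succ, Module.End.mul_apply, hrj, ih]
        simp [hSr, LinearMap.sum_apply, hk]
      · apply AddSubgroup.mem_sup_right
        refine ⟨Finsupp.single a 1, ?_⟩
        apply hj
        rw [hNm, hSr, LinearMap.sum_apply]
        simp_rw [hrs]
        ext b
        rw [pull_apply, Finsupp.finsetSum_apply]
        simp_rw [Finsupp.single_apply]
        have hinj : ∀ i < ℓ, ∀ i' < ℓ, (e ^ i) a = (e ^ i') a → i = i' := by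
          have key : ∀ i i', i ≤ i' → i' < ℓ → (e ^ i) a = (e ^ i') a → i = i' := by
            intro i i' hii hi' h
            obtain ⟨d, rfl⟩ := Nat.exists_eq_add_of_le hii
            rw [pow_add, Equiv.Perm.mul_apply] at h
            have := ha d ((e ^ i).injective h).symm
            have := Nat.eq_zero_of_dvd_of_lt this (by omega)
            omega
          intro i hi i' hi' h
          rcases le_total i i' with h' | h'
          · exact key i i' h' hi' h
          · exact (key i' i h' hi h.symm).symm
        by_cases hb : p a = p b
        · obtain ⟨k, hk⟩ := htr a b hb
          have hk' : (e ^ (k % ℓ)) a = b := by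
            rw [← hk]
            conv_rhs => rw [← Nat.mod_add_div k ℓ, pow_add, pow_mul, he, one_pow, mul_one]
          have hkl : k % ℓ < ℓ := Nat.mod_lt _ hl.out.pos
          rw [Finset.sum_eq_single (k % ℓ)]
          · simp [hk', hb]
          · intro i hi hne
            rw [if_neg]
            intro h
            exact hne (hinj i (Finset.mem_range.1 hi) _ hkl (h.trans hk'.symm))
          · intro h; exact absurd (Finset.mem_range.2 hkl) h
        · rw [if_neg hb, Finset.sum_eq_zero]
          intro i _
          rw [if_neg]
          rintro rfl
          exact hb (hpk i a).symm
      · exact AddSubgroup.mem_sup_left hD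
    intro b
    have hb : b ∈ H := by
      induction b using Finsupp.induction_linear with
      | zero => exact H.zero_mem
      | add f g hf hg => exact H.add_mem hf hg
      | single u n =>
        have : Finsupp.single u n = n • Finsupp.single u (1 : ℤ) := by simp
        rw [this]
        exact H.zsmul_mem (hcl (hsurj u)) n
    obtain ⟨x, hx, _, ⟨a, rfl⟩, rfl⟩ := AddSubgroup.mem_sup.1 hb
    exact ⟨a, by simpa using hx⟩

end
end HCF


namespace HCF
open Module NumberField IsDedekindDomain WithZero
open scoped nonZeroDivisors

section
variable {K : Type*} [Field K] [NumberField K]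

theorem val_eq_one_of_sub {v : Pl K} {x : K} (h : v.valuation K (x - 1) < 1) : v.valuation K x = 1 := by
  have := Valuation.map_add_eq_of_lt_right (v.valuation K) (x := x - 1) (y := 1) (by simpa using h)
  simpa using this

/-- ray subgroup -/
def Xs (S : Set (Pl K)) : Subgroup Kˣ where
  carrier := {x | ∀ v ∈ S, v.valuation K ((x : K) - 1) < 1}
  mul_mem' {x y} hx hy v hv := by
    have : ((x * y : Kˣ) : K) - 1 = x * (y - 1) + (x - 1) := by push_cast; ring
    rw [this]
    refine Valuation.map_add_lt _ ?_ (hx v hv)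
    rw [map_mul, val_eq_one_of_sub (hx v hv), one_mul]
    exact hy v hv
  one_mem' v hv := by simp
  inv_mem' {x} hx v hv := by
    have : ((x⁻¹ : Kˣ) : K) - 1 = - ((x : K)⁻¹ * (x - 1)) := by
      have := Units.ne_zero x
      push_cast; field_simp; ring
    rw [this, Valuation.map_neg, map_mul, map_inv₀, val_eq_one_of_sub (hx v hv), inv_one, one_mul]
    exact hx v hv

theorem mem_Xs {S : Set (Pl K)} {x : Kˣ} : x ∈ Xs S ↔ ∀ v ∈ S, v.valuation K ((x : K) - 1) < 1 := Iff.rfl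

/-- restricted divisor map -/
noncomputable def dvX (S : Set (Pl K)) : Additive (Xs S) →+ ({v : Pl K // v ∉ S} →₀ ℤ) :=
  (Finsupp.subtypeDomainAddMonoidHom (p := fun v => v ∉ S)).comp
    ((dv K).comp (MonoidHom.toAdditive (Xs S).subtype))

theorem dvX_apply (S : Set (Pl K)) (x : Xs S) (v : {v : Pl K // v ∉ S}) :
    dvX S (.ofMul x) v = ord v.1 ((x : Kˣ) : K) := rfl

theorem prod_le_iff (S : Finset (Pl K)) (v : Pl K) : (∏ w ∈ S, w.asIdeal) ≤ v.asIdeal ↔ v ∈ S := by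
  rw [v.isPrime.prod_le]
  constructor
  · rintro ⟨w, hw, h⟩
    have : w = v := HeightOneSpectrum.ext ((w.isMaximal.eq_of_le v.isPrime.ne_top h))
    exact this ▸ hw
  · intro h; exact ⟨v, h, le_rfl⟩

theorem prod_ne_bot (S : Finset (Pl K)) : (∏ w ∈ S, w.asIdeal) ≠ ⊥ := by
  rw [← Ideal.zero_eq_bot, Finset.prod_ne_zero_iff]
  intro w _; exact w.ne_bot

theorem dvX_index (S : Finset (Pl K)) : (dvX (S : Set (Pl K))).range.index ≠ 0 := by
  classical
  set n : Ideal (𝓞 K) := ∏ w ∈ S, w.asIdeal with hn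
  have : Finite (𝓞 K ⧸ n) := Ideal.finiteQuotientOfFreeOfNeBot _ (prod_ne_bot S)
  set D := ({v : Pl K // v ∉ (S : Set (Pl K))} →₀ ℤ)
  set ext : D →+ (Pl K →₀ ℤ) := Finsupp.mapDomain.addMonoidHom Subtype.val with hext
  have hextS : ∀ d : D, ∀ v ∈ S, ext d v = 0 := by
    intro d v hv
    apply Finsupp.mapDomain_of_notMem_range
    rintro ⟨w, rfl⟩
    exact w.2 hv
  have hexta : ∀ d : D, ∀ v, ext d v.1 = d v := by
    intro d v
    exact Finsupp.mapDomain_apply Subtype.val_injective _ _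
  set c : D →+ Additive (ClassGroup (𝓞 K)) := (clD K).comp ext
  have hker : c.ker.index ≠ 0 := AddSubgroup.FiniteIndex.index_ne_zero
  set dY : Additive (Yn n) →+ D := (Finsupp.subtypeDomainAddMonoidHom (p := fun v => v ∉ (S : Set (Pl K)))).comp
    ((dv K).comp (MonoidHom.toAdditive (Yn n).subtype)) with hdY
  have h1 : c.ker ≤ dY.range := by
    intro d hd
    obtain ⟨x, hx⟩ := (clD_eq_zero_iff _).1 (show clD K (ext d) = 0 from hd)
    have hxY : x ∈ Yn n := by
      intro v hv
      rw [prod_le_iff] at hv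
      rw [← ord_eq_zero_iff v (Units.ne_zero x), ← dv_apply, hx, hextS d v hv]
    refine ⟨.ofMul ⟨x, hxY⟩, ?_⟩
    ext v
    rw [← hexta d v, ← hx]
    rfl
  have h1' : dY.range.index ≠ 0 := fun h => hker (by
    have := AddSubgroup.index_dvd_of_le h1; rw [h] at this; exact zero_dvd_iff.1 this)
  -- kernel of reduction
  set kr : AddSubgroup (Additive (Yn n)) := (MonoidHom.toAdditive (redU n)).ker with hkr
  have hk : kr.index ≠ 0 := AddSubgroup.FiniteIndex.index_ne_zero
  have h2 : kr.map dY ≤ (dvX (S : Set (Pl K))).range := by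
    rintro _ ⟨x, hx, rfl⟩
    have hx' : redU n x.toMul = 1 := hx
    have hX : (x.toMul : Kˣ) ∈ Xs (S : Set (Pl K)) := by
      intro v hv
      have h3 : red n (YnR n x.toMul - 1) = 0 := by
        rw [map_sub, ← redU_coe, hx', map_one]; simp
      obtain ⟨a, ha, hav⟩ := red_eq_zero h3
      have hv' := (prod_le_iff S v).2 hv
      have := hav v hv'
      change v.valuation K (((YnR n x.toMul - 1 : Rn n) : K)) < 1
      rw [this, HeightOneSpectrum.valuation_lt_one_iff_mem]
      exact hv' ha
    exact ⟨.ofMul ⟨_, hX⟩, rfl⟩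
  have h3 : (kr.map dY).relIndex dY.range ≠ 0 := by
    have : (⊤ : AddSubgroup _).map dY = dY.range := by
      rw [AddMonoidHom.range_eq_map]
    rw [← this]
    intro h
    have h4 := AddSubgroup.relIndex_map_map dY kr ⊤
    rw [h] at h4
    have h5 : (kr ⊔ dY.ker).relIndex (⊤ ⊔ dY.ker) ∣ kr.index := by
      rw [top_sup_eq, AddSubgroup.relIndex_top_right]
      exact AddSubgroup.index_dvd_of_le le_sup_left
    rw [← h4] at h5
    exact hk (zero_dvd_iff.1 h5)
  have h4 : (kr.map dY).index ≠ 0 := by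
    rw [← AddSubgroup.relIndex_mul_index (show kr.map dY ≤ dY.range from by
      rintro _ ⟨x, _, rfl⟩; exact ⟨x, rfl⟩)]
    exact mul_ne_zero h3 h1'
  intro h
  have := AddSubgroup.index_dvd_of_le h2
  rw [h] at this
  exact h4 (zero_dvd_iff.1 this)

end
end HCF


namespace HCF
open Module NumberField IsDedekindDomain WithZero
open scoped nonZeroDivisors

section
variable {K : Type*} [Field K] [NumberField K]

theorem exists_unit (x : Kˣ) (h : ∀ v : Pl K, v.valuation K (x : K) = 1) :
    ∃ u : (𝓞 K)ˣ, Units.map (algebraMap (𝓞 K) K).toMonoidHom u = x := by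
  obtain ⟨a, ha⟩ := HeightOneSpectrum.mem_integers_of_valuation_le_one K (x : K) (fun v => (h v).le)
  obtain ⟨b, hb⟩ := HeightOneSpectrum.mem_integers_of_valuation_le_one K ((x⁻¹ : Kˣ) : K) (fun v => by
    rw [Units.val_inv_eq_inv_val, map_inv₀, h v, inv_one])
  have hab : a * b = 1 := by
    apply FaithfulSMul.algebraMap_injective (𝓞 K) K
    rw [map_mul, ha, hb, map_one]; simp
  refine ⟨⟨a, b, hab, by rw [mul_comm, hab]⟩, ?_⟩
  ext; exact ha

theorem val_unit (u : (𝓞 K)ˣ) (v : Pl K) : v.valuation K (algebraMap (𝓞 K) K u) = 1 := by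
  apply (HeightOneSpectrum.valuation_eq_one_iff_notMem v).2
  intro h
  exact v.isPrime.ne_top (Ideal.eq_top_of_isUnit_mem _ h u.isUnit)

theorem real_root_one [IsTotallyReal K] (x : K) (k : ℕ) (hk : k ≠ 0) (h : x ^ k = 1) : x = 1 ∨ x = -1 := by
  obtain ⟨φ⟩ : Nonempty (K →+* ℂ) := inferInstance
  have hr := IsTotallyReal.complexEmbedding_isReal φ
  have h1 : ‖φ x‖ = 1 := by
    have : ‖φ x‖ ^ k = 1 := by rw [← norm_pow, ← map_pow, h]; simp
    exact (pow_eq_one_iff_of_nonneg (norm_nonneg _) hk).1 this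
  have h2 : φ x = hr.embedding x := (hr.coe_embedding_apply x).symm
  rw [h2, Complex.norm_real, Real.norm_eq_abs] at h1
  rcases eq_or_eq_neg_of_abs_eq h1 with h3 | h3
  · left; apply φ.injective; rw [h2, h3]; simp
  · right; apply φ.injective; rw [h2, h3]; simp

/-- the unit subgroup of ray units -/
def ES (S : Set (Pl K)) : Subgroup (𝓞 K)ˣ := (Xs S).comap (Units.map (algebraMap (𝓞 K) K).toMonoidHom)

/-- the kernel of the divisor map on the ray group -/
noncomputable abbrev kX (S : Set (Pl K)) : Submodule ℤ (Additive (Xs S)) := LinearMap.ker (dvX S).toIntLinearMap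

theorem mem_kX (S : Set (Pl K)) (x : Xs S) : (Additive.ofMul x : Additive (Xs S)) ∈ kX S ↔
    ∀ v : Pl K, v.valuation K ((x : Kˣ) : K) = 1 := by
  rw [LinearMap.mem_ker]
  constructor
  · intro h v
    by_cases hv : v ∈ S
    · exact val_eq_one_of_sub (x.2 v hv)
    · rw [← ord_eq_zero_iff v (Units.ne_zero _), ← dvX_apply S x ⟨v, hv⟩]
      exact DFunLike.congr_fun h _
  · intro h
    ext v
    change dvX S (.ofMul x) v = 0
    rw [dvX_apply, ord_eq_zero_iff _ (Units.ne_zero _)]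
    exact h _

noncomputable def esFun (S : Set (Pl K)) : Additive (ES S) →+ kX S where
  toFun u := ⟨.ofMul ⟨Units.map (algebraMap (𝓞 K) K).toMonoidHom u.toMul.1, u.toMul.2⟩, by
      rw [mem_kX]; intro v; exact val_unit _ v⟩
  map_zero' := by
    apply Subtype.ext; apply Additive.toMul.injective; apply Subtype.ext; apply Units.ext
    exact map_one (algebraMap (𝓞 K) K)
  map_add' a b := by
    apply Subtype.ext; apply Additive.toMul.injective; apply Subtype.ext; apply Units.ext
    exact map_mul (algebraMap (𝓞 K) K) _ _

noncomputable def esEquiv (S : Set (Pl K)) : Additive (ES S) ≃+ kX S :=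
  AddEquiv.ofBijective (esFun S) (by
    constructor
    · intro a b h
      apply Additive.toMul.injective; apply Subtype.ext
      apply Units.ext
      apply FaithfulSMul.algebraMap_injective (𝓞 K) K
      have h1 := congrArg (fun z : kX S => (((z : Additive (Xs S)).toMul : Kˣ) : K)) h
      exact h1
    · rintro ⟨x, hx⟩
      obtain ⟨u, hu⟩ := exists_unit (x.toMul : Kˣ) ((mem_kX S x.toMul).1 hx)
      refine ⟨.ofMul ⟨u, ?_⟩, ?_⟩
      · change Units.map _ u ∈ Xs S
        rw [hu]; exact x.toMul.2
      · apply Subtype.ext; apply Additive.toMul.injective; apply Subtype.ext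
        exact hu)

theorem lattice_facts {A Q N : Type*} [AddCommGroup A] [AddCommGroup Q] [AddCommGroup N]
    [Module.Finite ℤ Q] [Module.IsTorsionFree ℤ Q] (q : A →+ Q) (hq : Function.Surjective q)
    (E : AddSubgroup A) (hE : E.index ≠ 0) (hinj : ∀ a ∈ E, q a = 0 → a = 0) (e : E ≃+ N) :
    Module.Finite ℤ N ∧ Module.IsTorsionFree ℤ N ∧ finrank ℤ N = finrank ℤ Q := by
  set f : E →+ Q := q.comp E.subtype with hf
  have hi : Function.Injective f := by
    rw [injective_iff_map_eq_zero]
    intro a ha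
    exact Subtype.ext (hinj a a.2 ha)
  have h5 : E.map q = f.range := by
    ext x
    constructor
    · rintro ⟨a, ha, rfl⟩; exact ⟨⟨a, ha⟩, rfl⟩
    · rintro ⟨a, rfl⟩; exact ⟨a, a.2, rfl⟩
  have hfr : f.range.FiniteIndex := by
    constructor
    intro h
    have h1 := AddSubgroup.index_map E q
    rw [h5, h, AddMonoidHom.range_eq_top.2 hq, AddSubgroup.index_top, mul_one] at h1
    have h7 := AddSubgroup.index_dvd_of_le (le_sup_left : E ≤ E ⊔ q.ker)
    rw [← h1] at h7
    exact hE (zero_dvd_iff.1 h7)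
  set eq1 : N ≃ₗ[ℤ] f.range := (e.symm.trans (AddMonoidHom.ofInjective hi)).toIntLinearEquiv
  have i1 : Module.Finite ℤ f.range := by
    change Module.Finite ℤ (AddSubgroup.toIntSubmodule f.range); infer_instance
  have i2 : Module.IsTorsionFree ℤ f.range := by
    change Module.IsTorsionFree ℤ (AddSubgroup.toIntSubmodule f.range); infer_instance
  refine ⟨Module.Finite.equiv eq1.symm, ?_, ?_⟩
  · exact eq1.injective.moduleIsTorsionFree _ (fun c x => map_smul eq1 c x)
  · rw [eq1.finrank_eq, AddSubgroup.finrank_eq_of_finiteIndex f.range]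

theorem kX_facts [IsTotallyReal K] (S : Finset (Pl K)) {v0 : Pl K} (hv0 : v0 ∈ S)
    (h2 : v0.valuation K (2 : K) = 1) :
    Module.Finite ℤ (kX (S : Set (Pl K))) ∧ Module.IsTorsionFree ℤ (kX (S : Set (Pl K))) ∧
    finrank ℤ (kX (S : Set (Pl K))) + 1 = finrank ℚ K := by
  have hinj : ∀ a : (𝓞 K)ˣ, a ∈ ES (S : Set (Pl K)) → a ∈ Units.torsion K → a = 1 := by
    intro a haE h3
    obtain ⟨k, hk, hk1⟩ := (isOfFinOrder_iff_pow_eq_one.1 ((CommGroup.mem_torsion _).1 h3))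
    have hk2 : (algebraMap (𝓞 K) K a) ^ k = 1 := by
      rw [← map_pow, ← Units.val_pow_eq_pow_val, hk1]; simp
    have hmem := haE v0 hv0
    rcases real_root_one _ k hk.ne' hk2 with h | h
    · apply Units.ext
      apply FaithfulSMul.algebraMap_injective (𝓞 K) K
      rw [h]; simp
    · exfalso
      change v0.valuation K (algebraMap (𝓞 K) K a - 1) < 1 at hmem
      rw [h, show (-1 - 1 : K) = - 2 by ring, Valuation.map_neg, h2] at hmem
      exact lt_irrefl _ hmem
  have hfi : (ES (S : Set (Pl K))).FiniteIndex := by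
    set n : Ideal (𝓞 K) := ∏ w ∈ S, w.asIdeal with hn
    have : Finite (𝓞 K ⧸ n) := Ideal.finiteQuotientOfFreeOfNeBot _ (prod_ne_bot S)
    have : (Units.map (Ideal.Quotient.mk n).toMonoidHom).ker.FiniteIndex := inferInstance
    refine Subgroup.finiteIndex_of_le (H := (Units.map (Ideal.Quotient.mk n).toMonoidHom).ker) ?_
    intro u hu v hv
    have h1 : Ideal.Quotient.mk n (u : 𝓞 K) = Ideal.Quotient.mk n 1 := by
      have := congrArg Units.val (MonoidHom.mem_ker.1 hu)
      simpa using this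
    rw [Ideal.Quotient.eq] at h1
    change v.valuation K (algebraMap (𝓞 K) K u - 1) < 1
    rw [← map_one (algebraMap (𝓞 K) K), ← map_sub]
    exact (HeightOneSpectrum.valuation_lt_one_iff_mem v _).2 ((prod_le_iff S v).2 hv h1)
  obtain ⟨r1, r2, r3⟩ := lattice_facts (A := Additive (𝓞 K)ˣ) (Q := Additive ((𝓞 K)ˣ ⧸ Units.torsion K))
    (N := kX (S : Set (Pl K)))
    (MonoidHom.toAdditive (QuotientGroup.mk' (Units.torsion K))) (QuotientGroup.mk'_surjective (Units.torsion K))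
    (Subgroup.toAddSubgroup (ES (S : Set (Pl K)))) (by
      rw [Subgroup.index_toAddSubgroup]; exact hfi.index_ne_zero)
    (fun a ha h => hinj a.toMul ha ((QuotientGroup.eq_one_iff a.toMul).1 h)) (esEquiv (S : Set (Pl K)))
  refine ⟨r1, r2, ?_⟩
  rw [r3, Units.finrank_modTorsion, Units.rank,
      IsTotallyReal.finrank K, InfinitePlace.card_eq_nrRealPlaces_add_nrComplexPlaces, IsTotallyReal.nrComplexPlaces_eq_zero K, add_zero]
  have : 0 < finrank ℚ K := finrank_pos
  rw [IsTotallyReal.finrank K] at this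
  omega

end
end HCF


namespace HCF
open Module NumberField IsDedekindDomain WithZero
open scoped nonZeroDivisors Pointwise

section
variable {F L : Type} [Field F] [NumberField F] [Field L] [NumberField L] [Algebra F L]

theorem smul_ord (g : L ≃ₐ[F] L) (Q : Pl L) (x : L) : ord (g • Q) (g x) = ord Q x := by
  simp only [ord, smul_val]

/-- Galois action on ray group -/
def xAct (S : Set (Pl L)) (hS : ∀ (g : L ≃ₐ[F] L) Q, g • Q ∈ S ↔ Q ∈ S) (g : L ≃ₐ[F] L) : Xs S →* Xs S where
  toFun x := ⟨Units.map (g : L →* L) x.1, by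
    intro Q hQ
    have h := x.2 (g⁻¹ • Q) ((hS _ _).2 hQ)
    rw [← smul_val g, smul_inv_smul, map_sub, map_one] at h
    exact h⟩
  map_one' := by apply Subtype.ext; simp
  map_mul' a b := by apply Subtype.ext; simp

theorem xAct_coe (S : Set (Pl L)) (hS) (g : L ≃ₐ[F] L) (x : Xs S) :
    ((xAct S hS g x : Lˣ) : L) = g ((x : Lˣ) : L) := rfl

/-- `xAct` as a linear endomorphism -/
def xEnd (S : Set (Pl L)) (hS : ∀ (g : L ≃ₐ[F] L) Q, g • Q ∈ S ↔ Q ∈ S) (g : L ≃ₐ[F] L) :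
    Module.End ℤ (Additive (Xs S)) := (MonoidHom.toAdditive (xAct S hS g)).toIntLinearMap

theorem xEnd_coe (S : Set (Pl L)) (hS) (g : L ≃ₐ[F] L) (x : Additive (Xs S)) :
    (((xEnd S hS g x).toMul : Lˣ) : L) = g ((x.toMul : Lˣ) : L) := rfl

theorem xs_ext {S : Set (Pl L)} {x y : Additive (Xs S)} (h : ((x.toMul : Lˣ) : L) = ((y.toMul : Lˣ) : L)) : x = y := by
  apply Additive.toMul.injective; apply Subtype.ext; exact Units.ext h

theorem xEnd_pow_coe (S : Set (Pl L)) (hS) (g : L ≃ₐ[F] L) (k : ℕ) (x : Additive (Xs S)) :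
    ((((xEnd S hS g ^ k) x).toMul : Lˣ) : L) = (g ^ k) ((x.toMul : Lˣ) : L) := by
  induction k with
  | zero => simp
  | succ k ih => rw [pow_succ', pow_succ', Module.End.mul_apply, xEnd_coe, ih]; rfl

theorem xs_sum_coe {S : Set (Pl L)} {ι : Type*} (s : Finset ι) (f : ι → Additive (Xs S)) :
    (((∑ i ∈ s, f i).toMul : Lˣ) : L) = ∏ i ∈ s, (((f i).toMul : Lˣ) : L) := by
  classical
  induction s using Finset.induction_on with
  | empty => simp
  | insert a s ha ih => rw [Finset.sum_insert ha, Finset.prod_insert ha, ← ih]; simp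

theorem sum_zpow_eq {M : Type*} [CommMonoid M] [Fintype (L ≃ₐ[F] L)] {σ : L ≃ₐ[F] L} (hσ : ∀ g : L ≃ₐ[F] L, g ∈ Subgroup.zpowers σ)
    (ℓ : ℕ) (ho : orderOf σ = ℓ) (f : (L ≃ₐ[F] L) → M) : ∏ g, f g = ∏ i ∈ Finset.range ℓ, f (σ ^ i) := by
  classical
  have hinj : Set.InjOn (fun i : ℕ => σ ^ i) (Finset.range ℓ) := by
    intro i hi j hj h
    rw [Finset.coe_range, Set.mem_Iio, ← ho] at hi hj
    exact pow_injOn_Iio_orderOf hi hj h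
  rw [← Finset.prod_image (g := fun i : ℕ => σ ^ i) (f := f) hinj]
  congr 1
  symm
  rw [Finset.eq_univ_iff_forall]
  intro g
  have := hσ g
  have h2 := (mem_powers_iff_mem_zpowers.2 this)
  obtain ⟨k, rfl⟩ := h2
  rw [Finset.mem_image]
  refine ⟨k % ℓ, ?_, ?_⟩
  · rw [Finset.mem_range]; apply Nat.mod_lt; rw [← ho]; exact orderOf_pos σ
  · change σ ^ (k % ℓ) = σ ^ k
    rw [← ho, pow_mod_orderOf]

theorem val_sum_lt {K : Type*} [Field K] [NumberField K] (v : Pl K) {ι : Type*} (s : Finset ι) (f : ι → K)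
    (h : ∀ i ∈ s, v.valuation K (f i) < 1) : v.valuation K (∑ i ∈ s, f i) < 1 :=
  Valuation.map_sum_lt (v.valuation K) one_ne_zero h

theorem h90X [IsGalois F L] (σ : L ≃ₐ[F] L) (hσ : ∀ g : L ≃ₐ[F] L, g ∈ Subgroup.zpowers σ)
    (ℓ : ℕ) (hl : ℓ ≠ 0) (ho : orderOf σ = ℓ) (S : Set (Pl L)) (hS)
    (hne : S.Nonempty) (hlS : ∀ Q ∈ S, Q.valuation L (ℓ : L) = 1)
    (x : Additive (Xs S)) (hx : (∑ i ∈ Finset.range ℓ, xEnd S hS σ ^ i) x = 0) :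
    ∃ y, x = xEnd S hS σ y - y := by
  classical
  have : IsCyclic (L ≃ₐ[F] L) := ⟨σ, hσ⟩
  have hl0 : (ℓ : L) ≠ 0 := by exact_mod_cast hl
  have h1 : ∏ i ∈ Finset.range ℓ, (σ ^ i) ((x.toMul : Lˣ) : L) = 1 := by
    have := congrArg (fun z : Additive (Xs S) => ((z.toMul : Lˣ) : L)) hx
    simp only [LinearMap.sum_apply] at this
    rw [xs_sum_coe] at this
    simp only [xEnd_pow_coe] at this
    rw [this]; simp
  have h2 : Algebra.norm F ((x.toMul : Lˣ) : L) = 1 := by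
    apply (algebraMap F L).injective
    rw [Algebra.norm_eq_prod_automorphisms, map_one, sum_zpow_eq hσ ℓ ho (fun g => g ((x.toMul : Lˣ) : L)), h1]
  have h2' : Algebra.norm F ((x.toMul : Lˣ) : L)⁻¹ = 1 := by rw [Algebra.norm_inv, h2, inv_one]
  obtain ⟨y, hy⟩ := groupCohomology.exists_div_of_norm_eq_one hσ h2'
  have hy0 := Units.ne_zero y
  have hsy0 : σ (y : L) ≠ 0 := by simp
  have hx0 := Units.ne_zero (x.toMul : Lˣ)
  have hy1 : σ y = ((x.toMul : Lˣ) : L) * y := by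
    field_simp at hy
    rw [← hy]; ring
  -- σ^i y / y in X
  have h3 : ∀ i : ℕ, ∀ Q ∈ S, Q.valuation L ((σ ^ i) (y : L) / y - 1) < 1 := by
    intro i
    induction i with
    | zero => intro Q _; simp [hy0]
    | succ i ih =>
      intro Q hQ
      have e1 : (σ ^ (i+1)) (y : L) / y - 1 = (((xEnd S hS σ ^ i) x).toMul : Lˣ) * ((σ ^ i) (y : L) / y - 1)
          + ((((xEnd S hS σ ^ i) x).toMul : Lˣ) - 1) := by
        rw [xEnd_pow_coe, pow_succ, AlgEquiv.mul_apply, hy1, map_mul]; ring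
      rw [e1]
      have := ((xEnd S hS σ ^ i) x).toMul.2 Q hQ
      refine Valuation.map_add_lt _ ?_ this
      rw [map_mul, val_eq_one_of_sub this, one_mul]
      exact ih Q hQ
  set b : L := (∑ i ∈ Finset.range ℓ, (σ ^ i) (y : L)) / ℓ with hb
  have hbσ : σ b = b := by
    have : (∑ i ∈ Finset.range ℓ, (σ ^ i) (y : L)) = algebraMap F L (Algebra.trace F L y) := by
      rw [trace_eq_sum_automorphisms]
      exact (congrArg Multiplicative.toAdd (sum_zpow_eq (M := Multiplicative L) hσ ℓ ho (fun g => Multiplicative.ofAdd (g (y : L))))).symm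
    rw [hb, this, map_div₀, AlgEquiv.commutes, map_natCast]
  have h4 : ∀ Q ∈ S, Q.valuation L (b / y - 1) < 1 := by
    intro Q hQ
    have e : b / y - 1 = (∑ i ∈ Finset.range ℓ, ((σ ^ i) (y : L) / y - 1)) / ℓ := by
      rw [Finset.sum_sub_distrib, ← Finset.sum_div, hb]
      simp only [Finset.sum_const, Finset.card_range, nsmul_eq_mul, mul_one]
      field_simp
    rw [e, map_div₀, hlS Q hQ, div_one]
    exact val_sum_lt _ _ _ (fun i _ => h3 i Q hQ)
  have hb0 : b ≠ 0 := by
    rintro h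
    obtain ⟨Q, hQ⟩ := hne
    have := h4 Q hQ
    rw [h, zero_div, zero_sub, Valuation.map_neg, map_one] at this
    exact lt_irrefl _ this
  have hmem : (Units.mk0 b hb0 / y) ∈ Xs S := by
    intro Q hQ
    have := h4 Q hQ
    push_cast
    exact this
  refine ⟨- .ofMul ⟨_, hmem⟩, ?_⟩
  apply xs_ext
  rw [map_neg, neg_sub_neg, toMul_sub]
  rw [Subgroup.coe_div, Units.val_div_eq_div_val, xEnd_coe]
  simp only [toMul_ofMul, Units.val_div_eq_div_val, Units.val_mk0]
  rw [map_div₀, hbσ, hy1]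
  field_simp

end
end HCF


namespace HCF
open Module NumberField IsDedekindDomain WithZero
open scoped nonZeroDivisors Pointwise

section
variable {F L : Type} [Field F] [NumberField F] [Field L] [NumberField L] [Algebra F L]

/-- the inclusion of ray groups -/
def xIncl (T : Set (Pl F)) (S : Set (Pl L)) (hS : ∀ Q, Q ∈ S ↔ und F Q ∈ T) : Xs T →* Xs S where
  toFun x := ⟨Units.map (algebraMap F L : F →* L) x.1, by
    intro Q hQ
    have h := x.2 (und F Q) ((hS _).1 hQ)
    rw [← und_val_lt_one, map_sub, map_one] at h
    exact h⟩
  map_one' := by apply Subtype.ext; simp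
  map_mul' a b := by apply Subtype.ext; simp

theorem at_main [IsGalois F L] [IsTotallyReal F] [IsTotallyReal L] (σ : L ≃ₐ[F] L)
    (hσ : ∀ g : L ≃ₐ[F] L, g ∈ Subgroup.zpowers σ)
    (ℓ : ℕ) [hl : Fact ℓ.Prime] (hdeg : finrank F L = ℓ) (T : Finset (Pl F))
    (hTl : ∀ v ∈ T, v.valuation F (ℓ : F) = 1) (v0 : Pl F) (hv0 : v0 ∈ T) (hv2 : v0.valuation F (2 : F) = 1)
    (hunr : ∀ Q : Pl L, und F Q ∉ T → ∀ x : F, Q.valuation L (algebraMap F L x) = (und F Q).valuation F x)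
    (hsurj : ∀ u : {u : Pl F // u ∉ (T : Set (Pl F))}, Finsupp.single u (1 : ℤ) ∈ AddSubgroup.closure
      ({D | ∃ u : {u : Pl F // u ∉ (T : Set (Pl F))}, D = (ℓ : ℤ) • Finsupp.single u (1 : ℤ)} ∪
       {D | ∃ u : {u : Pl F // u ∉ (T : Set (Pl F))}, (∃ Q : Pl L, und F Q = u.1 ∧
          ∀ g : L ≃ₐ[F] L, g • Q = Q → g = 1) ∧ D = Finsupp.single u (1 : ℤ)} ∪
       ((dvX (T : Set (Pl F))).range : Set _))) : False := by
  classical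
  have ho : orderOf σ = ℓ := by
    rw [orderOf_eq_card_of_forall_mem_zpowers hσ, IsGalois.card_aut_eq_finrank, hdeg]
  have hSf : {Q : Pl L | und F Q ∈ T}.Finite := by
    have : {Q : Pl L | und F Q ∈ T} = ⋃ u ∈ T, {Q : Pl L | und F Q = u} := by ext; simp
    rw [this]
    exact Set.Finite.biUnion T.finite_toSet (fun u _ => finite_fiber u)
  set TL : Finset (Pl L) := hSf.toFinset with hTL
  have hTLm : ∀ Q, Q ∈ TL ↔ und F Q ∈ T := by intro Q; simp [hTL]
  set S : Set (Pl L) := (TL : Set (Pl L)) with hSdef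
  have hSm : ∀ Q, Q ∈ S ↔ und F Q ∈ (T : Set (Pl F)) := hTLm
  have hSg : ∀ (g : L ≃ₐ[F] L) Q, g • Q ∈ S ↔ Q ∈ S := by
    intro g Q; rw [hSm, hSm, und_smul]
  obtain ⟨Q0, hQ0⟩ := und_surj F L v0
  have hQ0S : Q0 ∈ TL := by rw [hTLm, hQ0]; exact hv0
  have hQ02 : Q0.valuation L (2 : L) = 1 := by
    have := (und_val_eq_one (F := F) Q0 2).2 (by rw [hQ0]; exact hv2)
    rwa [map_ofNat] at this
  have hQl : ∀ Q ∈ S, Q.valuation L (ℓ : L) = 1 := by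
    intro Q hQ
    have := (und_val_eq_one (F := F) Q ℓ).2 (hTl _ ((hSm Q).1 hQ))
    simpa using this
  set s := xEnd S hSg σ with hs
  set e : Equiv.Perm {Q : Pl L // Q ∉ S} :=
    (MulAction.toPerm σ : Equiv.Perm (Pl L)).subtypePerm (fun Q => by
      change σ • Q ∉ S ↔ Q ∉ S; rw [hSg]) with he
  have hek : ∀ (k : ℕ) a, ((e ^ k) a).1 = σ ^ k • a.1 := by
    intro k
    induction k with
    | zero => intro a; simp
    | succ k ih => intro a; rw [pow_succ', pow_succ', Equiv.Perm.mul_apply, mul_smul, ← ih]; rfl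
  have hσl : σ ^ ℓ = 1 := by rw [← ho]; exact pow_orderOf_eq_one σ
  set p : {Q : Pl L // Q ∉ S} → {u : Pl F // u ∉ (T : Set (Pl F))} :=
    fun Q => ⟨und F Q.1, fun h => Q.2 ((hSm _).2 h)⟩ with hp
  have hpsurj : Function.Surjective p := by
    rintro ⟨u, hu⟩
    obtain ⟨Q, hQ⟩ := und_surj F L u
    exact ⟨⟨Q, fun h => hu (hQ ▸ (hSm Q).1 h)⟩, Subtype.ext hQ⟩
  have hordp : ∀ (x : F) (a : {Q : Pl L // Q ∉ S}), ord a.1 (algebraMap F L x) = ord (p a).1 x := by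
    intro x a
    have := hunr a.1 (fun h => a.2 ((hSm _).2 h)) x
    simp only [ord, this]; rfl
  have hfix : ∀ x : Additive (Xs S), s x = x → ∃ z : Xs (T : Set (Pl F)), x = .ofMul (xIncl (T : Set (Pl F)) S hSm z) := by
    intro x hx
    have h1 : σ ((x.toMul : Lˣ) : L) = ((x.toMul : Lˣ) : L) := by
      rw [← xEnd_coe S hSg, ← hs, hx]
    have h2 : ∀ g : L ≃ₐ[F] L, g ((x.toMul : Lˣ) : L) = ((x.toMul : Lˣ) : L) := by
      intro g
      obtain ⟨k, rfl⟩ := mem_powers_iff_mem_zpowers.2 (hσ g)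
      change (σ ^ k) _ = _
      induction k with
      | zero => simp
      | succ k ih => rw [pow_succ, AlgEquiv.mul_apply, h1, ih]
    obtain ⟨z, hz⟩ := (IsGalois.mem_range_algebraMap_iff_fixed _).2 h2
    have hz0 : z ≠ 0 := by
      rintro rfl
      rw [map_zero] at hz
      exact Units.ne_zero _ hz.symm
    refine ⟨⟨Units.mk0 z hz0, ?_⟩, ?_⟩
    · intro u hu
      obtain ⟨Q, rfl⟩ := und_surj F L u
      rw [← und_val_lt_one, map_sub, map_one, Units.val_mk0, hz]
      exact x.toMul.2 Q ((hSm Q).2 hu)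
    · exact xs_ext hz.symm
  have hincl_fix : ∀ z, s (.ofMul (xIncl (T : Set (Pl F)) S hSm z)) = .ofMul (xIncl (T : Set (Pl F)) S hSm z) := by
    intro z
    apply xs_ext
    rw [hs, xEnd_coe]
    exact AlgEquiv.commutes σ _
  obtain ⟨iL1, iL2, iL3⟩ := kX_facts TL hQ0S hQ02
  obtain ⟨iF1, iF2, iF3⟩ := kX_facts T hv0 hv2
  have hfield : finrank ℚ F * ℓ = finrank ℚ L := by rw [← hdeg]; exact finrank_mul_finrank ℚ F L
  refine ambiguous2 ℓ s ?_ e ?_ p hpsurj ?_ ?_ ?_ (dvX S).toIntLinearMap ?_ ?_ ?_ (finrank ℚ F) finrank_pos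
    ?_ ?_ (dvX (T : Set (Pl F))).range ?_ (dvX_index T) ?_
  · apply LinearMap.ext; intro x; apply xs_ext
    rw [hs, xEnd_pow_coe, hσl]; rfl
  · ext1 a; apply Subtype.ext; rw [hek, hσl]; simp
  · intro u
    refine Set.Finite.of_finite_image (f := Subtype.val) ((finite_fiber u.1).subset ?_)
      Subtype.val_injective.injOn
    rintro _ ⟨a, ha, rfl⟩
    exact congrArg Subtype.val ha
  · intro a; apply Subtype.ext
    exact und_smul σ a.1
  · intro a b hab
    obtain ⟨g, hg⟩ := exists_smul (congrArg Subtype.val hab : und F a.1 = und F b.1)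
    obtain ⟨k, rfl⟩ := mem_powers_iff_mem_zpowers.2 (hσ g)
    exact ⟨k, Subtype.ext (by rw [hek]; exact hg)⟩
  · intro x a
    exact smul_ord σ a.1 _
  · intro x hx
    exact h90X σ hσ ℓ hl.out.ne_zero ho S hSg ⟨Q0, hQ0S⟩ hQl x hx
  · exact dvX_index TL
  · rw [mul_comm, hfield]; exact iL3
  · rw [← iF3]
    congr 1
    set j : Additive (Xs (T : Set (Pl F))) →ₗ[ℤ] Additive (Xs S) :=
      (MonoidHom.toAdditive (xIncl (T : Set (Pl F)) S hSm)).toIntLinearMap with hj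
    have hji : Function.Injective j := by
      intro a b hab
      have h1 := congrArg (fun z : Additive (Xs S) => ((z.toMul : Lˣ) : L)) hab
      have h2 : algebraMap F L ((a.toMul : Fˣ) : F) = algebraMap F L ((b.toMul : Fˣ) : F) := h1
      exact xs_ext ((algebraMap F L).injective h2)
    have hmap : LinearMap.ker (dvX S).toIntLinearMap ⊓ LinearMap.ker (1 - s) = (kX (T : Set (Pl F))).map j := by
      ext x
      rw [Submodule.mem_inf]
      constructor
      · rintro ⟨h1, h2⟩
        have h3 : s x = x := by
          rw [LinearMap.mem_ker, LinearMap.sub_apply, Module.End.one_apply, sub_eq_zero] at h2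
          exact h2.symm
        obtain ⟨z, rfl⟩ := hfix x h3
        refine ⟨.ofMul z, ?_, rfl⟩
        rw [SetLike.mem_coe, mem_kX]
        intro u
        obtain ⟨Q, rfl⟩ := und_surj F L u
        rw [← und_val_eq_one]
        exact (mem_kX S _).1 h1 Q
      · rintro ⟨z, hz, rfl⟩
        constructor
        · apply (mem_kX S (xIncl (T : Set (Pl F)) S hSm z.toMul)).2
          intro Q
          exact (und_val_eq_one Q _).2 ((mem_kX _ z.toMul).1 hz _)
        · rw [LinearMap.mem_ker, LinearMap.sub_apply, Module.End.one_apply, sub_eq_zero]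
          exact (hincl_fix z.toMul).symm
    rw [hmap]
    exact (Submodule.equivMapOfInjective j hji (kX (T : Set (Pl F)))).finrank_eq.symm
  · intro b
    constructor
    · rintro ⟨z, rfl⟩
      exact ⟨_, hincl_fix z.toMul, fun a => hordp _ a⟩
    · rintro ⟨x, hx, hxa⟩
      obtain ⟨z, rfl⟩ := hfix x hx
      refine ⟨.ofMul z, ?_⟩
      ext u
      obtain ⟨a, rfl⟩ := hpsurj u
      rw [← hxa a]
      exact (hordp _ a).symm
  · intro u
    refine AddSubgroup.closure_mono ?_ (hsurj u)
    refine Set.union_subset_union (Set.union_subset_union_right _ ?_) subset_rfl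
    rintro _ ⟨u, ⟨Q, hQu, hQ⟩, rfl⟩
    have hQS : Q ∉ S := by rw [hSm, hQu]; exact u.2
    refine ⟨⟨Q, hQS⟩, ?_, ?_⟩
    · intro k hk
      have h1 := congrArg Subtype.val hk
      rw [hek] at h1
      rw [← ho]
      exact orderOf_dvd_of_pow_eq_one (hQ _ h1)
    · congr 1
      exact Subtype.ext hQu.symm

end
end HCF


namespace HCF
open Module NumberField IsDedekindDomain WithZero
open scoped nonZeroDivisors Pointwise

section
variable {N : Type*} [Field N] [NumberField N]

theorem val_root_one (v : Pl N) {ζ : N} {k : ℕ} (hk : k ≠ 0) (h : ζ ^ k = 1) : v.valuation N ζ = 1 := by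
  have : v.valuation N ζ ^ k = 1 := by rw [← map_pow, h, map_one]
  exact (pow_eq_one_iff_of_nonneg zero_le hk).1 this

theorem val_nat_le (v : Pl N) (n : ℕ) : v.valuation N (n : N) ≤ 1 := by
  have := HeightOneSpectrum.valuation_le_one (K := N) v (n : 𝓞 N)
  simpa using this

theorem val_one_or_root (v : Pl N) {ℓ : ℕ} {η : N} (h : η ^ ℓ = 1) (h1 : η ≠ 1)
    (hl : v.valuation N (ℓ : N) = 1) : v.valuation N (η - 1) = 1 := by
  have hl0 : ℓ ≠ 0 := by rintro rfl; simp at hl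
  have hη := val_root_one v hl0 h
  have hle : v.valuation N (η - 1) ≤ 1 := (Valuation.map_sub _ _ _).trans (by simp [hη])
  by_contra hne
  have hlt := lt_of_le_of_ne hle hne
  have hsum : ∑ k ∈ Finset.range ℓ, η ^ k = 0 := by
    have := mul_neg_geom_sum η ℓ
    rw [h, sub_self] at this
    exact (mul_eq_zero.1 this).resolve_left (sub_ne_zero.2 (Ne.symm h1))
  have hpow : ∀ k : ℕ, v.valuation N (η ^ k - 1) < 1 := by
    intro k
    have : η ^ k - 1 = (∑ i ∈ Finset.range k, η ^ i) * (η - 1) := (geom_sum_mul η k).symm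
    rw [this, map_mul]
    refine lt_of_le_of_lt (mul_le_of_le_one_left' ?_) hlt
    apply Valuation.map_sum_le
    intro i _
    rw [map_pow, hη, one_pow]
  have h2 : v.valuation N (-(∑ k ∈ Finset.range ℓ, (η ^ k - 1))) < 1 := by
    rw [Valuation.map_neg]
    exact val_sum_lt _ _ _ (fun i _ => hpow i)
  rw [Finset.sum_sub_distrib, hsum] at h2
  simp [hl] at h2

theorem val_root_sub (v : Pl N) {ℓ : ℕ} (hl : ℓ.Prime) {ζ : N} (h : IsPrimitiveRoot ζ ℓ) (j : ℕ) (hj : ¬ ℓ ∣ j) :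
    v.valuation N (ζ ^ j - 1) = v.valuation N (ζ - 1) := by
  have key : ∀ (η : N) (k : ℕ), η ^ ℓ = 1 → v.valuation N (η ^ k - 1) ≤ v.valuation N (η - 1) := by
    intro η k hη
    rw [← geom_sum_mul η k, map_mul]
    refine mul_le_of_le_one_left' ?_
    apply Valuation.map_sum_le
    intro i _
    rw [map_pow, val_root_one v hl.ne_zero hη, one_pow]
  apply le_antisymm (key ζ j h.pow_eq_one)
  have hc : Nat.Coprime j ℓ := (hl.coprime_iff_not_dvd.2 hj).symm
  obtain ⟨m, hm⟩ := Nat.exists_mul_mod_eq_one_of_coprime hc hl.one_lt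
  have h3 : (ζ ^ j) ^ m = ζ := by
    rw [← pow_mul, ← pow_mod_orderOf, ← h.eq_orderOf, hm.2, pow_one]
  have := key (ζ ^ j) m (by rw [← pow_mul, mul_comm, pow_mul, h.pow_eq_one, one_pow])
  rwa [h3] at this

theorem val_theta_le (v : Pl N) {θ θ' : N} {ℓ : ℕ} (h1 : θ + θ' = 1) (h2 : θ * θ' = 2 * ℓ) :
    v.valuation N θ ≤ 1 := by
  by_contra h
  rw [not_le] at h
  have h3 : θ' = 1 - θ := by rw [← h1]; ring
  have h4 : v.valuation N θ' = v.valuation N θ := by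
    rw [h3]
    exact Valuation.map_sub_eq_of_lt_right _ (by simpa using h)
  have h5 : v.valuation N (θ * θ') ≤ 1 := by
    rw [h2]; exact_mod_cast val_nat_le v (2 * ℓ)
  rw [map_mul, h4] at h5
  exact absurd h5 (not_le.2 (one_lt_mul'' h h))

theorem val_theta_dichotomy (v : Pl N) {θ θ' : N} {ℓ : ℕ} (h1 : θ + θ' = 1) (h2 : θ * θ' = 2 * ℓ)
    (hl : v.valuation N (ℓ : N) < 1) : v.valuation N θ < 1 ∨ v.valuation N θ' < 1 := by
  have a := val_theta_le v h1 h2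
  have b := val_theta_le v (by rw [add_comm]; exact h1) (by rw [mul_comm]; exact h2 : θ' * θ = 2 * ℓ)
  by_contra h
  push Not at h
  have ha := le_antisymm a h.1
  have hb := le_antisymm b h.2
  have : v.valuation N (θ * θ') < 1 := by
    rw [h2, map_mul]
    exact lt_of_le_of_lt (mul_le_of_le_one_left' (by exact_mod_cast val_nat_le v 2)) hl
  rw [map_mul, ha, hb] at this
  simp at this

/-- the conjugation cannot be an inertia element -/
theorem not_inertia_conj (v : Pl N) {θ θ' i : N} {ℓ : ℕ} (h1 : θ + θ' = 1) (h2 : θ * θ' = 2 * ℓ)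
    (hi : i * i = -1) (h3 : v.valuation N (-i - i) < 1) (h4 : v.valuation N (θ' - θ) < 1) : False := by
  have hvi : v.valuation N i = 1 := val_root_one v (k := 4) (by norm_num) (by
    rw [show i ^ 4 = (i * i) * (i * i) by ring, hi]; ring)
  have e1 : v.valuation N (2 : N) < 1 := by
    rw [show -i - i = -(2 * i) by ring, Valuation.map_neg, map_mul, hvi, mul_one] at h3
    exact h3
  have e2 : (θ' - θ) * (θ' - θ) = 1 - 2 * (4 * ℓ : ℕ) := by
    have : (θ' - θ) * (θ' - θ) = (θ + θ') * (θ + θ') - 4 * (θ * θ') := by ring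
    rw [this, h1, h2]; push_cast; ring
  have e3 : v.valuation N ((θ' - θ) * (θ' - θ)) < 1 := by
    rw [map_mul]; exact lt_of_le_of_lt (mul_le_of_le_one_left' h4.le) h4
  have e4 : v.valuation N (2 * (4 * ℓ : ℕ) : N) < 1 := by
    rw [map_mul, mul_comm]; exact lt_of_le_of_lt (mul_le_of_le_one_left' (val_nat_le v _)) e1
  have e5 := Valuation.map_add_lt _ e3 e4
  rw [e2] at e5
  simp at e5

theorem pow_sub_pow_prod {ℓ : ℕ} (hl : ℓ.Prime) {ζ : N} (h : IsPrimitiveRoot ζ ℓ) (x β : N) :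
    x ^ ℓ - β ^ ℓ = ∏ k ∈ Finset.range ℓ, (x - ζ ^ k * β) := by
  classical
  rw [h.pow_sub_pow_eq_prod_sub_mul x β hl.pos]
  symm
  refine Finset.prod_bij (fun k _ => ζ ^ k) ?_ ?_ ?_ ?_
  · intro k _
    rw [Polynomial.mem_nthRootsFinset hl.pos, ← pow_mul, mul_comm, pow_mul, h.pow_eq_one, one_pow]
  · intro a ha b hb hab
    exact h.pow_inj (Finset.mem_range.1 ha) (Finset.mem_range.1 hb) hab
  · intro b hb
    rw [Polynomial.mem_nthRootsFinset hl.pos] at hb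
    have := NeZero.mk hl.ne_zero
    obtain ⟨k, hk, rfl⟩ := h.eq_pow_of_pow_eq_one hb
    exact ⟨k, Finset.mem_range.2 hk, rfl⟩
  · intro k _; rfl

/-- the key local estimate -/
theorem val_x_sub (v : Pl N) {ℓ : ℕ} (hl : ℓ.Prime) {ζ x β : N} (h : IsPrimitiveRoot ζ ℓ)
    (hβ : v.valuation N β ≤ 1)
    (hh : v.valuation N (x ^ ℓ - β ^ ℓ) ≤ v.valuation N (ζ - 1) ^ ℓ) : v.valuation N (x - β) ≤ v.valuation N (ζ - 1) := by
  by_contra hlt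
  rw [not_le] at hlt
  have hprod : x ^ ℓ - β ^ ℓ = ∏ k ∈ Finset.range ℓ, (x - ζ ^ k * β) := pow_sub_pow_prod hl h x β
  have hk : ∀ k ∈ Finset.range ℓ, v.valuation N (x - ζ ^ k * β) = v.valuation N (x - β) := by
    intro k hk
    have e : x - ζ ^ k * β = (x - β) - (ζ ^ k - 1) * β := by ring
    rw [e, Valuation.map_sub_eq_of_lt_left]
    refine lt_of_le_of_lt ?_ hlt
    rw [map_mul]
    refine (mul_le_of_le_one_right' hβ).trans ?_
    by_cases hk0 : k = 0
    · simp [hk0]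
    · exact (val_root_sub v hl h k (fun hd => hk0 (Nat.eq_zero_of_dvd_of_lt hd (Finset.mem_range.1 hk)))).le
  rw [hprod, map_prod, Finset.prod_congr rfl hk, Finset.prod_const, Finset.card_range] at hh
  exact absurd hh (not_le.2 (pow_lt_pow_left₀ hlt zero_le hl.ne_zero))

/-- factor version -/
theorem exists_root_close (v : Pl N) {ℓ : ℕ} (hl : ℓ.Prime) {ζ x β : N} (h : IsPrimitiveRoot ζ ℓ)
    (hh : v.valuation N (x ^ ℓ - β ^ ℓ) < 1) : ∃ k : ℕ, v.valuation N (x - ζ ^ k * β) < 1 := by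
  have hprod : x ^ ℓ - β ^ ℓ = ∏ k ∈ Finset.range ℓ, (x - ζ ^ k * β) := pow_sub_pow_prod hl h x β
  by_contra hc
  push Not at hc
  rw [hprod, map_prod] at hh
  exact absurd hh (not_lt.2 (Finset.one_le_prod'' (fun k => hc k)))
end
end HCF


namespace HCF
open Module NumberField IsDedekindDomain WithZero
open scoped nonZeroDivisors Pointwise

section
variable {F N : Type} [Field F] [NumberField F] [Field N] [NumberField N] [Algebra F N]

theorem inert_val {P : Pl N} {g : N ≃ₐ[F] N} (hg : ∀ z : 𝓞 N, g • z - z ∈ P.asIdeal) (z : N)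
    (hz : P.valuation N z ≤ 1) : P.valuation N (g z - z) < 1 := by
  obtain ⟨b, a, hb, hab⟩ := exists_b P.asIdeal z (by
    intro v hv
    have : v = P := HeightOneSpectrum.ext (P.isMaximal.eq_of_le v.isPrime.ne_top hv).symm
    rw [this]; exact hz)
  have hlt : ∀ c : 𝓞 N, P.valuation N (g (algebraMap (𝓞 N) N c) - algebraMap (𝓞 N) N c) < 1 := by
    intro c
    rw [← coe_smul_int, ← map_sub]
    exact (HeightOneSpectrum.valuation_lt_one_iff_mem P _).2 (hg c)
  have hb1 : P.valuation N (algebraMap (𝓞 N) N b) = 1 := by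
    apply val_eq_one_of_sub
    rw [← map_one (algebraMap (𝓞 N) N), ← map_sub]
    exact (HeightOneSpectrum.valuation_lt_one_iff_mem P _).2 hb
  have hgb1 : P.valuation N (g (algebraMap (𝓞 N) N b)) = 1 := by
    have := Valuation.map_add_eq_of_lt_right (P.valuation N) (x := g (algebraMap (𝓞 N) N b) - algebraMap (𝓞 N) N b)
      (y := algebraMap (𝓞 N) N b) (by rw [hb1]; exact hlt b)
    rw [sub_add_cancel, hb1] at this
    exact this
  have e : g (algebraMap (𝓞 N) N b) * (g z - z) = (g (algebraMap (𝓞 N) N a) - algebraMap (𝓞 N) N a)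
      - (g (algebraMap (𝓞 N) N b) - algebraMap (𝓞 N) N b) * z := by
    rw [← hab, map_mul]; ring
  have h2 : P.valuation N (g (algebraMap (𝓞 N) N b) * (g z - z)) < 1 := by
    rw [e]
    refine Valuation.map_sub_lt _ (hlt a) ?_
    rw [map_mul]
    exact lt_of_le_of_lt (mul_le_of_le_one_right' hz) (hlt b)
  rwa [map_mul, hgb1, one_mul] at h2

theorem unram [IsGalois F N] {P : Pl N} 
    (h : ∀ g : N ≃ₐ[F] N, (∀ z, P.valuation N z ≤ 1 → P.valuation N (g z - z) < 1) → g = 1) (x : F) :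
    P.valuation N (algebraMap F N x) = (und F P).valuation F x := by
  have : Finite (𝓞 F ⧸ (und F P).asIdeal) := inferInstance
  have h1 := Ideal.card_inertia_eq_ramificationIdxIn (G := N ≃ₐ[F] N) (und F P).asIdeal P.asIdeal
  rw [Ideal.ramificationIdxIn_eq_ramificationIdx _ P.asIdeal (N ≃ₐ[F] N)] at h1
  have h2 : Ideal.inertia (N ≃ₐ[F] N) P.asIdeal = ⊥ := by
    rw [eq_bot_iff]
    intro g hg
    exact h g (inert_val (fun z => AddSubgroup.mem_inertia.1 hg z))
  rw [h2, Subgroup.card_bot] at h1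
  rw [← HeightOneSpectrum.valuation_liesOver N (und F P) P x]
  have h3 : (und F P).asIdeal.ramificationIdx' P.asIdeal = 1 := by
    rw [Ideal.ramificationIdx'_eq_ramificationIdx _ _ (und F P).ne_bot, ← h1]
  rw [h3, pow_one]
end
end HCF


namespace HCF
open Module NumberField IsDedekindDomain WithZero
open scoped nonZeroDivisors Pointwise

/-- Kummer data -/
structure KData (F N : Type) [Field F] [Field N] [Algebra F N] (ℓ : ℕ) where
  (τ σ : N ≃ₐ[F] N)
  (i ζ θ x : N)
  comm : τ * σ = σ * τ
  ττ : τ * τ = 1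
  σl : σ ^ ℓ = 1
  gen : ∀ g : N ≃ₐ[F] N, ∃ j : ℕ, g = σ ^ j ∨ g = τ * σ ^ j
  hi : i * i = -1
  hζ : IsPrimitiveRoot ζ ℓ
  σi : σ i = i
  σζ : σ ζ = ζ
  σθ : σ θ = θ
  σx : σ x = ζ * x
  τi : τ i = -i
  τζ : τ ζ = ζ⁻¹
  τx : τ x = x⁻¹
  θ1 : θ + τ θ = 1
  θ2 : θ * τ θ = 2 * ℓ

section
set_option linter.unusedSectionVars false
variable {F N : Type} [Field F] [NumberField F] [Field N] [NumberField N] [Algebra F N] {ℓ : ℕ}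

namespace KData
variable (D : KData F N ℓ)

theorem pow_fix {z : N} (h : D.σ z = z) (j : ℕ) : (D.σ ^ j) z = z := by
  induction j with
  | zero => simp
  | succ j ih => rw [pow_succ', AlgEquiv.mul_apply, ih, h]

theorem pow_x (j : ℕ) : (D.σ ^ j) D.x = D.ζ ^ j * D.x := by
  induction j with
  | zero => simp
  | succ j ih =>
    rw [pow_succ', AlgEquiv.mul_apply, ih, map_mul, map_pow, D.σζ, D.σx]; ring

theorem τ_τ (z : N) : D.τ (D.τ z) = z := by
  rw [← AlgEquiv.mul_apply, D.ττ]; rfl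

theorem τ_val (P : Pl N) (z : N) : (D.τ • P).valuation N z = P.valuation N (D.τ z) := by
  conv_lhs => rw [← D.τ_τ z]
  rw [smul_val]

theorem pow_eq_one {j : ℕ} (h : ℓ ∣ j) : D.σ ^ j = 1 := by
  obtain ⟨k, rfl⟩ := h
  rw [pow_mul, D.σl, one_pow]

theorem inert_σ (hl : ℓ.Prime) (P : Pl N) (hx : P.valuation N D.x = 1) (j : ℕ) (β : N) (hσβ : D.σ β = β)
    (hβ : P.valuation N D.θ < 1 → P.valuation N (ℓ : N) < 1 → P.valuation N β ≤ 1 ∧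
      P.valuation N (D.x ^ ℓ - β ^ ℓ) ≤ P.valuation N (D.ζ - 1) ^ ℓ)
    (hθ : P.valuation N (ℓ : N) < 1 → P.valuation N D.θ < 1)
    (h : ∀ z, P.valuation N z ≤ 1 → P.valuation N ((D.σ ^ j) z - z) < 1) : ℓ ∣ j := by
  by_contra hj
  have h1 := h D.x hx.le
  rw [D.pow_x, show D.ζ ^ j * D.x - D.x = (D.ζ ^ j - 1) * D.x by ring, map_mul, hx, mul_one] at h1
  have hne : D.ζ ^ j ≠ 1 := fun e => hj ((D.hζ.pow_eq_one_iff_dvd j).1 e)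
  have hpow : (D.ζ ^ j) ^ ℓ = 1 := by rw [← pow_mul, mul_comm, pow_mul, D.hζ.pow_eq_one, one_pow]
  have hlt : P.valuation N (ℓ : N) < 1 := by
    refine lt_of_le_of_ne (val_nat_le P ℓ) fun e => ?_
    rw [val_one_or_root P hpow hne e] at h1
    exact lt_irrefl _ h1
  obtain ⟨hb, hb2⟩ := hβ (hθ hlt) hlt
  have h2 := val_x_sub P hl D.hζ hb hb2
  have hz1 : D.ζ - 1 ≠ 0 := sub_ne_zero.2 (D.hζ.ne_one hl.one_lt)
  have hv0 : P.valuation N (D.ζ - 1) ≠ 0 := (Valuation.ne_zero_iff _).2 hz1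
  have h3 := h ((D.x - β) / (D.ζ - 1)) (by
    rw [map_div₀]
    exact div_le_one_of_le₀ h2 zero_le)
  have e : (D.σ ^ j) ((D.x - β) / (D.ζ - 1)) - (D.x - β) / (D.ζ - 1) = (D.ζ ^ j - 1) * D.x / (D.ζ - 1) := by
    rw [map_div₀, map_sub, map_sub, map_one, D.pow_fix hσβ, D.pow_fix D.σζ, D.pow_x]
    field_simp; ring
  rw [e, map_div₀, map_mul, hx, mul_one, val_root_sub P hl D.hζ j hj, div_self hv0] at h3
  exact lt_irrefl _ h3

theorem comm_pow (j : ℕ) (z : N) : (D.σ ^ j) (D.τ z) = D.τ ((D.σ ^ j) z) := by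
  have : D.τ * D.σ ^ j = D.σ ^ j * D.τ := (Commute.pow_right (show Commute D.τ D.σ from D.comm) j)
  rw [← AlgEquiv.mul_apply, ← this]; rfl

theorem inert_triv (hl : ℓ.Prime) (P : Pl N) (hx : P.valuation N D.x = 1) (β : N) (hσβ : D.σ β = β)
    (hβ : ∀ P : Pl N, P.valuation N D.θ < 1 → P.valuation N (ℓ : N) < 1 → P.valuation N β ≤ 1 ∧
      P.valuation N (D.x ^ ℓ - β ^ ℓ) ≤ P.valuation N (D.ζ - 1) ^ ℓ)
    (g : N ≃ₐ[F] N) (h : ∀ z, P.valuation N z ≤ 1 → P.valuation N (g z - z) < 1) : g = 1 := by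
  obtain ⟨j, rfl | rfl⟩ := D.gen g
  · apply D.pow_eq_one
    by_cases hθ : P.valuation N (ℓ : N) < 1 → P.valuation N D.θ < 1
    · exact D.inert_σ hl P hx j β hσβ (hβ P) hθ h
    · push Not at hθ
      have h2 : P.valuation N (D.τ D.θ) < 1 :=
        (val_theta_dichotomy P D.θ1 D.θ2 hθ.1).resolve_left (not_lt.2 hθ.2)
      refine D.inert_σ hl (D.τ • P) ?_ j β hσβ (hβ _) ?_ ?_
      · rw [D.τ_val, D.τx, map_inv₀, hx, inv_one]
      · intro _
        rw [D.τ_val]; exact h2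
      · intro z hz
        rw [D.τ_val] at hz ⊢
        rw [map_sub, ← D.comm_pow]
        exact h _ hz
  · exfalso
    refine not_inertia_conj P D.θ1 D.θ2 D.hi ?_ ?_
    · have := h D.i (val_root_one P (k := 4) (by norm_num) (by
        rw [show D.i ^ 4 = (D.i * D.i) * (D.i * D.i) by ring, D.hi]; ring)).le
      rwa [AlgEquiv.mul_apply, D.pow_fix D.σi, D.τi] at this
    · have := h D.θ (val_theta_le P D.θ1 D.θ2)
      rwa [AlgEquiv.mul_apply, D.pow_fix D.σθ] at this

theorem stab (hl : ℓ.Prime) (P : Pl N) (hx : P.valuation N D.x = 1) (hlP : P.valuation N (ℓ : N) = 1)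
    (β : N) (hσβ : D.σ β = β) (hb1 : P.valuation N β = 1)
    (hb2 : P.valuation N (β * D.τ β - 1) < 1) (hb3 : P.valuation N (D.x ^ ℓ - β ^ ℓ) < 1)
    (g : N ≃ₐ[F] N) (hg : g • P = P) : g = 1 ∨ g = D.τ := by
  have hζ0 : D.ζ ≠ 0 := D.hζ.ne_zero hl.ne_zero
  have hx0 : D.x ≠ 0 := fun h => by rw [h, map_zero] at hx; exact zero_ne_one hx
  have hvζ : P.valuation N D.ζ = 1 := val_root_one P hl.ne_zero D.hζ.pow_eq_one
  obtain ⟨k, hk⟩ := exists_root_close P hl D.hζ hb3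
  obtain ⟨γ, hγ⟩ : ∃ γ, γ = D.ζ ^ k * β := ⟨_, rfl⟩
  rw [← hγ] at hk
  have hσγ : D.σ γ = γ := by rw [hγ, map_mul, map_pow, D.σζ, hσβ]
  have hγ1 : P.valuation N γ = 1 := by rw [hγ, map_mul, map_pow, hvζ, one_pow, one_mul, hb1]
  have hγ2 : P.valuation N (γ * D.τ γ - 1) < 1 := by
    have : γ * D.τ γ = β * D.τ β := by
      rw [hγ, map_mul, map_pow, D.τζ, inv_pow]; field_simp
    rwa [this]
  have hv : ∀ z, P.valuation N (g z) = P.valuation N z := fun z => by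
    conv_lhs => rw [← hg]
    rw [smul_val]
  have key : ∀ j : ℕ, P.valuation N (D.ζ ^ j - 1) < 1 → D.σ ^ j = 1 := by
    intro j hlt
    by_contra hne
    have hne : D.ζ ^ j ≠ 1 := fun e => hne (D.pow_eq_one ((D.hζ.pow_eq_one_iff_dvd j).1 e))
    have hpow : (D.ζ ^ j) ^ ℓ = 1 := by rw [← pow_mul, mul_comm, pow_mul, D.hζ.pow_eq_one, one_pow]
    rw [val_one_or_root P hpow hne hlP] at hlt
    exact lt_irrefl _ hlt
  have h1 := hv (D.x - γ)
  obtain ⟨j, rfl | rfl⟩ := D.gen g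
  · left
    apply key
    rw [map_sub, D.pow_x, D.pow_fix hσγ] at h1
    have h2 := Valuation.map_sub_lt _ (h1.trans_lt hk) hk
    rw [show D.ζ ^ j * D.x - γ - (D.x - γ) = (D.ζ ^ j - 1) * D.x by ring, map_mul, hx, mul_one] at h2
    exact h2
  · right
    rw [key j, mul_one]
    rw [AlgEquiv.mul_apply, map_sub, D.pow_x, D.pow_fix hσγ, map_sub, map_mul, map_pow, D.τζ, D.τx] at h1
    have h2 := h1.trans_lt hk
    -- multiply by γ * ζ^j
    have h3 : P.valuation N (γ * D.ζ ^ j * (D.ζ⁻¹ ^ j * D.x⁻¹ - D.τ γ)) < 1 := by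
      rw [map_mul, map_mul, map_pow, hvζ, one_pow, hγ1, one_mul, one_mul]; exact h2
    have h4 : P.valuation N (D.ζ ^ j * (γ * D.τ γ - 1)) < 1 := by
      rw [map_mul, map_pow, hvζ, one_pow, one_mul]; exact hγ2
    have h5 : P.valuation N (D.x⁻¹ * (D.x - γ)) < 1 := by
      rw [map_mul, map_inv₀, hx, inv_one, one_mul]; exact hk
    have h6 := Valuation.map_add_lt _ (Valuation.map_add_lt _ h3 h4) h5
    rw [show γ * D.ζ ^ j * (D.ζ⁻¹ ^ j * D.x⁻¹ - D.τ γ) + D.ζ ^ j * (γ * D.τ γ - 1) + D.x⁻¹ * (D.x - γ)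
      = -(D.ζ ^ j - 1) by rw [inv_pow]; field_simp; ring, Valuation.map_neg] at h6
    exact h6

end KData
end
end HCF


namespace HCF
open Module NumberField IsDedekindDomain WithZero
open scoped nonZeroDivisors Pointwise

section
set_option linter.unusedSectionVars false

theorem und_und (F L N : Type) [Field F] [NumberField F] [Field N] [NumberField N] [Algebra F N]
    [Field L] [NumberField L] [Algebra F L] [Algebra L N] [IsScalarTower F L N] (P : Pl N) :
    und F (und L P) = und F P := by
  apply HeightOneSpectrum.ext
  change Ideal.comap _ (Ideal.comap _ _) = Ideal.comap _ _
  rw [Ideal.comap_comap, ← IsScalarTower.algebraMap_eq]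

theorem unram_sub (F L N : Type) [Field F] [NumberField F] [Field N] [NumberField N] [Algebra F N]
    [Field L] [NumberField L] [Algebra F L] [Algebra L N] [IsScalarTower F L N] (P : Pl N)
    (h : ∀ x : F, P.valuation N (algebraMap F N x) = (und F P).valuation F x) (x : F) :
    (und L P).valuation L (algebraMap F L x) = (und F (und L P)).valuation F x := by
  obtain ⟨e, he, h1⟩ := und_val_pow (F := F) (und L P) 0
  obtain ⟨e', he', h2⟩ := und_val_pow (F := L) P 0
  have h3 : ∀ x : F, (und F P).valuation F x = (und F P).valuation F x ^ (e * e') := by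
    intro x
    have a := h x
    rw [IsScalarTower.algebraMap_apply F L N, h2, h1, und_und, ← pow_mul] at a
    exact a.symm
  obtain ⟨p, hp⟩ := (und F P).valuation_exists_uniformizer F
  have h4 := h3 p
  rw [hp, ← exp_nsmul] at h4
  have h5 := exp_injective h4
  have h6 : e * e' = 1 := by
    simp at h5; exact_mod_cast h5.symm
  rw [h1, (mul_eq_one.1 h6).1, pow_one]

/-- restriction of automorphisms and places -/
theorem und_restrict (F L N : Type) [Field F] [NumberField F] [Field N] [NumberField N] [Algebra F N]
    [Field L] [NumberField L] [Algebra F L] [Algebra L N] [IsScalarTower F L N] [Normal F L] (P : Pl N)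
    (g : N ≃ₐ[F] N) : und L (g • P) = g.restrictNormal L • und L P := by
  have hval : ∀ x : L, (und L (g • P)).valuation L x < 1 ↔ (g.restrictNormal L • und L P).valuation L x < 1 := by
    intro x
    obtain ⟨y, rfl⟩ := (g.restrictNormal L).surjective x
    rw [smul_val, ← und_val_lt_one, ← und_val_lt_one, AlgEquiv.restrictNormal_commutes, smul_val]
  apply HeightOneSpectrum.ext
  ext a
  rw [← HeightOneSpectrum.valuation_lt_one_iff_mem _ a (K := L), hval, HeightOneSpectrum.valuation_lt_one_iff_mem]
end

section
set_option linter.unusedSectionVars false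
variable {F N : Type} [Field F] [NumberField F] [Field N] [NumberField N] [Algebra F N] [IsGalois F N] {ℓ : ℕ}
variable (D : KData F N ℓ)
namespace KData

abbrev L : IntermediateField F N := IntermediateField.fixedField (Subgroup.zpowers D.τ)

instance : (Subgroup.zpowers D.τ).Normal := by
  have hc : ∀ g : N ≃ₐ[F] N, Commute D.τ g := by
    intro g
    have h1 : Commute D.τ D.σ := D.comm
    obtain ⟨j, rfl | rfl⟩ := D.gen g
    · exact h1.pow_right j
    · exact (Commute.refl _).mul_right (h1.pow_right j)
  constructor
  rintro n ⟨k, rfl⟩ g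
  refine ⟨k, ?_⟩
  have := (hc g).zpow_left k
  simp only
  rw [← this.eq, mul_inv_cancel_right]

instance : IsGalois F D.L := IsGalois.of_fixedField_normal_subgroup _

theorem mem_L (z : N) : z ∈ D.L ↔ D.τ z = z := by
  rw [IntermediateField.mem_fixedField_iff]
  constructor
  · intro h; exact h _ (Subgroup.mem_zpowers _)
  · rintro h _ ⟨k, rfl⟩
    have : D.τ ∈ MulAction.stabilizer (N ≃ₐ[F] N) z := h
    exact (Subgroup.zpow_mem _ this k : _ ∈ MulAction.stabilizer (N ≃ₐ[F] N) z)

theorem mem_zpowers {g : N ≃ₐ[F] N} (hg : g ∈ Subgroup.zpowers D.τ) : g = 1 ∨ g = D.τ := by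
  obtain ⟨k, rfl⟩ := hg
  have h2 : D.τ ^ (2:ℤ) = 1 := by rw [zpow_ofNat, pow_two, D.ττ]
  rcases Int.even_or_odd' k with ⟨m, rfl | rfl⟩
  · left; simp only; rw [zpow_mul, h2, one_zpow]
  · right; simp only; rw [zpow_add, zpow_mul, h2, one_zpow, one_mul, zpow_one]

theorem restrict_eq_one (g : N ≃ₐ[F] N) : g.restrictNormal D.L = 1 ↔ g = 1 ∨ g = D.τ := by
  constructor
  · intro h
    apply D.mem_zpowers
    rw [← IntermediateField.fixingSubgroup_fixedField (Subgroup.zpowers D.τ),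
      IntermediateField.mem_fixingSubgroup_iff]
    intro x hx
    have := AlgEquiv.restrictNormal_commutes g D.L ⟨x, hx⟩
    rw [h] at this
    exact this.symm
  · intro h
    apply AlgEquiv.ext
    intro x
    apply (algebraMap D.L N).injective
    rw [AlgEquiv.restrictNormal_commutes]
    rcases h with rfl | rfl
    · rfl
    · exact (D.mem_L _).1 x.2

noncomputable def σL : D.L ≃ₐ[F] D.L := AlgEquiv.restrictNormalHom D.L D.σ

theorem lift (g : D.L ≃ₐ[F] D.L) : ∃ g' : N ≃ₐ[F] N, g'.restrictNormal D.L = g :=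
  AlgEquiv.restrictNormalHom_surjective N g

theorem restrict_mul (g h : N ≃ₐ[F] N) :
    (g * h).restrictNormal D.L = g.restrictNormal D.L * h.restrictNormal D.L :=
  map_mul (AlgEquiv.restrictNormalHom D.L) g h

theorem σL_gen (g : D.L ≃ₐ[F] D.L) : g ∈ Subgroup.zpowers D.σL := by
  obtain ⟨g', rfl⟩ := D.lift g
  have hp : ∀ j : ℕ, (D.σ ^ j).restrictNormal D.L = D.σL ^ j := fun j =>
    map_pow (AlgEquiv.restrictNormalHom D.L) D.σ j
  obtain ⟨j, rfl | rfl⟩ := D.gen g'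
  · rw [hp]; exact Subgroup.npow_mem_zpowers _ _
  · rw [restrict_mul, hp, (D.restrict_eq_one _).2 (Or.inr rfl), one_mul]; exact Subgroup.npow_mem_zpowers _ _

theorem finrank_L (hl : ℓ.Prime) (hx : D.x ≠ 0) : finrank F D.L = ℓ := by
  rw [← IsGalois.card_aut_eq_finrank, ← orderOf_eq_card_of_forall_mem_zpowers D.σL_gen]
  have := Fact.mk hl
  apply orderOf_eq_prime
  · rw [σL, ← map_pow, D.σl, map_one]
  · intro h
    have h2 := (D.restrict_eq_one D.σ).1 h
    rcases h2 with h2 | h2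
    · have h3 := D.σx
      rw [h2] at h3
      have : (D.ζ - 1) * D.x = 0 := by rw [sub_mul, ← h3]; simp
      rcases mul_eq_zero.1 this with h4 | h4
      · exact D.hζ.ne_one hl.one_lt (sub_eq_zero.1 h4)
      · exact hx h4
    · have h3 := D.σi
      rw [h2, D.τi] at h3
      have : D.i * D.i = 0 := by
        have : D.i = 0 := self_eq_neg.1 h3.symm
        rw [this, zero_mul]
      rw [D.hi] at this
      simp at this

theorem stab_L (P : Pl N) (h : ∀ g : N ≃ₐ[F] N, g • P = P → g = 1 ∨ g = D.τ) (g : D.L ≃ₐ[F] D.L)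
    (hg : g • und D.L P = und D.L P) : g = 1 := by
  obtain ⟨g', rfl⟩ := D.lift g
  rw [← und_restrict] at hg
  obtain ⟨k, hk⟩ := exists_smul hg
  let k' : N ≃ₐ[F] N := k.restrictScalars F
  have hk' : k' • (g' • P) = P := hk
  have hk1 : k'.restrictNormal D.L = 1 := by
    apply AlgEquiv.ext
    intro x
    apply (algebraMap D.L N).injective
    rw [AlgEquiv.restrictNormal_commutes]
    exact k.commutes x
  rw [← mul_smul] at hk'
  have := (D.restrict_eq_one _).2 (h _ hk')
  rwa [restrict_mul, hk1, one_mul] at this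

theorem unram_L (hl : ℓ.Prime) (T : Set (Pl F)) (hxT : ∀ P : Pl N, und F P ∉ T → P.valuation N D.x = 1)
    (β : N) (hσβ : D.σ β = β)
    (hβ : ∀ P : Pl N, P.valuation N D.θ < 1 → P.valuation N (ℓ : N) < 1 → P.valuation N β ≤ 1 ∧
      P.valuation N (D.x ^ ℓ - β ^ ℓ) ≤ P.valuation N (D.ζ - 1) ^ ℓ) (Q : Pl D.L) (hQ : und F Q ∉ T) (x : F) :
    Q.valuation D.L (algebraMap F D.L x) = (und F Q).valuation F x := by
  obtain ⟨P, rfl⟩ := und_surj D.L N Q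
  apply unram_sub F D.L N P
  apply unram
  apply D.inert_triv hl P (hxT P _) β hσβ hβ
  rwa [und_und] at hQ

end KData
end
end HCF


namespace HCF
open Module NumberField IsDedekindDomain WithZero
open scoped nonZeroDivisors Pointwise

/-- CM data -/
structure CM (F K : Type) [Field F] [Field K] [Algebra F K] (ℓ : ℕ) where
  τ : K ≃ₐ[F] K
  (i ζ θ : K)
  hi : i * i = -1
  τi : τ i = -i
  gen : ∀ z : K, ∃ a b : F, z = algebraMap F K a + algebraMap F K b * i
  hζ : IsPrimitiveRoot ζ ℓ
  τζ : τ ζ = ζ⁻¹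
  θ1 : θ + τ θ = 1
  θ2 : θ * τ θ = 2 * ℓ

section
set_option linter.unusedSectionVars false
set_option linter.style.haveILetI false
variable {F K : Type} [Field F] [NumberField F] [Field K] [NumberField K] [Algebra F K] {ℓ : ℕ}

theorem conj_real [IsTotallyReal F] (φ : F →+* ℂ) (a : F) : starRingEnd ℂ (φ a) = φ a := by
  have := ComplexEmbedding.isReal_iff.1 (IsTotallyReal.complexEmbedding_isReal φ)
  exact RingHom.congr_fun this a

namespace CM
variable (D : CM F K ℓ)

theorem conj [IsTotallyReal F] (φ : K →+* ℂ) (z : K) : φ (D.τ z) = starRingEnd ℂ (φ z) := by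
  have h1 : (φ D.i) * (φ D.i) = Complex.I * Complex.I := by rw [← map_mul, D.hi]; simp
  have h2 : starRingEnd ℂ (φ D.i) = - φ D.i := by
    rcases mul_self_eq_mul_self_iff.1 h1 with h | h <;> rw [h] <;> simp
  obtain ⟨a, b, rfl⟩ := D.gen z
  have ha : ∀ a : F, starRingEnd ℂ (φ (algebraMap F K a)) = φ (algebraMap F K a) := fun a =>
    conj_real (φ.comp (algebraMap F K)) a
  simp only [map_add, map_mul, ha, h2, AlgEquiv.commutes, D.τi, map_neg]

theorem τ_τ (z : K) : D.τ (D.τ z) = z := by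
  obtain ⟨a, b, rfl⟩ := D.gen z
  simp [D.τi]

theorem fixed {z : K} (h : D.τ z = z) : ∃ a : F, algebraMap F K a = z := by
  obtain ⟨a, b, rfl⟩ := D.gen z
  simp only [map_add, map_mul, AlgEquiv.commutes, D.τi, add_right_inj] at h
  have : algebraMap F K b * D.i = 0 := by
    rw [mul_neg] at h
    exact self_eq_neg.1 h.symm
  exact ⟨a, by rw [this, add_zero]⟩

theorem i_ne : D.i ≠ 0 := by
  intro h
  have := D.hi
  rw [h] at this
  simp at this

end CM

/-- stage one: a field with an `ℓ`-th root and conjugation -/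
theorem stage1 [IsTotallyReal F] (D : CM F K ℓ) (hl : ℓ.Prime) (α : K) (hα : α * D.τ α = 1) :
    ∃ (N : Type) (_ : Field N) (_ : NumberField N) (_ : Algebra K N) (_ : Algebra F N)
      (_ : IsScalarTower F K N) (x : N) (τ : N ≃ₐ[F] N),
      x ^ ℓ = algebraMap K N α ∧ IntermediateField.adjoin K {x} = ⊤ ∧ τ x = x⁻¹ ∧
      (∀ z : K, τ (algebraMap K N z) = algebraMap K N (D.τ z)) ∧ τ * τ = 1 := by
  obtain ⟨φ⟩ : Nonempty (K →+* ℂ) := inferInstance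
  letI : Algebra K ℂ := φ.toAlgebra
  letI : Algebra F ℂ := (φ.comp (algebraMap F K)).toAlgebra
  haveI : IsScalarTower F K ℂ := IsScalarTower.of_algebraMap_eq fun x => rfl
  obtain ⟨x, hx⟩ := IsAlgClosed.exists_pow_nat_eq (φ α) hl.pos
  have hxn : ‖x‖ = 1 := by
    have h1 : φ α * starRingEnd ℂ (φ α) = 1 := by rw [← D.conj, ← map_mul, hα, map_one]
    rw [Complex.mul_conj] at h1
    have h2 : ‖φ α‖ = 1 := by
      have : Complex.normSq (φ α) = 1 := by exact_mod_cast h1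
      rw [Complex.normSq_eq_norm_sq] at this
      exact (pow_eq_one_iff_of_nonneg (norm_nonneg _) two_ne_zero).1 this
    rw [← hx, norm_pow] at h2
    exact (pow_eq_one_iff_of_nonneg (norm_nonneg _) hl.ne_zero).1 h2
  have hxc : starRingEnd ℂ x = x⁻¹ := by
    rw [Complex.inv_def, Complex.normSq_eq_norm_sq, hxn]; simp
  let N := IntermediateField.adjoin K {x}
  have hInt : IsIntegral K x := ⟨Polynomial.X ^ ℓ - Polynomial.C α,
    Polynomial.monic_X_pow_sub_C α hl.ne_zero, by
      rw [← Polynomial.aeval_def]; simp only [map_sub, map_pow, Polynomial.aeval_X, Polynomial.aeval_C, hx]; exact sub_self _⟩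
  haveI : FiniteDimensional K N := IntermediateField.adjoin.finiteDimensional hInt
  haveI : CharZero N := charZero_of_injective_algebraMap (algebraMap K N).injective
  haveI : NumberField N := NumberField.of_module_finite K N
  have hN : ∀ z ∈ N, starRingEnd ℂ z ∈ N := by
    intro z hz
    refine IntermediateField.adjoin_induction K (p := fun z _ => starRingEnd ℂ z ∈ N) ?_ ?_ ?_ ?_ ?_ hz
    · rintro _ rfl
      rw [hxc]; exact inv_mem (IntermediateField.mem_adjoin_simple_self K _)
    · intro z
      have : starRingEnd ℂ (algebraMap K ℂ z) = algebraMap K ℂ (D.τ z) := (D.conj φ z).symm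
      rw [this]; exact N.algebraMap_mem _
    · intro a b _ _ ha hb; rw [map_add]; exact add_mem ha hb
    · intro a _ ha; rw [map_inv₀]; exact inv_mem ha
    · intro a b _ _ ha hb; rw [map_mul]; exact mul_mem ha hb
  let τ : N ≃ₐ[F] N :=
    { toFun := fun z => ⟨starRingEnd ℂ z, hN z z.2⟩
      invFun := fun z => ⟨starRingEnd ℂ z, hN z z.2⟩
      left_inv := fun z => Subtype.ext (by simp)
      right_inv := fun z => Subtype.ext (by simp)
      map_mul' := fun a b => Subtype.ext (by simp)
      map_add' := fun a b => Subtype.ext (by simp)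
      commutes' := fun r => Subtype.ext (conj_real (φ.comp (algebraMap F K)) r) }
  refine ⟨N, inferInstance, inferInstance, inferInstance, inferInstance, inferInstance,
    ⟨x, IntermediateField.mem_adjoin_simple_self K x⟩, τ, Subtype.ext hx, ?_, Subtype.ext hxc, ?_, ?_⟩
  · apply IntermediateField.adjoin_eq_top_of_algebra
    exact (IntermediateField.adjoin.powerBasis hInt).adjoin_gen_eq_top
  · intro z
    exact Subtype.ext (D.conj φ z).symm
  · ext z
    change starRingEnd ℂ (starRingEnd ℂ (z : ℂ)) = z
    simp

variable {N : Type} [Field N] [NumberField N] [Algebra K N] [Algebra F N] [IsScalarTower F K N]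

theorem hom_ext (D : CM F K ℓ) {x : N} (hx : IntermediateField.adjoin K {x} = ⊤) {E : Type*} [Field E] {f g : N →+* E}
    (h1 : ∀ a : F, f (algebraMap F N a) = g (algebraMap F N a))
    (h2 : f (algebraMap K N D.i) = g (algebraMap K N D.i)) (h3 : f x = g x) : f = g := by
  ext z
  have hz : z ∈ IntermediateField.adjoin K {x} := by rw [hx]; trivial
  refine IntermediateField.adjoin_induction K (p := fun z _ => f z = g z) ?_ ?_ ?_ ?_ ?_ hz
  · rintro _ rfl; exact h3
  · intro z
    obtain ⟨a, b, rfl⟩ := D.gen z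
    simp only [map_add, map_mul, h2, ← IsScalarTower.algebraMap_apply, h1]
  · intro a b _ _ ha hb; rw [map_add, map_add, ha, hb]
  · intro a _ ha; rw [map_inv₀, map_inv₀, ha]
  · intro a b _ _ ha hb; rw [map_mul, map_mul, ha, hb]

theorem stage2 (D : CM F K ℓ) (hl : ℓ.Prime) (α : K) (hα : ∀ b : K, b ^ ℓ ≠ α)
    (x : N) (τ : N ≃ₐ[F] N) (hx : x ^ ℓ = algebraMap K N α) (htop : IntermediateField.adjoin K {x} = ⊤)
    (hτx : τ x = x⁻¹) (hτ : ∀ z : K, τ (algebraMap K N z) = algebraMap K N (D.τ z)) (hττ : τ * τ = 1) :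
    IsGalois F N ∧ ∃ E : KData F N ℓ, E.x = x ∧ E.τ = τ ∧ E.ζ = algebraMap K N D.ζ ∧ E.θ = algebraMap K N D.θ ∧
      ∀ z : K, E.σ (algebraMap K N z) = algebraMap K N z := by
  have hirr := X_pow_sub_C_irreducible_of_prime hl hα
  have hx0 : x ≠ 0 := by
    rintro rfl
    rw [zero_pow hl.ne_zero] at hx
    have : α = 0 := (algebraMap K N).injective (by rw [← hx, map_zero])
    exact hα 0 (by rw [this, zero_pow hl.ne_zero])
  have hmin : ∀ y : N, y ^ ℓ = algebraMap K N α → minpoly K y = Polynomial.X ^ ℓ - Polynomial.C α := by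
    intro y hy
    exact (minpoly.eq_of_irreducible_of_monic hirr (by simp [hy]) (Polynomial.monic_X_pow_sub_C α hl.ne_zero)).symm
  have hfin : finrank K N = ℓ := by
    rw [← IntermediateField.finrank_top', ← htop, IntermediateField.adjoin.finrank (IsIntegral.of_finite K x),
      hmin x hx, Polynomial.natDegree_X_pow_sub_C]
  have hne : (primitiveRoots ℓ K).Nonempty := ⟨D.ζ, (mem_primitiveRoots hl.pos).2 D.hζ⟩
  have hsp := isSplittingField_X_pow_sub_C_of_root_adjoin_eq_top (K := K) (L := N) (a := α) (α := x)
    (by rwa [hfin]) (by rwa [hfin]) htop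
  rw [hfin] at hsp
  have hgal : IsGalois K N := isGalois_of_isSplittingField_X_pow_sub_C hne hirr N
  have hζN : IsPrimitiveRoot (algebraMap K N D.ζ) ℓ := D.hζ.map_of_injective (algebraMap K N).injective
  obtain ⟨σ', hσ'⟩ : ∃ σ' : N ≃ₐ[K] N, σ' x = algebraMap K N D.ζ * x := by
    have : IsConjRoot K (algebraMap K N D.ζ * x) x := by
      rw [IsConjRoot, hmin x hx, hmin]
      rw [mul_pow, hx, ← map_pow, D.hζ.pow_eq_one, map_one, one_mul]
    obtain ⟨s, hs⟩ := isConjRoot_iff_exists_algEquiv.1 this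
    exact ⟨s, hs⟩
  let σ : N ≃ₐ[F] N := σ'.restrictScalars F
  have hσx : σ x = algebraMap K N D.ζ * x := hσ'
  have hσK : ∀ z : K, σ (algebraMap K N z) = algebraMap K N z := fun z => σ'.commutes z
  have hσpx : ∀ j : ℕ, (σ ^ j) x = algebraMap K N D.ζ ^ j * x := by
    intro j
    induction j with
    | zero => simp
    | succ j ih =>
      rw [pow_succ', AlgEquiv.mul_apply, ih, map_mul, map_pow, hσx, hσK]; ring
  have hσpK : ∀ (j : ℕ) (z : K), (σ ^ j) (algebraMap K N z) = algebraMap K N z := by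
    intro j z
    induction j with
    | zero => simp
    | succ j ih => rw [pow_succ', AlgEquiv.mul_apply, ih, hσK]
  have hext : ∀ f g : N ≃ₐ[F] N, f (algebraMap K N D.i) = g (algebraMap K N D.i) → f x = g x → f = g := by
    intro f g h1 h2
    have := hom_ext (F := F) D htop (f := (f : N →+* N)) (g := (g : N →+* N)) (by simp) h1 h2
    ext z
    exact RingHom.congr_fun this z
  have gen0 : ∀ g : N ≃ₐ[F] N, g (algebraMap K N D.i) = algebraMap K N D.i → ∃ j : ℕ, g = σ ^ j := by
    intro g hg
    have hgK : ∀ z, g (algebraMap K N z) = algebraMap K N z := by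
      intro z
      obtain ⟨a, b, rfl⟩ := D.gen z
      simp only [map_add, map_mul, hg, ← IsScalarTower.algebraMap_apply, AlgEquiv.commutes]
    have h1 : (g x / x) ^ ℓ = 1 := by
      rw [div_pow, ← map_pow, hx, hgK, div_self]
      rw [← hx]; exact pow_ne_zero _ hx0
    haveI : NeZero ℓ := ⟨hl.ne_zero⟩
    obtain ⟨j, -, hj⟩ := hζN.eq_pow_of_pow_eq_one h1
    refine ⟨j, hext _ _ ?_ ?_⟩
    · rw [hg, hσpK]
    · rw [hσpx, hj, div_mul_cancel₀ _ hx0]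
  have gen : ∀ g : N ≃ₐ[F] N, ∃ j : ℕ, g = σ ^ j ∨ g = τ * σ ^ j := by
    intro g
    have h1 : g (algebraMap K N D.i) * g (algebraMap K N D.i) = algebraMap K N D.i * algebraMap K N D.i := by
      rw [← map_mul, ← map_mul, D.hi]; simp
    rcases mul_self_eq_mul_self_iff.1 h1 with h | h
    · obtain ⟨j, hj⟩ := gen0 g h
      exact ⟨j, Or.inl hj⟩
    · obtain ⟨j, hj⟩ := gen0 (τ * g) (by rw [AlgEquiv.mul_apply, h, map_neg, hτ, D.τi]; simp)
      exact ⟨j, Or.inr (by rw [← hj, ← mul_assoc, hττ, one_mul])⟩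
  constructor
  · apply IsGalois.of_fixedField_eq_bot
    rw [eq_bot_iff]
    intro z hz
    rw [IntermediateField.mem_fixedField_iff] at hz
    have h1 : z ∈ (⊥ : IntermediateField K N) := by
      rw [IsGalois.mem_bot_iff_fixed]
      intro f
      exact hz (f.restrictScalars F) trivial
    obtain ⟨k, rfl⟩ := IntermediateField.mem_bot.1 h1
    have h2 := hz τ trivial
    rw [hτ] at h2
    obtain ⟨a, rfl⟩ := D.fixed ((algebraMap K N).injective h2)
    exact IntermediateField.mem_bot.2 ⟨a, by rw [IsScalarTower.algebraMap_apply F K N]⟩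
  · refine ⟨⟨τ, σ, algebraMap K N D.i, algebraMap K N D.ζ, algebraMap K N D.θ, x, ?_, hττ, ?_, gen, ?_, hζN, hσK _, hσK _,
      hσK _, hσx, ?_, ?_, hτx, ?_, ?_⟩, rfl, rfl, rfl, rfl, hσK⟩
    · apply hext
      · rw [AlgEquiv.mul_apply, AlgEquiv.mul_apply, hσK, hτ, hσK]
      · rw [AlgEquiv.mul_apply, AlgEquiv.mul_apply, hσx, map_mul, hτ, hτx, map_inv₀, hσx, D.τζ, mul_inv, map_inv₀]
    · apply hext
      · rw [hσpK]; rfl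
      · rw [hσpx, hζN.pow_eq_one, one_mul]; rfl
    · rw [← map_mul, D.hi]; simp
    · rw [hτ, D.τi, map_neg]
    · rw [hτ, D.τζ, map_inv₀]
    · rw [hτ, ← map_add, D.θ1, map_one]
    · rw [hτ, ← map_mul, D.θ2, map_mul, map_ofNat, map_natCast]
end
end HCF


namespace HCF
open Module NumberField IsDedekindDomain WithZero
open scoped nonZeroDivisors Pointwise

section
set_option linter.unusedSectionVars false
set_option linter.style.haveILetI false

theorem totReal_iff (L : Type) [Field L] : IsTotallyReal L ↔ ∀ (φ : L →+* ℂ) (x : L), starRingEnd ℂ (φ x) = φ x := by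
  constructor
  · intro h φ x
    exact RingHom.congr_fun (ComplexEmbedding.isReal_iff.1 (IsTotallyReal.complexEmbedding_isReal φ)) x
  · intro h
    constructor
    intro v
    rw [InfinitePlace.isReal_iff, ComplexEmbedding.isReal_iff]
    exact RingHom.ext fun x => h _ x

variable {F K : Type} [Field F] [NumberField F] [Field K] [NumberField K] [Algebra F K] {ℓ : ℕ}

theorem kum [IsTotallyReal F] (D : CM F K ℓ) (hl : ℓ.Prime) (T : Set (Pl F)) (α : K) (hα : α * D.τ α = 1)
    (hαT : ∀ w : Pl K, und F w ∉ T → w.valuation K α = 1) (hα' : ∀ b : K, b ^ ℓ ≠ α)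
    (hV : ∃ β : K, ∀ w : Pl K, w.valuation K D.θ < 1 → w.valuation K (ℓ : K) < 1 → w.valuation K β ≤ 1 ∧
      w.valuation K (α - β ^ ℓ) ≤ w.valuation K (D.ζ - 1) ^ ℓ) :
    ∃ (L : Type) (_ : Field L) (_ : NumberField L) (_ : Algebra F L) (_ : IsTotallyReal L),
      IsGalois F L ∧ (∃ σ : L ≃ₐ[F] L, ∀ g, g ∈ Subgroup.zpowers σ) ∧ finrank F L = ℓ ∧
      (∀ Q : Pl L, und F Q ∉ T → ∀ x : F, Q.valuation L (algebraMap F L x) = (und F Q).valuation F x) ∧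
      ∀ w : Pl K, und F w ∉ T → w.valuation K (ℓ : K) = 1 →
        (∃ β : K, w.valuation K β = 1 ∧ w.valuation K (β * D.τ β - 1) < 1 ∧ w.valuation K (α - β ^ ℓ) < 1) →
        ∃ Q : Pl L, und F Q = und F w ∧ ∀ g : L ≃ₐ[F] L, g • Q = Q → g = 1 := by
  obtain ⟨N, _, _, _, _, _, x, τ, hx, htop, hτx, hτ, hττ⟩ := stage1 D hl α hα
  obtain ⟨hgal, E, rfl, rfl, hEζ, hEθ, hEσ⟩ := stage2 D hl α hα' x τ hx htop hτx hτ hττ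
  have hxT : ∀ P : Pl N, und F P ∉ T → P.valuation N E.x = 1 := by
    intro P hP
    have h1 : P.valuation N (E.x ^ ℓ) = 1 := by
      rw [hx, und_val_eq_one]; exact hαT _ (by rwa [und_und])
    rw [map_pow] at h1
    exact (pow_eq_one_iff_of_nonneg zero_le hl.ne_zero).1 h1
  have hx0 : E.x ≠ 0 := by
    intro h
    rw [h, zero_pow hl.ne_zero] at hx
    have : α = 0 := (algebraMap K N).injective (by rw [← hx, map_zero])
    rw [this, zero_mul] at hα
    exact zero_ne_one hα
  obtain ⟨β, hβ⟩ := hV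
  refine ⟨E.L, inferInstance, inferInstance, inferInstance, ?_, inferInstance, ⟨E.σL, E.σL_gen⟩,
    E.finrank_L hl hx0, ?_, ?_⟩
  · rw [totReal_iff]
    intro ψ y
    let φ := ComplexEmbedding.lift N ψ
    have hφ : ∀ y : E.L, φ (algebraMap E.L N y) = ψ y := fun y =>
      RingHom.congr_fun (ComplexEmbedding.lift_comp_algebraMap (K := N) ψ) y
    have key : (starRingEnd ℂ).comp φ = φ.comp (E.τ : N →+* N) := by
      apply hom_ext D htop
      · intro a
        simp only [RingHom.comp_apply]
        rw [show (E.τ : N →+* N) (algebraMap F N a) = algebraMap F N a from E.τ.commutes a]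
        exact conj_real (φ.comp (algebraMap F N)) a
      · simp only [RingHom.comp_apply]
        rw [show (E.τ : N →+* N) (algebraMap K N D.i) = algebraMap K N (D.τ D.i) from hτ D.i]
        exact (D.conj (φ.comp (algebraMap K N)) D.i).symm
      · simp only [RingHom.comp_apply]
        rw [show (E.τ : N →+* N) E.x = E.x⁻¹ from E.τx, map_inv₀]
        have h1 : φ (algebraMap K N α) * starRingEnd ℂ (φ (algebraMap K N α)) = 1 := by
          have := D.conj (φ.comp (algebraMap K N)) α
          simp only [RingHom.comp_apply] at this
          rw [← this, ← map_mul, ← map_mul, hα, map_one, map_one]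
        rw [Complex.mul_conj] at h1
        have h2 : ‖φ (algebraMap K N α)‖ = 1 := by
          have : Complex.normSq (φ (algebraMap K N α)) = 1 := by exact_mod_cast h1
          rw [Complex.normSq_eq_norm_sq] at this
          exact (pow_eq_one_iff_of_nonneg (norm_nonneg _) two_ne_zero).1 this
        rw [← hx, map_pow, norm_pow] at h2
        have h3 := (pow_eq_one_iff_of_nonneg (norm_nonneg _) hl.ne_zero).1 h2
        rw [Complex.inv_def, Complex.normSq_eq_norm_sq, h3]; simp
    have := RingHom.congr_fun key (algebraMap E.L N y)
    simp only [RingHom.comp_apply] at this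
    rw [← hφ, this]
    congr 1
    exact (E.mem_L _).1 y.2
  · apply E.unram_L hl T hxT (algebraMap K N β) (hEσ β)
    intro P h1 h2
    rw [hEθ, und_val_lt_one] at h1
    rw [← map_natCast (algebraMap K N), und_val_lt_one] at h2
    obtain ⟨h3, h4⟩ := hβ _ h1 h2
    refine ⟨(und_val_le_one _ _).2 h3, ?_⟩
    rw [hEζ, hx, ← map_pow, ← map_sub, ← map_one (algebraMap K N), ← map_sub]
    obtain ⟨e, he, h⟩ := und_val_pow (F := K) P 0
    rw [h, h, pow_right_comm]
    exact pow_le_pow_left₀ zero_le h4 e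
  · rintro w hw hwl ⟨β, h1, h2, h3⟩
    obtain ⟨P, rfl⟩ := und_surj K N w
    refine ⟨und E.L P, by rw [und_und, und_und], ?_⟩
    apply E.stab_L
    apply E.stab hl P (hxT P (by rwa [und_und] at hw)) ?_ (algebraMap K N β) (hEσ β) ?_ ?_ ?_
    · rw [← map_natCast (algebraMap K N), und_val_eq_one]; exact hwl
    · rwa [und_val_eq_one]
    · rw [hτ, ← map_mul, ← map_one (algebraMap K N), ← map_sub, und_val_lt_one]; exact h2
    · rw [hx, ← map_pow, ← map_sub, und_val_lt_one]; exact h3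
end
end HCF


namespace HCF
open Module NumberField IsDedekindDomain WithZero
open scoped nonZeroDivisors Pointwise

section
set_option linter.unusedSectionVars false
set_option linter.style.haveILetI false

theorem finrank_range {M A : Type*} [AddCommGroup M] [AddCommGroup A] [Module.Finite ℤ A] [Module.IsTorsionFree ℤ A]
    (f : M →+ A) (hf : f.range.index ≠ 0) (ℓ : ℕ) :
    ((f.range.map (nsmulAddMonoidHom (α := A) ℓ)).comap f).index = ℓ ^ finrank ℤ A := by
  have hfi : f.range.FiniteIndex := ⟨hf⟩
  haveI : Module.Free ℤ f.range.toIntSubmodule := inferInstance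
  rw [AddSubgroup.index_comap, AddSubgroup.relIndex_map_nsmul]
  congr 1
  exact AddSubgroup.finrank_eq_of_finiteIndex f.range

theorem index_lower {M A : Type*} [AddCommGroup M] [AddCommGroup A] [Module.Finite ℤ A] [Module.IsTorsionFree ℤ A]
    (f : M →+ A) (hf : f.range.index ≠ 0) (ℓ : ℕ) (hl : ℓ.Prime) (z : M) (hz : f z = 0) (hz2 : addOrderOf z = ℓ)
    [Finite f.ker] (h0 : (nsmulAddMonoidHom (α := M) ℓ).range.index ≠ 0) :
    ℓ ^ (finrank ℤ A + 1) ≤ (nsmulAddMonoidHom (α := M) ℓ).range.index := by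
  set J := (nsmulAddMonoidHom (α := M) ℓ).range with hJ
  set J' := (f.range.map (nsmulAddMonoidHom (α := A) ℓ)).comap f with hJ'
  have hle : J ≤ J' := by
    rintro _ ⟨m, rfl⟩
    exact ⟨f m, ⟨m, rfl⟩, by simp⟩
  have hker : f.ker ≤ J' := by
    intro m hm
    rw [AddMonoidHom.mem_ker] at hm
    rw [hJ', AddSubgroup.mem_comap, hm]; exact zero_mem _
  have h1 := AddSubgroup.relIndex_mul_index hle
  rw [hJ', finrank_range f hf ℓ, ← hJ'] at h1
  have h2 : ℓ ≤ J.relIndex f.ker := by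
    have e : J.addSubgroupOf f.ker = (nsmulAddMonoidHom (α := f.ker) ℓ).range := by
      ext ⟨m, hm⟩
      rw [AddSubgroup.mem_addSubgroupOf]
      constructor
      · rintro ⟨k, hk⟩
        have hk' : ℓ • k = m := hk
        have : ℓ • f k = 0 := by rw [← map_nsmul, hk']; exact hm
        refine ⟨⟨k, ?_⟩, Subtype.ext hk⟩
        rw [← natCast_zsmul] at this
        exact (smul_eq_zero.1 this).resolve_left (by exact_mod_cast hl.ne_zero)
      · rintro ⟨k, hk⟩
        exact ⟨k, congrArg Subtype.val hk⟩
    rw [AddSubgroup.relIndex, e, AddSubgroup.index_range]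
    have : Nat.card (AddSubgroup.zmultiples (⟨z, hz⟩ : f.ker)) ≤ Nat.card (nsmulAddMonoidHom (α := f.ker) ℓ).ker := by
      apply Nat.card_le_card_of_injective (AddSubgroup.inclusion _) (AddSubgroup.inclusion_injective _)
      rw [AddSubgroup.zmultiples_le, AddMonoidHom.mem_ker]
      apply Subtype.ext
      change ℓ • z = 0
      rw [← hz2, addOrderOf_nsmul_eq_zero]
    rw [Nat.card_zmultiples] at this
    have h3 : addOrderOf (⟨z, hz⟩ : f.ker) = ℓ := by
      rw [← hz2, ← AddSubgroup.addOrderOf_coe]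
    rwa [h3] at this
  have h3 : J.relIndex f.ker ≤ J.relIndex J' := by
    apply AddSubgroup.relIndex_le_of_le_right hker
    intro h
    rw [h, zero_mul] at h1
    exact h0 h1.symm
  rw [← h1, pow_succ, mul_comm]
  exact Nat.mul_le_mul (h2.trans h3) le_rfl

variable {F K : Type} [Field F] [NumberField F] [Field K] [NumberField K] [Algebra F K] {ℓ : ℕ}

namespace CM
variable (D : CM F K ℓ)

theorem aut (g : K ≃ₐ[F] K) : g = 1 ∨ g = D.τ := by
  have hext : ∀ f g : K ≃ₐ[F] K, f D.i = g D.i → f = g := by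
    intro f g h
    ext z
    obtain ⟨a, b, rfl⟩ := D.gen z
    simp [h]
  have h1 : g D.i * g D.i = D.i * D.i := by rw [← map_mul, D.hi]; simp
  rcases mul_self_eq_mul_self_iff.1 h1 with h | h
  · left; exact hext _ _ h
  · right; exact hext _ _ (by rw [h, D.τi])

theorem isGalois (D : CM F K ℓ) : IsGalois F K := by
  apply IsGalois.of_fixedField_eq_bot
  rw [eq_bot_iff]
  intro z hz
  rw [IntermediateField.mem_fixedField_iff] at hz
  obtain ⟨a, ha⟩ := D.fixed (hz D.τ trivial)
  exact IntermediateField.mem_bot.2 ⟨a, ha⟩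

theorem und_eq {w w' : Pl K} (h : und F w = und F w') : w' = w ∨ w' = D.τ • w := by
  haveI := D.isGalois
  obtain ⟨g, rfl⟩ := exists_smul h
  rcases D.aut g with rfl | rfl
  · left; rw [one_smul]
  · right; rfl

theorem τ_val (P : Pl K) (z : K) : (D.τ • P).valuation K z = P.valuation K (D.τ z) := by
  conv_lhs => rw [← D.τ_τ z]
  rw [smul_val]

/-- the group `H` -/
def H (T : Set (Pl F)) : Subgroup Kˣ where
  carrier := {α | (α : K) * D.τ α = 1 ∧ ∀ w : Pl K, und F w ∉ T → w.valuation K (α : K) = 1}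
  one_mem' := by simp
  mul_mem' := by
    rintro a b ⟨ha, ha'⟩ ⟨hb, hb'⟩
    refine ⟨?_, fun w hw => ?_⟩
    · rw [Units.val_mul, map_mul, mul_mul_mul_comm, ha, hb, one_mul]
    · rw [Units.val_mul, map_mul, ha' w hw, hb' w hw, one_mul]
  inv_mem' := by
    rintro a ⟨ha, ha'⟩
    refine ⟨?_, fun w hw => ?_⟩
    · rw [Units.val_inv_eq_inv_val, map_inv₀, ← mul_inv, ha, inv_one]
    · rw [Units.val_inv_eq_inv_val, map_inv₀, ha' w hw, inv_one]

theorem root_mem [IsTotallyReal F] (hl : ℓ.Prime) (T : Set (Pl F)) (b : Kˣ) (h : b ^ ℓ ∈ D.H T) : b ∈ D.H T := by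
  obtain ⟨h1, h2⟩ := h
  constructor
  · obtain ⟨φ⟩ : Nonempty (K →+* ℂ) := inferInstance
    apply φ.injective
    rw [map_mul, D.conj, Complex.mul_conj, map_one, Complex.normSq_eq_norm_sq]
    have h3 : φ ((b : K) * D.τ b) ^ ℓ = 1 := by
      rw [← map_pow, mul_pow, ← map_pow D.τ, ← Units.val_pow_eq_pow_val, h1, map_one]
    rw [map_mul, D.conj, Complex.mul_conj, Complex.normSq_eq_norm_sq] at h3
    have h4 : (‖φ b‖ ^ 2) ^ ℓ = 1 := by exact_mod_cast h3
    have h5 := (pow_eq_one_iff_of_nonneg (by positivity) hl.ne_zero).1 h4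
    rw [h5]; simp
  · intro w hw
    have := h2 w hw
    rw [Units.val_pow_eq_pow_val, map_pow] at this
    exact (pow_eq_one_iff_of_nonneg zero_le hl.ne_zero).1 this

/-- the order map -/
noncomputable def ordH (T : Finset (Pl F)) (ws : Pl F → Pl K) : Additive (D.H (T : Set (Pl F))) →+ (T → ℤ) where
  toFun a v := ord (ws v) ((a.toMul : Kˣ) : K)
  map_zero' := by
    ext v
    exact (ord_eq_zero_iff _ (Units.ne_zero _)).2 (by simp)
  map_add' a b := by
    ext v
    exact ord_mul _ (Units.ne_zero _) (Units.ne_zero _)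

theorem H_big [IsTotallyReal F] (hl : ℓ.Prime) (T : Finset (Pl F)) (ws : Pl F → Pl K)
    (hws : ∀ v ∈ T, und F (ws v) = v ∧ D.τ • ws v ≠ ws v) (A : Subgroup (D.H (T : Set (Pl F))))
    (hA0 : A.index ≠ 0) (hA : A.index ≤ ℓ ^ T.card) :
    ∃ α ∈ A, ∀ b : K, b ^ ℓ ≠ ((α : Kˣ) : K) := by
  classical
  by_contra hcon
  push Not at hcon
  set f := D.ordH T ws with hf
  have hA1 : A.toAddSubgroup ≤ (nsmulAddMonoidHom (α := Additive (D.H (T : Set (Pl F)))) ℓ).range := by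
    intro a ha
    obtain ⟨b, hb⟩ := hcon a.toMul ha
    have hb0 : b ≠ 0 := by
      rintro rfl
      rw [zero_pow hl.ne_zero] at hb
      exact Units.ne_zero _ hb.symm
    have hb2 : (Units.mk0 b hb0) ^ ℓ = (a.toMul : Kˣ) := Units.ext (by simpa using hb)
    refine ⟨Additive.ofMul ⟨Units.mk0 b hb0, D.root_mem hl _ _ (by rw [hb2]; exact SetLike.coe_mem _)⟩, ?_⟩
    apply Additive.toMul.injective
    apply Subtype.ext
    exact hb2
  have hAi : A.toAddSubgroup.index = A.index := rfl
  have h0 : (nsmulAddMonoidHom (α := Additive (D.H (T : Set (Pl F)))) ℓ).range.index ≠ 0 := by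
    intro h
    have := AddSubgroup.index_dvd_of_le hA1
    rw [h, zero_dvd_iff] at this
    exact hA0 this
  have hle := Nat.le_of_dvd (Nat.pos_of_ne_zero (hAi ▸ hA0)) (AddSubgroup.index_dvd_of_le hA1)
  -- finite index
  have hfi : f.range.index ≠ 0 := by
    obtain ⟨h, hh0, hhc⟩ : ∃ h : ℕ, h ≠ 0 ∧ ∀ c : ClassGroup (𝓞 K), c ^ h = 1 :=
      ⟨Nat.card (ClassGroup (𝓞 K)), Nat.card_pos.ne', fun c => pow_card_eq_one'⟩
    have hh : (nsmulAddMonoidHom (α := T → ℤ) (h)).range ≤ f.range := by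
      rintro _ ⟨g, rfl⟩
      have hs : ∀ v : T, (Pi.single v (h : ℤ) : T → ℤ) ∈ f.range := by
        intro v
        obtain ⟨a, ha⟩ := (clD_eq_zero_iff (K := K) (h • Finsupp.single (ws v) 1)).1 (by
          rw [map_nsmul]
          apply Additive.toMul.injective
          rw [toMul_nsmul, hhc]; rfl)
        have hord : ∀ w, ord w (a : K) = if ws v = w then (h : ℤ) else 0 := by
          intro w
          classical
          rw [← dv_apply, ha]
          simp [Finsupp.single_apply]
        have hτa : D.τ (a : K) ≠ 0 := by simp
        have hord2 : ∀ w, ord w (D.τ (a : K)) = ord (D.τ • w) (a : K) := by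
          intro w; rw [ord, ord, D.τ_val]
        let b : Kˣ := a / Units.mk0 (D.τ a) hτa
        have hb : (b : K) = a / D.τ a := by simp [b]
        have hbo : ∀ w, ord w (b : K) = ord w (a : K) - ord w (D.τ (a : K)) := by
          intro w
          have := ord_mul w (x := (b : K)) (y := D.τ (a : K)) (Units.ne_zero _) hτa
          rw [hb, div_mul_cancel₀ _ hτa] at this
          rw [hb]; omega
        have hbH : b ∈ D.H (T : Set (Pl F)) := by
          constructor
          · rw [hb, map_div₀, D.τ_τ]
            field_simp
          · intro w hw
            have h1 : ∀ w', ws v = w' → und F w' ∈ (T : Set (Pl F)) := by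
              rintro _ rfl; rw [(hws v v.2).1]; exact v.2
            rw [← ord_eq_zero_iff _ (Units.ne_zero _), hbo, hord2, hord, hord, if_neg, if_neg, sub_zero]
            · intro h; exact hw (by rw [← und_smul D.τ w]; exact h1 _ h)
            · intro h; exact hw (h1 _ h)
        refine ⟨Additive.ofMul ⟨b, hbH⟩, ?_⟩
        ext v'
        change ord (ws v') (b : K) = _
        rw [hbo, hord2, hord, hord]
        by_cases hv : v' = v
        · subst hv
          rw [if_pos rfl, if_neg (fun h => (hws _ v'.2).2 h.symm)]
          simp
        · have h1 : ∀ w', ws v = w' → und F w' = v := by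
            rintro _ rfl; rw [(hws v v.2).1]
          rw [if_neg, if_neg]
          · simp [hv]
          · intro h
            have := h1 _ h
            rw [und_smul, (hws _ v'.2).1] at this
            exact hv (Subtype.ext this)
          · intro h
            have := h1 _ h
            rw [(hws _ v'.2).1] at this
            exact hv (Subtype.ext this)
      have e : nsmulAddMonoidHom (α := T → ℤ) (h) g =
          ∑ v : T, g v • (Pi.single v (h : ℤ) : T → ℤ) := by
        ext v
        simp [Finset.sum_apply, Pi.single_apply, mul_comm]
      rw [e]
      exact AddSubgroup.sum_mem _ fun v _ => AddSubgroup.zsmul_mem _ (hs v) _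
    intro hz
    have := AddSubgroup.index_dvd_of_le hh
    rw [hz, zero_dvd_iff, AddSubgroup.index_range_nsmul] at this
    exact pow_ne_zero _ hh0 this
  have hker : ∀ a : Kˣ, (ha : a ∈ D.H (T : Set (Pl F))) → f (Additive.ofMul ⟨a, ha⟩) = 0 →
      a ∈ (Units.map (algebraMap (𝓞 K) K).toMonoidHom) '' (Units.torsion K : Set (𝓞 K)ˣ) := by
    intro a ha hfa
    have hval : ∀ w : Pl K, w.valuation K (a : K) = 1 := by
      intro w
      by_cases hw : und F w ∈ (T : Set (Pl F))
      · have h1 : (ws (und F w)).valuation K (a : K) = 1 := by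
          rw [← ord_eq_zero_iff _ (Units.ne_zero _)]
          exact congrFun hfa ⟨_, hw⟩
        rcases D.und_eq (hws _ hw).1 with h | h
        · rw [h]; exact h1
        · rw [h, D.τ_val]
          have : D.τ (a : K) = (a : K)⁻¹ := eq_inv_of_mul_eq_one_right ha.1
          rw [this, map_inv₀, h1, inv_one]
      · exact ha.2 w hw
    obtain ⟨u, rfl⟩ := exists_unit a hval
    refine ⟨u, ?_, rfl⟩
    rw [SetLike.mem_coe, Units.mem_torsion]
    intro w
    have h1 := D.conj w.embedding (algebraMap (𝓞 K) K u)
    have h2 := ha.1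
    have h3 : w.embedding (algebraMap (𝓞 K) K u) * starRingEnd ℂ (w.embedding (algebraMap (𝓞 K) K u)) = 1 := by
      rw [← h1, ← map_mul]
      rw [← map_one w.embedding]
      exact congrArg _ h2
    rw [Complex.mul_conj, Complex.normSq_eq_norm_sq] at h3
    have h4 : ‖w.embedding (algebraMap (𝓞 K) K u)‖ ^ 2 = 1 := by exact_mod_cast h3
    have h5 := (pow_eq_one_iff_of_nonneg (norm_nonneg _) two_ne_zero).1 h4
    rwa [InfinitePlace.norm_embedding_eq] at h5
  haveI : Finite f.ker := by
    haveI : Finite (Units.torsion K : Set (𝓞 K)ˣ) := inferInstanceAs (Finite (Units.torsion K))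
    have hfin : ((Units.map (algebraMap (𝓞 K) K).toMonoidHom) '' (Units.torsion K : Set (𝓞 K)ˣ)).Finite :=
      Set.Finite.image _ (Set.toFinite (Units.torsion K : Set (𝓞 K)ˣ))
    haveI := hfin.to_subtype
    refine Finite.of_injective (β := ((Units.map (algebraMap (𝓞 K) K).toMonoidHom) '' (Units.torsion K : Set (𝓞 K)ˣ) : Set Kˣ))
      (fun a => ⟨((a : Additive (D.H (T : Set (Pl F)))).toMul : Kˣ), hker _ (SetLike.coe_mem _) a.2⟩) ?_
    intro a b hab
    apply Subtype.ext
    apply Additive.toMul.injective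
    apply Subtype.ext
    have := Subtype.mk.inj hab
    exact this
  have hζ0 : D.ζ ≠ 0 := D.hζ.ne_zero hl.ne_zero
  have hζ1 : ∀ w : Pl K, w.valuation K D.ζ = 1 := fun w => val_root_one w hl.ne_zero D.hζ.pow_eq_one
  have hζH : Units.mk0 D.ζ hζ0 ∈ D.H (T : Set (Pl F)) :=
    ⟨by simp [D.τζ, hζ0], fun w _ => hζ1 w⟩
  have := index_lower f hfi ℓ hl (Additive.ofMul ⟨_, hζH⟩) (by
      ext v; exact (ord_eq_zero_iff _ hζ0).2 (hζ1 _)) (by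
      rw [addOrderOf_ofMul_eq_orderOf, Subgroup.orderOf_mk, ← orderOf_units]
      exact D.hζ.eq_orderOf.symm) h0
  have h6 : finrank ℤ (T → ℤ) = T.card := by simp
  rw [h6] at this
  have h7 : ℓ ^ T.card < ℓ ^ (T.card + 1) := Nat.pow_lt_pow_right hl.one_lt (by omega)
  omega
end CM
end
end HCF


namespace HCF
open Module NumberField IsDedekindDomain WithZero
open scoped nonZeroDivisors Pointwise

section
set_option linter.unusedSectionVars false
set_option linter.style.haveILetI false

theorem idx_comap {G C : Type*} [Group G] [CommGroup C] [Finite C] (f : G →* C) (ℓ : ℕ) :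
    (((powMonoidHom (α := C) ℓ).range).comap f).index ≠ 0 ∧
    (((powMonoidHom (α := C) ℓ).range).comap f).index ≤ Nat.card (powMonoidHom (α := C) ℓ).ker := by
  have h1 : ((powMonoidHom (α := C) ℓ).range).index = Nat.card (powMonoidHom (α := C) ℓ).ker :=
    Subgroup.index_range
  have h2 : (((powMonoidHom (α := C) ℓ).range).comap f).index ∣ ((powMonoidHom (α := C) ℓ).range).index := by
    rw [Subgroup.index_comap]
    exact Subgroup.relIndex_dvd_index_of_normal _ _
  rw [h1] at h2
  exact ⟨fun h => Nat.card_pos.ne' (Nat.eq_zero_of_zero_dvd (h ▸ h2)), Nat.le_of_dvd Nat.card_pos h2⟩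

variable {F K : Type} [Field F] [NumberField F] [Field K] [NumberField K] [Algebra F K] {ℓ : ℕ}

theorem exists_int (x : K) (h : ∀ w : Pl K, w.valuation K x ≤ 1) : ∃ y : 𝓞 K, algebraMap (𝓞 K) K y = x := by
  obtain ⟨y, hy⟩ := HeightOneSpectrum.mem_integers_of_valuation_le_one K x h
  exact ⟨y, hy⟩

theorem vlt (w : Pl K) (a : 𝓞 K) : w.valuation K (algebraMap (𝓞 K) K a) < 1 ↔ a ∈ w.asIdeal :=
  HeightOneSpectrum.valuation_lt_one_iff_mem w a

theorem vlepow (w : Pl K) (a : 𝓞 K) (m : ℕ) :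
    w.valuation K (algebraMap (𝓞 K) K a) ≤ exp (-(m : ℤ)) ↔ a ∈ w.asIdeal ^ m := by
  rw [HeightOneSpectrum.valuation_of_algebraMap]
  exact HeightOneSpectrum.intValuation_le_pow_iff_mem w a m

namespace CM
variable (D : CM F K ℓ)

/-- split condition group -/
def W (w : Pl K) : Subgroup Kˣ where
  carrier := {b | w.valuation K (b : K) = 1 ∧ w.valuation K ((b : K) * D.τ b - 1) < 1}
  one_mem' := by simp
  mul_mem' := by
    rintro a b ⟨ha, ha'⟩ ⟨hb, hb'⟩
    refine ⟨by rw [Units.val_mul, map_mul, ha, hb, one_mul], ?_⟩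
    have h1 := val_eq_one_of_sub ha'
    rw [Units.val_mul, map_mul, show (a : K) * b * (D.τ a * D.τ b) - 1 =
      ((a : K) * D.τ a) * (b * D.τ b - 1) + (a * D.τ a - 1) by ring]
    refine Valuation.map_add_lt _ ?_ ha'
    rw [map_mul, h1, one_mul]; exact hb'
  inv_mem' := by
    rintro a ⟨ha, ha'⟩
    refine ⟨by rw [Units.val_inv_eq_inv_val, map_inv₀, ha, inv_one], ?_⟩
    have h1 := val_eq_one_of_sub ha'
    have h0 : (a : K) ≠ 0 := Units.ne_zero _
    have h0' : D.τ (a : K) ≠ 0 := by simp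
    rw [Units.val_inv_eq_inv_val, map_inv₀, show (a : K)⁻¹ * (D.τ a)⁻¹ - 1 = -(((a : K) * D.τ a)⁻¹ * (a * D.τ a - 1)) by
      field_simp; ring, Valuation.map_neg, map_mul, map_inv₀, h1, inv_one, one_mul]
    exact ha'

theorem le_self {v w : Pl K} (h : w.asIdeal ≤ v.asIdeal) : v = w :=
  HeightOneSpectrum.ext (w.isMaximal.eq_of_le v.isPrime.ne_top h).symm

/-- reduction on W -/
noncomputable def redW (w : Pl K) : D.W w →* (𝓞 K ⧸ w.asIdeal)ˣ :=
  (redU w.asIdeal).comp (Subgroup.inclusion (show D.W w ≤ Yn w.asIdeal from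
    fun b hb v hv => by rw [le_self hv]; exact hb.1))

theorem split_index (hl : ℓ.Prime) (T : Set (Pl F)) (w : Pl K) (hw : und F w ∉ T) :
    ∃ A : Subgroup (D.H T), A.index ≠ 0 ∧ A.index ≤ ℓ ∧ ∀ α ∈ A,
      ∃ β : K, w.valuation K β = 1 ∧ w.valuation K (β * D.τ β - 1) < 1 ∧ w.valuation K (((α : Kˣ) : K) - β ^ ℓ) < 1 := by
  have hHW : D.H T ≤ D.W w := by
    intro a ha
    exact ⟨ha.2 w hw, by rw [ha.1]; simp⟩
  let C := (D.redW w).range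
  let f : D.H T →* C := ((D.redW w).rangeRestrict).comp (Subgroup.inclusion hHW)
  letI : Field (𝓞 K ⧸ w.asIdeal) := Ideal.Quotient.field _
  haveI : Finite (𝓞 K ⧸ w.asIdeal)ˣ := inferInstance
  haveI : IsCyclic (𝓞 K ⧸ w.asIdeal)ˣ := inferInstance
  haveI : IsCyclic C := inferInstance
  obtain ⟨h1, h2⟩ := idx_comap f ℓ
  refine ⟨_, h1, h2.trans ?_, ?_⟩
  · rw [IsCyclic.card_powMonoidHom_ker]
    exact Nat.gcd_le_right _ hl.pos
  · rintro α ⟨⟨_, β, rfl⟩, hβ⟩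
    refine ⟨((β : Kˣ) : K), β.2.1, β.2.2, ?_⟩
    have h3 : D.redW w (β ^ ℓ) = D.redW w (Subgroup.inclusion hHW α) := by
      have := congrArg Subtype.val hβ
      rw [map_pow]
      exact this
    have h4 := congrArg Units.val h3
    have h5 := val_sub_lt_of_red_eq h4.symm
    simpa [YnR] using h5

theorem finrank_le (D : CM F K ℓ) : finrank ℚ K ≤ 2 * finrank ℚ F := by
  haveI := D.isGalois
  rw [← Module.finrank_mul_finrank ℚ F K, mul_comm]
  apply Nat.mul_le_mul_right
  rw [← IsGalois.card_aut_eq_finrank]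
  classical
  have : Function.Surjective (fun b : Bool => if b then (1 : K ≃ₐ[F] K) else D.τ) := by
    intro g
    rcases D.aut g with rfl | rfl
    · exact ⟨true, rfl⟩
    · exact ⟨false, rfl⟩
  have := Nat.card_le_card_of_surjective _ this
  simpa using this

theorem V_index (hl : ℓ.Prime) (T : Set (Pl F)) (hT : ∀ w : Pl K, w.valuation K (ℓ : K) < 1 → und F w ∉ T) :
    ∃ A : Subgroup (D.H T), A.index ≠ 0 ∧ A.index ≤ ℓ ^ finrank ℚ F ∧ ∀ α ∈ A,
      ∃ β : K, ∀ w : Pl K, w.valuation K D.θ < 1 → w.valuation K (ℓ : K) < 1 → w.valuation K β ≤ 1 ∧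
        w.valuation K (((α : Kˣ) : K) - β ^ ℓ) ≤ w.valuation K (D.ζ - 1) ^ ℓ := by
  obtain ⟨θ, hθ⟩ := exists_int D.θ fun w => val_theta_le w D.θ1 D.θ2
  obtain ⟨ζ, hζ⟩ := exists_int D.ζ fun w => (val_root_one w hl.ne_zero D.hζ.pow_eq_one).le
  have hinj : Function.Injective (algebraMap (𝓞 K) K) := IsFractionRing.injective _ _
  have hζp : IsPrimitiveRoot ζ ℓ := by
    apply IsPrimitiveRoot.of_map_of_injective (f := algebraMap (𝓞 K) K) _ hinj
    rw [hζ]; exact D.hζ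
  set e : 𝓞 K ≃+* 𝓞 K := RingOfIntegers.mapRingEquiv D.τ.toRingEquiv with he
  have hec : ∀ x : 𝓞 K, algebraMap (𝓞 K) K (e x) = D.τ (algebraMap (𝓞 K) K x) := fun x => rfl
  set q : Ideal (𝓞 K) := Ideal.span {ζ - 1, θ} with hq
  have hζq : ζ - 1 ∈ q := Ideal.subset_span (by simp)
  have hθq : θ ∈ q := Ideal.subset_span (by simp)
  have hζ10 : ζ - 1 ≠ 0 := hζp.sub_one_ne_zero hl.one_lt
  have hdvd : (ζ - 1) ^ (ℓ - 1) ∣ (ℓ : 𝓞 K) := by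
    obtain ⟨z, _, hz⟩ := hζp.self_sub_one_pow_dvd_order (k := ℓ - 1) (by have := hl.pos; omega)
    exact ⟨z, by rw [hz, mul_comm]⟩
  have hdvd1 : (ζ - 1) ∣ (ℓ : 𝓞 K) := hζp.sub_one_dvd_natCast hl.one_lt
  have hvπ : ∀ w : Pl K, w.valuation K (ℓ : K) ≤ w.valuation K (D.ζ - 1) := by
    intro w
    obtain ⟨c, hc⟩ := hdvd1
    have := congrArg (algebraMap (𝓞 K) K) hc
    rw [map_natCast, map_mul, map_sub, map_one, hζ] at this
    rw [this, map_mul]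
    exact mul_le_of_le_one_right' (w.valuation_le_one c)
  have hv2π : ∀ w : Pl K, w.valuation K ((2 : K) * ℓ) ≤ w.valuation K (D.ζ - 1) := by
    intro w
    rw [map_mul]
    refine (mul_le_of_le_one_left' ?_).trans (hvπ w)
    exact_mod_cast val_nat_le w 2
  -- sizes
  set N := Ideal.absNorm q with hN
  have hq0 : q ≠ ⊥ := fun h => hζ10 (by simpa [h] using hζq)
  have hN0 : N ≠ 0 := Ideal.absNorm_ne_zero_iff_mem_nonZeroDivisors.2 (mem_nonZeroDivisors_of_ne_zero hq0)
  have hNe : Ideal.absNorm (q.map e) = N := by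
    rw [hN, Ideal.absNorm_apply, Ideal.absNorm_apply]
    exact (Nat.card_congr (Ideal.quotientEquiv q (q.map e) e rfl).toEquiv).symm
  have hNN : N * N ∣ Ideal.absNorm (Ideal.span {ζ - 1}) := by
    conv_lhs => rw [← hNe]
    rw [hNe]
    nth_rewrite 2 [← hNe]
    rw [hN, ← map_mul]
    apply Ideal.absNorm_dvd_absNorm_of_le
    rw [Ideal.span_singleton_le_iff_mem]
    have h1 : (ζ - 1) * e θ ∈ q * q.map e := Ideal.mul_mem_mul hζq (Ideal.mem_map_of_mem _ hθq)
    have h2 : θ * e (ζ - 1) ∈ q * q.map e := Ideal.mul_mem_mul hθq (Ideal.mem_map_of_mem _ hζq)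
    have h3 : ζ - 1 = (ζ - 1) * e θ - ζ * (θ * e (ζ - 1)) := by
      apply hinj
      have hζ0 : D.ζ ≠ 0 := D.hζ.ne_zero hl.ne_zero
      simp only [map_sub, map_mul, map_one, hec, hζ, hθ, D.τζ]
      rw [← sub_eq_iff_eq_add'.2 D.θ1.symm]
      field_simp
      ring
    rw [h3]
    exact sub_mem h1 (Ideal.mul_mem_left _ _ h2)
  have hfin : N ^ (ℓ - 1) ≤ ℓ ^ finrank ℚ F := by
    have h1 : (N * N) ^ (ℓ - 1) ∣ ℓ ^ finrank ℚ K := by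
      refine (pow_dvd_pow_of_dvd hNN _).trans ?_
      rw [← map_pow, Ideal.span_singleton_pow, ← RingOfIntegers.rank K, ← Ideal.absNorm_span_natCast (S := 𝓞 K)]
      apply Ideal.absNorm_dvd_absNorm_of_le
      rw [Ideal.span_singleton_le_span_singleton]
      exact hdvd
    have h2 := Nat.le_of_dvd (pow_pos hl.pos _) h1
    have h3 : (N * N) ^ (ℓ - 1) ≤ ℓ ^ (2 * finrank ℚ F) := h2.trans (Nat.pow_le_pow_right hl.pos D.finrank_le)
    rw [mul_pow, ← sq, mul_comm 2, pow_mul] at h3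
    exact (Nat.pow_le_pow_iff_left two_ne_zero).1 h3
  -- local facts
  have hloc : ∀ w : Pl K, w.valuation K D.θ < 1 → w.valuation K (ℓ : K) < 1 → q ^ ℓ ≤ w.asIdeal ∧
      ∀ a ∈ q ^ ℓ, w.valuation K (algebraMap (𝓞 K) K a) ≤ w.valuation K (D.ζ - 1) ^ ℓ := by
    intro w hw1 hw2
    have hθv : w.valuation K D.θ ≤ w.valuation K (D.ζ - 1) := by
      have h1 : w.valuation K (D.τ D.θ) = 1 := by
        apply val_eq_one_of_sub
        rw [show D.τ D.θ - 1 = - D.θ by rw [← D.θ1]; ring, Valuation.map_neg]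
        exact hw1
      have h2 := hv2π w
      rw [← D.θ2, map_mul, h1, mul_one] at h2
      exact h2
    have hπ0 : D.ζ - 1 ≠ 0 := D.hζ.sub_one_ne_zero hl.one_lt
    have hπ1 : w.valuation K (D.ζ - 1) < 1 := by
      have h1 : w.valuation K ((D.ζ - 1) ^ ℓ) < 1 := by
        obtain ⟨r, hr⟩ := exists_add_pow_prime_eq hl (ζ - 1) 1
        rw [sub_add_cancel, hζp.pow_eq_one, one_pow] at hr
        have h2 : (ζ - 1) ^ ℓ = ℓ * (-((ζ - 1) * 1 * r)) := by linear_combination -hr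
        rw [← hζ, ← map_one (algebraMap (𝓞 K) K), ← map_sub, ← map_pow, h2, map_mul, map_natCast, map_mul]
        exact lt_of_le_of_lt (mul_le_of_le_one_right' (w.valuation_le_one _)) hw2
      rw [map_pow] at h1
      exact (pow_lt_one_iff_of_nonneg zero_le hl.ne_zero).1 h1
    have hqle : q ≤ w.asIdeal := by
      rw [hq, Ideal.span_le]
      rintro x (rfl | rfl)
      · rw [SetLike.mem_coe, ← vlt, map_sub, map_one, hζ]; exact hπ1
      · rw [SetLike.mem_coe, ← vlt, hθ]; exact hw1
    refine ⟨(Ideal.pow_le_self hl.ne_zero).trans hqle, ?_⟩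
    obtain ⟨m, hm⟩ : ∃ m : ℕ, w.valuation K (D.ζ - 1) = exp (-(m : ℤ)) := by
      have h1 := val_eq_exp w hπ0
      rw [h1] at hπ1 ⊢
      rw [← exp_zero, exp_lt_exp] at hπ1
      refine ⟨(ord w (D.ζ - 1)).toNat, ?_⟩
      congr 2
      omega
    have hq2 : q ≤ w.asIdeal ^ m := by
      rw [hq, Ideal.span_le]
      rintro x (rfl | rfl)
      · rw [SetLike.mem_coe, ← vlepow, map_sub, map_one, hζ, hm]
      · rw [SetLike.mem_coe, ← vlepow, hθ, ← hm]
        exact hθv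
    intro a ha
    have h1 : a ∈ w.asIdeal ^ (m * ℓ) := by
      rw [pow_mul]
      exact Ideal.pow_right_mono hq2 ℓ ha
    rw [← vlepow] at h1
    refine h1.trans (le_of_eq ?_)
    rw [hm, ← exp_nsmul]
    congr 1
    simp [mul_comm]
  have hY : D.H T ≤ Yn (q ^ ℓ) := by
    intro α hα v hv
    have h1 : q ≤ v.asIdeal := v.isPrime.le_of_pow_le hv
    apply hα.2
    apply hT
    refine lt_of_le_of_lt (hvπ v) ?_
    rw [← hζ, ← map_one (algebraMap (𝓞 K) K), ← map_sub, HeightOneSpectrum.valuation_lt_one_iff_mem]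
    exact h1 hζq
  have hqℓ0 : q ^ ℓ ≠ ⊥ := pow_ne_zero _ hq0
  haveI : Finite (𝓞 K ⧸ q ^ ℓ) := Ideal.finiteQuotientOfFreeOfNeBot _ hqℓ0
  haveI : Finite (𝓞 K ⧸ q) := Ideal.finiteQuotientOfFreeOfNeBot _ hq0
  let f : D.H T →* (𝓞 K ⧸ q ^ ℓ)ˣ := (redU (q ^ ℓ)).comp (Subgroup.inclusion hY)
  obtain ⟨h1, h2⟩ := idx_comap f ℓ
  refine ⟨_, h1, h2.trans (le_trans ?_ hfin), ?_⟩
  · set g := Ideal.Quotient.factor (Ideal.pow_le_self hl.ne_zero : q ^ ℓ ≤ q) with hg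
    have hgs : Function.Surjective g := Ideal.Quotient.factor_surjective _
    have hcard : Nat.card g.toAddMonoidHom.ker = N ^ (ℓ - 1) := by
      have h3 := AddSubgroup.index_mul_card g.toAddMonoidHom.ker
      have h30 : g.toAddMonoidHom.range = ⊤ := AddMonoidHom.range_eq_top.2 hgs
      rw [AddSubgroup.index_ker, h30, AddSubgroup.card_top] at h3
      have h4 : Nat.card (𝓞 K ⧸ q) = N := rfl
      have h5 : Nat.card (𝓞 K ⧸ q ^ ℓ) = N ^ ℓ := by
        rw [hN, ← map_pow]; rfl
      rw [h4, h5] at h3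
      have h6 : N ^ ℓ = N * N ^ (ℓ - 1) := by
        rw [← pow_succ', Nat.sub_add_cancel hl.pos]
      rw [h6] at h3
      exact Nat.eq_of_mul_eq_mul_left (Nat.pos_of_ne_zero hN0) h3
    rw [← hcard]
    refine Nat.card_le_card_of_injective (fun x => ⟨((x : (𝓞 K ⧸ q ^ ℓ)ˣ) : 𝓞 K ⧸ q ^ ℓ) - 1, ?_⟩) ?_
    · obtain ⟨x, hx⟩ := x
      rw [MonoidHom.mem_ker, powMonoidHom_apply] at hx
      obtain ⟨y, hy⟩ := Ideal.Quotient.mk_surjective (x : 𝓞 K ⧸ q ^ ℓ)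
      rw [AddMonoidHom.mem_ker]
      change g ((x : 𝓞 K ⧸ q ^ ℓ) - 1) = 0
      rw [← hy, ← map_one (Ideal.Quotient.mk (q ^ ℓ)), ← map_sub, hg, Ideal.Quotient.factor_mk,
        Ideal.Quotient.eq_zero_iff_mem]
      have hy2 : y ^ ℓ - 1 ∈ q ^ ℓ := by
        rw [← Ideal.Quotient.eq_zero_iff_mem, map_sub, map_pow, hy, ← Units.val_pow_eq_pow_val, hx]; simp
      set Y := algebraMap (𝓞 K) K y with hY'
      have hπ0 : D.ζ - 1 ≠ 0 := D.hζ.sub_one_ne_zero hl.one_lt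
      obtain ⟨c, hc⟩ := exists_int ((Y - 1) * D.τ D.θ / (D.ζ - 1)) (by
        intro w
        rw [map_div₀, map_mul]
        have hY1 : w.valuation K (Y - 1) ≤ 1 := (Valuation.map_sub _ _ _).trans (by simp [hY', w.valuation_le_one])
        have hθ' : w.valuation K (D.τ D.θ) ≤ 1 :=
          val_theta_le w (by rw [add_comm]; exact D.θ1) (by rw [mul_comm]; exact D.θ2)
        have hp : 0 < w.valuation K (D.ζ - 1) := by
          rw [pos_iff_ne_zero]; exact (Valuation.ne_zero_iff _).2 hπ0
        refine div_le_one_of_le₀ ?_ zero_le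
        by_cases hℓ : w.valuation K (ℓ : K) < 1
        · by_cases hθw : w.valuation K D.θ < 1
          · obtain ⟨_, hw⟩ := hloc w hθw hℓ
            have h3 := hw _ hy2
            rw [map_sub, map_pow, map_one, ← hY'] at h3
            have h4 := val_x_sub w hl D.hζ (x := Y) (β := 1) (by simp) (by rw [one_pow]; exact h3)
            exact (mul_le_of_le_one_right' hθ').trans h4
          · have h5 : w.valuation K D.θ = 1 := le_antisymm (val_theta_le w D.θ1 D.θ2) (not_lt.1 hθw)
            have h6 := hv2π w
            rw [← D.θ2, map_mul, h5, one_mul] at h6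
            exact (mul_le_of_le_one_left' hY1).trans h6
        · have h7 : (1 : ℤᵐ⁰) ≤ w.valuation K (D.ζ - 1) := (not_lt.1 hℓ).trans (hvπ w)
          exact (mul_le_one' hY1 hθ').trans h7)
      have h8 : y - 1 = (y - 1) * θ + c * (ζ - 1) := by
        apply hinj
        simp only [map_sub, map_mul, map_add, map_one, hζ, hθ, hc, ← hY']
        rw [div_mul_cancel₀ _ hπ0, ← mul_add, D.θ1, mul_one]
      rw [h8]
      exact add_mem (Ideal.mul_mem_left _ _ hθq) (Ideal.mul_mem_left _ _ hζq)
    · intro x y hxy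
      have := Subtype.mk.inj hxy
      exact Subtype.ext (Units.ext (sub_left_injective this))
  · rintro α ⟨a, ha⟩
    obtain ⟨β, hβ⟩ := Ideal.Quotient.mk_surjective (a : 𝓞 K ⧸ q ^ ℓ)
    refine ⟨algebraMap (𝓞 K) K β, fun w hw1 hw2 => ⟨w.valuation_le_one β, ?_⟩⟩
    obtain ⟨hqw, hw⟩ := hloc w hw1 hw2
    have h3 : red (q ^ ℓ) (YnR (q ^ ℓ) (Subgroup.inclusion hY α)) = red (q ^ ℓ) ((⟨_, mem_Rn _ β⟩ : Rn (q ^ ℓ)) ^ ℓ) := by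
      rw [map_pow, red_coe, hβ]
      exact (congrArg Units.val ha).symm
    have h4 : red (q ^ ℓ) (YnR (q ^ ℓ) (Subgroup.inclusion hY α) - (⟨_, mem_Rn _ β⟩ : Rn (q ^ ℓ)) ^ ℓ) = 0 := by
      rw [map_sub, h3, sub_self]
    obtain ⟨a0, ha0, h5⟩ := red_eq_zero h4
    have h6 := h5 w hqw
    have h7 := hw a0 ha0
    rw [← h6] at h7
    exact h7
end CM
end
end HCF


namespace HCF
open Module NumberField IsDedekindDomain WithZero
open scoped nonZeroDivisors Pointwise

section
set_option linter.unusedSectionVars false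
set_option linter.style.haveILetI false

theorem index_split {M A : Type*} [AddCommGroup M] [AddCommGroup A] (f : M →+ A) (J : AddSubgroup M) :
    J.relIndex f.ker * (J ⊔ f.ker).index = J.index := by
  rw [← AddSubgroup.relIndex_sup_left]
  exact AddSubgroup.relIndex_mul_index le_sup_left

theorem abs_count {Γ I : Type*} [AddCommGroup Γ] [AddCommGroup I] (φ : Γ →+ I) (hφ : Function.Surjective φ)
    (R : AddSubgroup I) (B : AddSubgroup Γ) (hB : ∀ b ∈ B, φ b ∈ R) : R.index * B.relIndex φ.ker ∣ B.index := by
  rw [← index_split φ B, mul_comm, ← AddSubgroup.index_comap_of_surjective R hφ]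
  apply mul_dvd_mul_left
  apply AddSubgroup.index_dvd_of_le
  rw [sup_le_iff]
  refine ⟨fun b hb => hB b hb, fun b hb => ?_⟩
  rw [AddSubgroup.mem_comap, AddMonoidHom.mem_ker.1 hb]
  exact zero_mem _

theorem unit_index_aux {A Q : Type*} [AddCommGroup A] [AddCommGroup Q] [Module.Finite ℤ Q] [Module.IsTorsionFree ℤ Q]
    (q : A →+ Q) (hq : Function.Surjective q) (ℓ : ℕ) (J : AddSubgroup A) (hJ : ∀ u ∈ J, ∃ y, q u = ℓ • q y) :
    ℓ ^ finrank ℤ Q ∣ J.index := by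
  rw [← finrank_range q (by rw [AddMonoidHom.range_eq_top.2 hq]; simp) ℓ]
  apply AddSubgroup.index_dvd_of_le
  intro u hu
  obtain ⟨y, hy⟩ := hJ u hu
  exact ⟨q y, ⟨_, rfl⟩, hy.symm⟩

theorem abs_GT {Z Y I E : Type*} [AddCommGroup Z] [AddCommGroup Y] [AddCommGroup I] [AddCommGroup E]
    [Module.Finite ℤ Z] [Module.IsTorsionFree ℤ Z] (ℓ : ℕ)
    (m : Z →+ I) (d : Y →+ I) (hsurj : ∀ i, ∃ a y, m a + d y = i)
    (R : AddSubgroup I) (BY : AddSubgroup Y) (hR1 : ∀ i, ℓ • i ∈ R) (hR2 : ∀ y ∈ BY, d y ∈ R)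
    (ι : E →+ Y) (hι : ∀ e, d (ι e) = 0) (hι' : ∀ y, d y = 0 → ∃ e, ι e = y)
    (hroot : ∀ y ∈ BY, ∀ a, m a + d y = 0 → ∃ z a', m a' + d z = 0 ∧ a = ℓ • a')
    (h : ℕ) (h0 : h ≠ 0) (hh : ∀ a, ∃ y, m (h • a) + d y = 0) :
    R.index * (ℓ ^ finrank ℤ Z * (BY.comap ι).index) ∣ ℓ ^ finrank ℤ Z * BY.index := by
  let φ : Z × Y →+ I := (m.comp (AddMonoidHom.fst _ _)) + (d.comp (AddMonoidHom.snd _ _))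
  have hφ : ∀ a y, φ (a, y) = m a + d y := fun a y => rfl
  have hφs : Function.Surjective φ := fun i => by
    obtain ⟨a, y, e⟩ := hsurj i; exact ⟨(a, y), e⟩
  let B : AddSubgroup (Z × Y) := ((nsmulAddMonoidHom (α := Z) ℓ).range).prod BY
  have hBindex : B.index = ℓ ^ finrank ℤ Z * BY.index := by
    rw [AddSubgroup.index_prod, AddSubgroup.index_range_nsmul]
  have hBR : ∀ b ∈ B, φ b ∈ R := by
    rintro ⟨_, y⟩ ⟨⟨a, rfl⟩, hy⟩
    rw [hφ]
    refine add_mem ?_ (hR2 y hy)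
    have : m (nsmulAddMonoidHom ℓ a) = ℓ • m a := by simp
    rw [this]; exact hR1 _
  have hcount := abs_count φ hφs _ B hBR
  rw [hBindex] at hcount
  refine (mul_dvd_mul_left _ ?_).trans hcount
  let ψ : φ.ker →+ Z := (AddMonoidHom.fst _ _).comp φ.ker.subtype
  set J := B.addSubgroupOf φ.ker with hJ
  change _ ∣ J.index
  rw [← index_split ψ J, mul_comm]
  apply mul_dvd_mul
  · let χ : E →+ φ.ker := ((AddMonoidHom.inr Z Y).comp ι).codRestrict φ.ker (fun e => by
      rw [AddMonoidHom.mem_ker]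
      change m 0 + d (ι e) = 0
      rw [hι, map_zero, add_zero])
    have hχ : χ.range = ψ.ker := by
      ext ⟨⟨a, y⟩, hay⟩
      constructor
      · rintro ⟨e, he⟩
        have := congrArg (fun z => z.1.1) he
        exact this.symm
      · intro h1
        have h1' : a = 0 := h1
        subst h1'
        obtain ⟨e, rfl⟩ := hι' y (by
          rw [AddMonoidHom.mem_ker, hφ, map_zero, zero_add] at hay; exact hay)
        exact ⟨e, rfl⟩
    rw [← hχ, ← AddSubgroup.index_comap]
    apply AddSubgroup.index_dvd_of_le
    intro e he
    exact he.2
  · have hfi : ψ.range.index ≠ 0 := by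
      have hle : (nsmulAddMonoidHom (α := Z) h).range ≤ ψ.range := by
        rintro _ ⟨a, rfl⟩
        obtain ⟨y, hy⟩ := hh a
        exact ⟨⟨(h • a, y), hy⟩, rfl⟩
      intro hz
      have := AddSubgroup.index_dvd_of_le hle
      rw [hz, zero_dvd_iff, AddSubgroup.index_range_nsmul] at this
      exact pow_ne_zero _ h0 this
    rw [← finrank_range ψ hfi ℓ]
    apply AddSubgroup.index_dvd_of_le
    rw [sup_le_iff]
    constructor
    · rintro ⟨⟨a, y⟩, hay⟩ hb
      obtain ⟨z, a', h1, h2⟩ := hroot y hb.2 a hay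
      refine ⟨a', ⟨⟨(a', z), h1⟩, rfl⟩, h2.symm⟩
    · intro x hx
      rw [AddSubgroup.mem_comap, AddMonoidHom.mem_ker.1 hx]
      exact zero_mem _

variable {F K : Type} [Field F] [NumberField F] [Field K] [NumberField K] [Algebra F K] {ℓ : ℕ}

theorem CM.root_descend (D : CM F K ℓ) (hl : ℓ.Prime) (u : F) (hu : u ≠ 0) (b : K) (hb : b ^ ℓ = algebraMap F K u) :
    ∃ y : F, u = y ^ ℓ ∨ u = -y ^ ℓ := by
  have hinj : Function.Injective (algebraMap F K) := (algebraMap F K).injective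
  have hτb : D.τ b ^ ℓ = algebraMap F K u := by rw [← map_pow, hb, AlgEquiv.commutes]
  rcases hl.eq_two_or_odd' with h2 | hodd
  · subst h2
    rcases sq_eq_sq_iff_eq_or_eq_neg.1 (hτb.trans hb.symm) with h | h
    · obtain ⟨y, hy⟩ := D.fixed h
      exact ⟨y, Or.inl (hinj (by rw [map_pow, hy, hb]))⟩
    · obtain ⟨y, hy⟩ := D.fixed (z := D.i * b) (by rw [map_mul, h, D.τi]; ring)
      refine ⟨y, Or.inr (hinj ?_)⟩
      rw [map_neg, map_pow, hy, mul_pow, hb, sq, D.hi]; ring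
  · obtain ⟨k, hk⟩ := hodd
    obtain ⟨y, hy⟩ := D.fixed (z := b * D.τ b) (by rw [map_mul, D.τ_τ, mul_comm])
    have h1 : y ^ ℓ = u ^ 2 := hinj (by rw [map_pow, hy, mul_pow, hb, hτb, map_pow, sq])
    have hy0 : y ≠ 0 := by
      rintro rfl
      rw [zero_pow hl.ne_zero] at h1
      exact hu (pow_eq_zero_iff two_ne_zero |>.1 h1.symm)
    refine ⟨u / y ^ k, Or.inl ?_⟩
    rw [div_pow, ← pow_mul, mul_comm k, pow_mul, h1, ← pow_mul]
    rw [eq_div_iff (pow_ne_zero _ hu), ← pow_succ']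
    congr 1
    omega

/-- units at T -/
def YT (T : Set (Pl F)) : Subgroup Fˣ where
  carrier := {x | ∀ v ∈ T, v.valuation F (x : F) = 1}
  mul_mem' hx hy v hv := by rw [Units.val_mul, map_mul, hx v hv, hy v hv, one_mul]
  one_mem' v hv := by simp
  inv_mem' hx v hv := by rw [Units.val_inv_eq_inv_val, map_inv₀, hx v hv, inv_one]

/-- reductions -/
noncomputable def rhoT (T : Finset (Pl F)) : YT (T : Set (Pl F)) →* ∀ v : T, (𝓞 F ⧸ v.1.asIdeal)ˣ :=
  MonoidHom.pi fun v => (redU v.1.asIdeal).comp (Subgroup.inclusion (show YT (T : Set (Pl F)) ≤ Yn v.1.asIdeal from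
    fun b hb w hw => by rw [CM.le_self hw]; exact hb v v.2))

theorem rho_eq (T : Finset (Pl F)) (x y : YT (T : Set (Pl F))) (h : rhoT T x = rhoT T y) (v : Pl F) (hv : v ∈ T) :
    v.valuation F (((x : Fˣ) : F) - ((y : Fˣ) : F)) < 1 := by
  have h1 := congrArg Units.val (congrFun h ⟨v, hv⟩)
  exact val_sub_lt_of_red_eq h1

theorem BY_index (hl : ℓ.Prime) (T : Finset (Pl F)) : ∃ A : Subgroup (YT (T : Set (Pl F))), A.index ≠ 0 ∧ A.index ≤ ℓ ^ T.card ∧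
    ∀ y ∈ A, ∃ z : YT (T : Set (Pl F)), ∀ v ∈ T, v.valuation F (((y : Fˣ) : F) - ((z : Fˣ) : F) ^ ℓ) < 1 := by
  let f := (rhoT T).rangeRestrict
  obtain ⟨h1, h2⟩ := idx_comap f ℓ
  refine ⟨_, h1, h2.trans ?_, ?_⟩
  · have h3 : Nat.card (∀ v : T, (powMonoidHom (α := (𝓞 F ⧸ v.1.asIdeal)ˣ) ℓ).ker) ≤ ℓ ^ T.card := by
      rw [Nat.card_pi]
      refine (Finset.prod_le_pow_card _ _ ℓ ?_).trans (by simp)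
      intro v _
      letI : Field (𝓞 F ⧸ v.1.asIdeal) := Ideal.Quotient.field _
      haveI : IsCyclic (𝓞 F ⧸ v.1.asIdeal)ˣ := inferInstance
      rw [IsCyclic.card_powMonoidHom_ker]
      exact Nat.gcd_le_right _ hl.pos
    refine le_trans ?_ h3
    refine Nat.card_le_card_of_injective (fun x v => ⟨x.1.1 v, ?_⟩) ?_
    · have := congrFun (congrArg Subtype.val (MonoidHom.mem_ker.1 x.2)) v
      exact this
    · intro x y h
      apply Subtype.ext; apply Subtype.ext
      funext v
      exact Subtype.mk.inj (congrFun h v)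
  · rintro y ⟨⟨_, z, rfl⟩, hz⟩
    refine ⟨z, fun v hv => ?_⟩
    have := rho_eq T y (z ^ ℓ) (by
      have := congrArg Subtype.val hz
      rw [map_pow]
      exact this.symm) v hv
    simpa using this

/-- the relation subgroup -/
noncomputable def RT (F : Type) [Field F] [NumberField F] (ℓ : ℕ) (T : Set (Pl F)) : AddSubgroup ({v : Pl F // v ∉ T} →₀ ℤ) :=
  (nsmulAddMonoidHom (α := {v : Pl F // v ∉ T} →₀ ℤ) ℓ).range ⊔ (dvX T).range

theorem map_neg_pow {H R : Type*} [CommRing R] [Group H] (f : Rˣ →* H) (h : f (-1) = 1) (y : Rˣ) (ℓ : ℕ) :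
    f (- y ^ ℓ) = f y ^ ℓ := by
  rw [← neg_one_mul, map_mul, h, map_pow, one_mul]

theorem unit_index [IsTotallyReal F] (ℓ : ℕ) (J : AddSubgroup (Additive (𝓞 F)ˣ))
    (hJ : ∀ u ∈ J, ∃ y : (𝓞 F)ˣ, u.toMul = y ^ ℓ ∨ u.toMul = - y ^ ℓ) : ℓ ^ (finrank ℚ F - 1) ∣ J.index := by
  have h := unit_index_aux (A := Additive (𝓞 F)ˣ) (Q := Additive ((𝓞 F)ˣ ⧸ Units.torsion F))
    (MonoidHom.toAdditive (QuotientGroup.mk' (Units.torsion F))) (QuotientGroup.mk'_surjective (Units.torsion F)) ℓ J ?_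
  · rw [Units.finrank_modTorsion, Units.rank,
      InfinitePlace.card_eq_nrRealPlaces_add_nrComplexPlaces, IsTotallyReal.nrComplexPlaces_eq_zero F, add_zero, ← IsTotallyReal.finrank F] at h
    exact h
  intro u hu
  obtain ⟨y, hy⟩ := hJ u hu
  refine ⟨.ofMul y, ?_⟩
  have h5 : (QuotientGroup.mk' (Units.torsion F)) (-1 : (𝓞 F)ˣ) = 1 := by
    apply (QuotientGroup.eq_one_iff (-1 : (𝓞 F)ˣ)).2
    rw [Units.torsion, CommGroup.mem_torsion, isOfFinOrder_iff_pow_eq_one]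
    exact ⟨2, by norm_num, by simp⟩
  change (QuotientGroup.mk' (Units.torsion F)) u.toMul = (QuotientGroup.mk' (Units.torsion F)) y ^ ℓ
  rcases hy with hy | hy
  · rw [hy, map_pow]
  · rw [hy]
    exact map_neg_pow (QuotientGroup.mk' (Units.torsion F)) h5 y ℓ

theorem GT_bound [IsTotallyReal F] (D : CM F K ℓ) (hl : ℓ.Prime) (S T : Finset (Pl F)) (hST : Disjoint S T)
    (hS : ∀ c : Additive (ClassGroup (𝓞 F)), ∃ E : Pl F →₀ ℤ, clD F E = c ∧ E.support ⊆ S)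
    (hdet : ∀ u : Fˣ, (∀ v ∉ S, v.valuation F (u : F) = 1) →
      (∀ v ∈ T, ∃ z : F, v.valuation F ((u : F) - z ^ ℓ) < 1) → ∃ b : K, b ^ ℓ = algebraMap F K u) :
    (RT F ℓ (T : Set (Pl F))).index * ℓ ^ (finrank ℚ F - 1) ≤ ℓ ^ T.card := by
  classical
  obtain ⟨BY, hBY0, hBYle, hBY⟩ := BY_index hl T
  let j : S → {v : Pl F // v ∉ (T : Set (Pl F))} := fun s => ⟨s.1, fun h => Finset.disjoint_left.1 hST s.2 h⟩
  have hj : Function.Injective j := fun a b h => Subtype.ext (congrArg (fun z => z.1) h)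
  obtain ⟨dY, hdY⟩ : ∃ dY : Additive (YT (T : Set (Pl F))) →+ ({v : Pl F // v ∉ (T : Set (Pl F))} →₀ ℤ),
      ∀ (y : YT (T : Set (Pl F))) v, dY (.ofMul y) v = ord v.1 ((y : Fˣ) : F) :=
    ⟨(Finsupp.subtypeDomainAddMonoidHom (p := fun v => v ∉ (T : Set (Pl F)))).comp
    ((dv F).comp (MonoidHom.toAdditive (YT (T : Set (Pl F))).subtype)), fun y v => rfl⟩
  obtain ⟨m, hm1, hm2⟩ : ∃ m : (S →₀ ℤ) →+ ({v : Pl F // v ∉ (T : Set (Pl F))} →₀ ℤ), (∀ a s, m a (j s) = a s) ∧ (∀ a v, v.1 ∉ S → m a v = 0) := by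
    refine ⟨Finsupp.mapDomain.addMonoidHom j, fun a s => Finsupp.mapDomain_apply hj _ _, ?_⟩
    intro a v hv
    apply Finsupp.mapDomain_of_notMem_range
    rintro ⟨w, rfl⟩
    exact hv w.2
  have hφs : ∀ d : ({v : Pl F // v ∉ (T : Set (Pl F))} →₀ ℤ), ∃ a y, m a + dY y = d := by
    intro d
    let ext : ({v : Pl F // v ∉ (T : Set (Pl F))} →₀ ℤ) →+ (Pl F →₀ ℤ) := Finsupp.mapDomain.addMonoidHom Subtype.val
    have hextT : ∀ v ∈ T, ext d v = 0 := by
      intro v hv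
      apply Finsupp.mapDomain_of_notMem_range
      rintro ⟨w, rfl⟩
      exact w.2 hv
    have hexta : ∀ v, ext d v.1 = d v := by
      intro v
      exact Finsupp.mapDomain_apply Subtype.val_injective _ _
    obtain ⟨E, hE, hEs⟩ := hS (clD F (ext d))
    obtain ⟨x, hx⟩ := (clD_eq_zero_iff (ext d - E)).1 (by rw [map_sub, hE, sub_self])
    have hE0 : ∀ v ∉ S, E v = 0 := fun v hv => Finsupp.notMem_support_iff.1 fun h => hv (hEs h)
    have hxY : x ∈ YT (T : Set (Pl F)) := by
      intro v hv
      rw [← ord_eq_zero_iff v (Units.ne_zero x), ← dv_apply, hx, Finsupp.sub_apply, hextT v hv,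
        hE0 v (fun h => Finset.disjoint_left.1 hST h hv), sub_zero]
    refine ⟨Finsupp.comapDomain Subtype.val E Subtype.val_injective.injOn, .ofMul ⟨x, hxY⟩, ?_⟩
    ext v
    rw [Finsupp.add_apply, hdY]
    change _ + ord v.1 (x : F) = _
    rw [← dv_apply, hx, Finsupp.sub_apply, hexta]
    by_cases hv : v.1 ∈ S
    · have : v = j ⟨v.1, hv⟩ := rfl
      rw [this, hm1, Finsupp.comapDomain_apply]
      ring
    · rw [hm2 _ _ hv, hE0 _ hv]; ring
  have hBR : ∀ y ∈ Subgroup.toAddSubgroup BY, dY y ∈ RT F ℓ (T : Set (Pl F)) := by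
    intro y hy
    obtain ⟨z, hz⟩ := hBY y.toMul hy
    have hx : ((y.toMul / z ^ ℓ : YT (T : Set (Pl F))) : Fˣ) ∈ Xs (T : Set (Pl F)) := by
      intro v hv
      have h1 := hz v hv
      have h2 : v.valuation F ((z : Fˣ) : F) = 1 := z.2 v hv
      have e : (((y.toMul / z ^ ℓ : YT (T : Set (Pl F))) : Fˣ) : F) - 1 =
        ((((y.toMul : YT (T : Set (Pl F))) : Fˣ) : F) - ((z : Fˣ) : F) ^ ℓ) / ((z : Fˣ) : F) ^ ℓ := by
        rw [sub_div, div_self (pow_ne_zero _ (Units.ne_zero _))]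
        simp
      rw [e, map_div₀, map_pow, h2, one_pow, div_one]
      exact h1
    have e : dY y = ℓ • dY (.ofMul z) + dvX (T : Set (Pl F)) (.ofMul ⟨_, hx⟩) := by
      have e1 : dvX (T : Set (Pl F)) (.ofMul ⟨_, hx⟩) = dY (.ofMul (y.toMul / z ^ ℓ)) := by
        ext v; rw [hdY]; rfl
      rw [e1, ← map_nsmul, ← map_add]
      congr 1
      apply Additive.toMul.injective
      simp
    rw [e]
    exact add_mem (AddSubgroup.mem_sup_left ⟨_, rfl⟩) (AddSubgroup.mem_sup_right ⟨_, rfl⟩)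
  have hmemY : ∀ x : Fˣ, (∀ v ∉ S, v.valuation F (x : F) = 1) → x ∈ YT (T : Set (Pl F)) :=
    fun x hx v hv => hx v fun h => Finset.disjoint_left.1 hST h hv
  -- an S-unit gives an element of the kernel
  have hker1 : ∀ (x : Fˣ) (hx : ∀ v ∉ S, v.valuation F (x : F) = 1),
      m (Finsupp.equivFunOnFinite.symm fun s : S => - ord s.1 (x : F)) + dY (.ofMul ⟨x, hmemY x hx⟩) = 0 := by
    intro x hx
    ext v
    rw [Finsupp.add_apply, hdY]
    by_cases hv : v.1 ∈ S
    · have : v = j ⟨v.1, hv⟩ := rfl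
      rw [this, hm1]
      simp [j]
    · rw [hm2 _ _ hv, (ord_eq_zero_iff v.1 (Units.ne_zero x)).2 (hx _ hv)]; rfl
  have hker2 : ∀ a (y : YT (T : Set (Pl F))), m a + dY (.ofMul y) = 0 →
      (∀ v ∉ S, v.valuation F ((y : Fˣ) : F) = 1) ∧ ∀ s : S, a s = - ord s.1 ((y : Fˣ) : F) := by
    intro a y hay
    constructor
    · intro v hv
      by_cases hvT : v ∈ (T : Set (Pl F))
      · exact y.2 v hvT
      · rw [← ord_eq_zero_iff v (Units.ne_zero _), ← hdY y ⟨v, hvT⟩]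
        have := DFunLike.congr_fun hay ⟨v, hvT⟩
        rw [Finsupp.add_apply, hm2 _ _ hv, zero_add] at this
        exact this
    · intro s
      have := DFunLike.congr_fun hay (j s)
      rw [Finsupp.add_apply, hm1, hdY] at this
      exact eq_neg_of_add_eq_zero_left this
  let ι : Additive (𝓞 F)ˣ →+ Additive (YT (T : Set (Pl F))) := MonoidHom.toAdditive
    ((Units.map (algebraMap (𝓞 F) F).toMonoidHom).codRestrict (YT (T : Set (Pl F))) (fun u v _ => val_unit u v))
  have hroot : ∀ y : YT (T : Set (Pl F)), y ∈ BY → (∀ v ∉ S, v.valuation F ((y : Fˣ) : F) = 1) →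
      ∃ z : Fˣ, (y : Fˣ) = z ^ ℓ ∨ (y : Fˣ) = - z ^ ℓ := by
    intro y hy hv
    obtain ⟨z, hz⟩ := hBY y hy
    obtain ⟨b, hb⟩ := hdet y hv (fun v hv => ⟨_, hz v hv⟩)
    obtain ⟨t, ht⟩ := D.root_descend hl _ (Units.ne_zero _) b hb
    have ht0 : t ≠ 0 := by
      rintro rfl
      rw [zero_pow hl.ne_zero, neg_zero, or_self] at ht
      exact Units.ne_zero _ ht
    refine ⟨Units.mk0 t ht0, ?_⟩
    rcases ht with ht | ht
    · left; apply Units.ext; simpa using ht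
    · right; apply Units.ext; simpa using ht
  have hval : ∀ (y z : Fˣ), (y = z ^ ℓ ∨ y = - z ^ ℓ) → ∀ v : Pl F, v.valuation F (y : F) = v.valuation F (z : F) ^ ℓ := by
    rintro y z (rfl | rfl) v
    · simp
    · simp [Valuation.map_neg]
  obtain ⟨h, hh0, hhc⟩ : ∃ h : ℕ, h ≠ 0 ∧ ∀ c : ClassGroup (𝓞 F), c ^ h = 1 :=
    ⟨Nat.card (ClassGroup (𝓞 F)), Nat.card_pos.ne', fun c => pow_card_eq_one'⟩
  have hh : ∀ a, ∃ y, m (h • a) + dY y = 0 := by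
    intro a
    obtain ⟨y, hy⟩ : ∃ y : Fˣ, dv F (.ofMul y) = h • Finsupp.mapDomain Subtype.val (-a) := by
      apply (clD_eq_zero_iff _).1
      rw [map_nsmul]
      apply Additive.toMul.injective
      rw [toMul_nsmul, hhc]; rfl
    have hyS : ∀ v ∉ S, v.valuation F (y : F) = 1 := by
      intro v hv
      rw [← ord_eq_zero_iff v (Units.ne_zero y), ← dv_apply, hy, Finsupp.smul_apply, Finsupp.mapDomain_of_notMem_range, smul_zero]
      rintro ⟨w, rfl⟩
      exact hv w.2
    refine ⟨.ofMul ⟨y, hmemY y hyS⟩, ?_⟩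
    convert hker1 y hyS using 3
    ext s
    have : ord s.1 (y : F) = h • (- a s) := by
      rw [← dv_apply, hy, Finsupp.smul_apply, Finsupp.mapDomain_apply Subtype.val_injective]; rfl
    simp [this]
  have hι1 : ∀ e, dY (ι e) = 0 := by
    intro e
    ext v
    refine (hdY (ι e).toMul v).trans ?_
    exact (ord_eq_zero_iff _ (Units.ne_zero _)).2 (val_unit e.toMul v.1)
  have hιu : ∀ y : Fˣ, (∀ v : Pl F, v.valuation F (y : F) = 1) → ∃ u : (𝓞 F)ˣ, ∀ hy : y ∈ YT (T : Set (Pl F)),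
      ι (.ofMul u) = .ofMul ⟨y, hy⟩ := by
    intro y hy
    obtain ⟨u, hu⟩ := exists_unit y hy
    exact ⟨u, fun hy => Additive.toMul.injective (Subtype.ext hu)⟩
  have hι2 : ∀ y, dY y = 0 → ∃ e, ι e = y := by
    intro y hy
    obtain ⟨u, hu⟩ := hιu ((y.toMul : YT (T : Set (Pl F))) : Fˣ) (by
      intro v
      by_cases hvT : v ∈ (T : Set (Pl F))
      · exact y.toMul.2 v hvT
      · rw [← ord_eq_zero_iff v (Units.ne_zero _)]
        exact (hdY y.toMul ⟨v, hvT⟩).symm.trans (DFunLike.congr_fun hy ⟨v, hvT⟩))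
    exact ⟨.ofMul u, hu y.toMul.2⟩
  have hroot' : ∀ y ∈ Subgroup.toAddSubgroup BY, ∀ a, m a + dY y = 0 → ∃ z a', m a' + dY z = 0 ∧ a = ℓ • a' := by
    intro y hy a hay
    obtain ⟨hy1, hy2⟩ := hker2 a y.toMul hay
    obtain ⟨z, hz⟩ := hroot y.toMul hy hy1
    have hzv := hval _ _ hz
    refine ⟨_, _, hker1 z (fun v hv => ?_), ?_⟩
    · have := hzv v
      rw [hy1 v hv] at this
      exact (pow_eq_one_iff_of_nonneg zero_le hl.ne_zero).1 this.symm
    · ext s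
      rw [hy2]
      have h1 := hzv s.1
      rw [val_eq_exp _ (Units.ne_zero _), val_eq_exp _ (Units.ne_zero z), ← exp_nsmul, exp_inj] at h1
      simp only [Finsupp.smul_apply, Finsupp.equivFunOnFinite_symm_apply_apply]
      exact h1
  have hu : ℓ ^ (finrank ℚ F - 1) ∣ ((Subgroup.toAddSubgroup BY).comap ι).index := by
    apply unit_index
    intro u hu
    obtain ⟨z, hz⟩ := hroot (ι u).toMul hu (fun v _ => val_unit u.toMul v)
    have hz1 : ∀ v : Pl F, v.valuation F (z : F) = 1 := fun v =>
      (pow_eq_one_iff_of_nonneg zero_le hl.ne_zero).1 ((hval _ _ hz v).symm.trans (val_unit u.toMul v))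
    obtain ⟨t, ht⟩ := exists_unit z hz1
    have hinj : Function.Injective (Units.map (algebraMap (𝓞 F) F).toMonoidHom) :=
      Units.map_injective (FaithfulSMul.algebraMap_injective (𝓞 F) F)
    refine ⟨t, ?_⟩
    have hι : ((ι u).toMul : Fˣ) = Units.map (algebraMap (𝓞 F) F).toMonoidHom u.toMul := rfl
    rw [hι] at hz
    refine hz.imp (fun h => hinj ?_) (fun h => hinj ?_)
    · rw [h, map_pow, ht]
    · rw [h, ← ht]
      apply Units.ext
      simp
  have key := abs_GT (Z := S →₀ ℤ) (Y := Additive (YT (T : Set (Pl F)))) (I := ({v : Pl F // v ∉ (T : Set (Pl F))} →₀ ℤ)) (E := Additive (𝓞 F)ˣ) ℓ m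
    dY hφs (RT F ℓ (T : Set (Pl F))) (Subgroup.toAddSubgroup BY)
    (fun i => AddSubgroup.mem_sup_left ⟨i, rfl⟩) hBR ι hι1 hι2 hroot' h hh0 hh
  have hBYi : (Subgroup.toAddSubgroup BY).index = BY.index := rfl
  rw [hBYi] at key
  have hpos : 0 < ℓ ^ finrank ℤ (S →₀ ℤ) := pow_pos hl.pos _
  have key2 : (RT F ℓ (T : Set (Pl F))).index * ((Subgroup.toAddSubgroup BY).comap ι).index ∣ BY.index := by
    rw [mul_left_comm] at key
    exact (Nat.mul_dvd_mul_iff_left hpos).1 key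
  exact (Nat.le_of_dvd (Nat.pos_of_ne_zero hBY0) ((mul_dvd_mul_left _ hu).trans key2)).trans hBYle
end
end HCF


namespace HCF
open Module NumberField IsDedekindDomain WithZero
open scoped nonZeroDivisors Pointwise

section
set_option linter.unusedSectionVars false
set_option linter.style.haveILetI false
open Filter Topology
open scoped ENNReal

/-- the zeta function as an extended nonnegative real -/
noncomputable def zetaE (K : Type) [Field K] [NumberField K] (s : ℝ) : ℝ≥0∞ :=
  ∑' I : {I : Ideal (𝓞 K) // I ≠ ⊥}, (Ideal.absNorm I.1 : ℝ≥0∞) ^ (-s)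

variable (K : Type) [Field K] [NumberField K]

theorem zetaE_eq (s : ℝ) : zetaE K s =
    ∑' n : ℕ, if n = 0 then 0 else (Nat.card {I : Ideal (𝓞 K) // Ideal.absNorm I = n} : ℝ≥0∞) * (n : ℝ≥0∞) ^ (-s) := by
  have h1 : zetaE K s = ∑' I : Ideal (𝓞 K), if Ideal.absNorm I = 0 then (0 : ℝ≥0∞) else (Ideal.absNorm I : ℝ≥0∞) ^ (-s) := by
    unfold zetaE
    refine (tsum_subtype {I : Ideal (𝓞 K) | I ≠ ⊥} (fun I : Ideal (𝓞 K) => (Ideal.absNorm I : ℝ≥0∞) ^ (-s))).trans ?_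
    refine tsum_congr fun I => ?_
    by_cases h : I = ⊥
    · subst h; simp
    · rw [Set.indicator_of_mem h, if_neg (Ideal.absNorm_eq_zero_iff.not.2 h)]
  rw [h1, ← (Equiv.sigmaFiberEquiv (fun I : Ideal (𝓞 K) => Ideal.absNorm I)).tsum_eq, ENNReal.tsum_sigma']
  refine tsum_congr fun n => ?_
  have h2 : ∀ I : {I : Ideal (𝓞 K) // Ideal.absNorm I = n},
    (if Ideal.absNorm ((Equiv.sigmaFiberEquiv (fun I : Ideal (𝓞 K) => Ideal.absNorm I)) ⟨n, I⟩) = 0 then (0 : ℝ≥0∞) else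
      (Ideal.absNorm ((Equiv.sigmaFiberEquiv (fun I : Ideal (𝓞 K) => Ideal.absNorm I)) ⟨n, I⟩) : ℝ≥0∞) ^ (-s)) =
      if n = 0 then 0 else (n : ℝ≥0∞) ^ (-s) := by
    rintro ⟨I, rfl⟩; rfl
  rw [tsum_congr h2]
  haveI : Finite {I : Ideal (𝓞 K) // Ideal.absNorm I = n} := Ideal.finite_setOfPred_absNorm_eq n
  haveI := Fintype.ofFinite {I : Ideal (𝓞 K) // Ideal.absNorm I = n}
  rw [tsum_fintype, Finset.sum_const, Finset.card_univ, Nat.card_eq_fintype_card]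
  split_ifs <;> simp

theorem zetaE_dedekind (s : ℝ) (h : dedekindZeta K s ≠ 0) :
    zetaE K s ≠ ∞ ∧ ((zetaE K s).toReal : ℂ) = dedekindZeta K s := by
  set a : ℕ → ℝ := fun n => if n = 0 then 0 else (Nat.card {I : Ideal (𝓞 K) // Ideal.absNorm I = n} : ℝ) * (n : ℝ) ^ (-s) with ha
  have ha0 : ∀ n, 0 ≤ a n := by
    intro n; rw [ha]; dsimp only; split_ifs
    · exact le_rfl
    · positivity
  have hae : zetaE K s = ∑' n, ENNReal.ofReal (a n) := by
    rw [zetaE_eq]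
    refine tsum_congr fun n => ?_
    rw [ha]; dsimp only; split_ifs with hn
    · simp
    · rw [ENNReal.ofReal_mul (by positivity), ← ENNReal.ofReal_rpow_of_pos (by positivity)]
      simp
  have hterm : ∀ n, LSeries.term (fun n ↦ (Nat.card {I : Ideal (𝓞 K) // Ideal.absNorm I = n} : ℂ)) s n = ((a n : ℝ) : ℂ) := by
    intro n
    rw [LSeries.term_def, ha]; dsimp only; split_ifs with hn
    · simp
    · rw [Real.rpow_neg (by positivity)]
      push_cast
      rw [Complex.ofReal_cpow (by positivity)]
      simp [div_eq_mul_inv]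
  have hd : dedekindZeta K s = ∑' n, ((a n : ℝ) : ℂ) := by
    unfold dedekindZeta LSeries
    exact tsum_congr hterm
  rw [hd, ← Complex.ofReal_tsum] at h
  have hs : Summable a := by
    by_contra hs
    rw [tsum_eq_zero_of_not_summable hs] at h
    exact h rfl
  rw [hae, ← ENNReal.ofReal_tsum_of_nonneg ha0 hs]
  refine ⟨ENNReal.ofReal_ne_top, ?_⟩
  rw [ENNReal.toReal_ofReal (tsum_nonneg ha0), hd, Complex.ofReal_tsum]

theorem zetaE_tendsto : (∀ᶠ s : ℝ in 𝓝[>] 1, zetaE K s ≠ ∞) ∧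
    Tendsto (fun s : ℝ => (s - 1) * (zetaE K s).toReal) (𝓝[>] 1) (𝓝 (dedekindZeta_residue K)) := by
  have h := tendsto_sub_one_mul_dedekindZeta_nhdsGT K
  have hne : ∀ᶠ s : ℝ in 𝓝[>] 1, dedekindZeta K s ≠ 0 := by
    filter_upwards [h.eventually_ne (Complex.ofReal_ne_zero.2 (dedekindZeta_residue_ne_zero K))] with s hs
    exact right_ne_zero_of_mul hs
  refine ⟨hne.mono fun s hs => (zetaE_dedekind K s hs).1, ?_⟩
  have h2 := (Complex.continuous_re.tendsto _).comp h
  rw [Complex.ofReal_re] at h2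
  refine h2.congr' ?_
  filter_upwards [hne] with s hs
  rw [Function.comp_apply, ← (zetaE_dedekind K s hs).2]
  simp

theorem zeta_contra (E : Type) [Field E] [NumberField E] (C : ℝ≥0∞) (hC : C ≠ ∞)
    (h : ∀ s : ℝ, 1 < s → zetaE K s ≠ ∞ → zetaE K s ^ 2 ≤ C * zetaE E s) : False := by
  obtain ⟨hK, hK'⟩ := zetaE_tendsto K
  obtain ⟨hE, hE'⟩ := zetaE_tendsto E
  have h1 : Tendsto (fun s : ℝ => ((s - 1) * (zetaE K s).toReal) ^ 2) (𝓝[>] 1) (𝓝 (dedekindZeta_residue K ^ 2)) := hK'.pow 2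
  have h2 : Tendsto (fun s : ℝ => C.toReal * ((s - 1) * ((s - 1) * (zetaE E s).toReal))) (𝓝[>] 1)
      (𝓝 (C.toReal * ((1 - 1) * dedekindZeta_residue E))) := by
    refine Tendsto.const_mul _ (Tendsto.mul ?_ hE')
    exact tendsto_nhdsWithin_of_tendsto_nhds (ContinuousAt.tendsto (by fun_prop))
  have h3 := le_of_tendsto_of_tendsto h1 h2 (by
    filter_upwards [hK, hE, self_mem_nhdsWithin] with s hs1 hs2 hs3
    have h4 := ENNReal.toReal_mono (ENNReal.mul_ne_top hC hs2) (h s hs3 hs1)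
    rw [ENNReal.toReal_pow, ENNReal.toReal_mul] at h4
    have h5 : 0 ≤ (s - 1) ^ 2 := sq_nonneg _
    nlinarith [mul_le_mul_of_nonneg_left h4 h5])
  rw [sub_self, zero_mul, mul_zero] at h3
  have := dedekindZeta_residue_pos K
  nlinarith
end
end HCF


namespace HCF
open Module NumberField IsDedekindDomain WithZero
open scoped nonZeroDivisors Pointwise

section
set_option linter.unusedSectionVars false
set_option linter.style.haveILetI false
open scoped ENNReal

variable {K : Type} [Field K] [NumberField K]

/-- weight of a multiset of primes -/
noncomputable def wt (s : ℝ) (m : Multiset (Pl K)) : ℝ≥0∞ := (m.map fun w => (Ideal.absNorm w.asIdeal : ℝ≥0∞) ^ (-s)).prod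

theorem wt_add (s : ℝ) (m m' : Multiset (Pl K)) : wt s (m + m') = wt s m * wt s m' := by
  simp [wt]

theorem wt_cons (s : ℝ) (w : Pl K) (m : Multiset (Pl K)) :
    wt s (w ::ₘ m) = (Ideal.absNorm w.asIdeal : ℝ≥0∞) ^ (-s) * wt s m := by
  simp [wt]

/-- ideal of a multiset -/
noncomputable def mP (m : Multiset (Pl K)) : {I : Ideal (𝓞 K) // I ≠ ⊥} :=
  ⟨(m.map fun w => w.asIdeal).prod, by
    rw [← Ideal.zero_eq_bot]
    apply Multiset.prod_ne_zero
    intro h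
    obtain ⟨w, _, hw⟩ := Multiset.mem_map.1 h
    exact w.ne_bot hw⟩

theorem mP_wt (s : ℝ) (m : Multiset (Pl K)) : (Ideal.absNorm (mP m).1 : ℝ≥0∞) ^ (-s) = wt s m := by
  induction m using Multiset.induction_on with
  | empty => simp [mP, wt]
  | cons w m ih =>
    rw [wt_cons, ← ih, ← ENNReal.mul_rpow_of_ne_top (ENNReal.natCast_ne_top _) (ENNReal.natCast_ne_top _)]
    simp [mP]

theorem mP_inj : Function.Injective (mP (K := K)) := by
  intro m m' h
  have h1 := congrArg (fun I => UniqueFactorizationMonoid.normalizedFactors I.1) h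
  have key : ∀ m : Multiset (Pl K), UniqueFactorizationMonoid.normalizedFactors (mP m).1 = m.map fun w => w.asIdeal := by
    intro m
    apply UniqueFactorizationMonoid.normalizedFactors_prod_of_prime
    intro p hp
    obtain ⟨w, _, rfl⟩ := Multiset.mem_map.1 hp
    exact w.prime
  simp only [key] at h1
  exact Multiset.map_injective (fun a b h => HeightOneSpectrum.ext h) h1

theorem mP_surj : Function.Surjective (mP (K := K)) := by
  rintro ⟨I, hI⟩
  have h1 : ∀ p ∈ UniqueFactorizationMonoid.normalizedFactors I, Prime p := fun p hp =>
    UniqueFactorizationMonoid.prime_of_normalized_factor p hp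
  refine ⟨(UniqueFactorizationMonoid.normalizedFactors I).pmap (fun p hp => (⟨p, Ideal.isPrime_of_prime hp, hp.ne_zero⟩ : Pl K)) h1,
    Subtype.ext ?_⟩
  change ((Multiset.pmap _ _ _).map _).prod = I
  rw [Multiset.map_pmap]
  simp only [Multiset.pmap_eq_map, Multiset.map_id']
  rw [UniqueFactorizationMonoid.prod_normalizedFactors_eq (by exact hI), normalize_eq]

theorem zetaE_multiset (s : ℝ) : zetaE K s = ∑' m : Multiset (Pl K), wt s m := by
  unfold zetaE
  rw [← (Equiv.ofBijective (mP (K := K)) ⟨mP_inj, mP_surj⟩).tsum_eq]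
  exact tsum_congr fun m => mP_wt s m

/-- sum over multisets avoiding B -/
noncomputable def ZB (B : Finset (Pl K)) (s : ℝ) : ℝ≥0∞ := ∑' m : {m : Multiset (Pl K) | ∀ w ∈ m, w ∉ B}, wt s m.1

theorem ZB_empty (s : ℝ) : ZB (∅ : Finset (Pl K)) s = zetaE K s := by
  rw [zetaE_multiset]
  unfold ZB
  have : {m : Multiset (Pl K) | ∀ w ∈ m, w ∉ (∅ : Finset (Pl K))} = Set.univ := by
    ext m; simp
  rw [this]
  exact tsum_univ (wt s)

theorem ZB_le (B : Finset (Pl K)) (s : ℝ) : ZB B s ≤ zetaE K s := by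
  rw [zetaE_multiset]
  exact ENNReal.tsum_comp_le_tsum_of_injective Subtype.val_injective _

theorem norm_half (w : Pl K) (s : ℝ) (hs : 1 < s) : (Ideal.absNorm w.asIdeal : ℝ≥0∞) ^ (-s) ≤ 2⁻¹ := by
  have h1 : (2 : ℝ≥0∞) ≤ (Ideal.absNorm w.asIdeal : ℝ≥0∞) := by
    have h2 : Ideal.absNorm w.asIdeal ≠ 1 := fun h => w.isPrime.ne_top (Ideal.absNorm_eq_one_iff.1 h)
    have h3 : Ideal.absNorm w.asIdeal ≠ 0 := fun h => w.ne_bot (Ideal.absNorm_eq_zero_iff.1 h)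
    have : 2 ≤ Ideal.absNorm w.asIdeal := by omega
    exact_mod_cast this
  rw [ENNReal.rpow_neg, ENNReal.inv_le_inv]
  refine h1.trans ?_
  conv_lhs => rw [← ENNReal.rpow_one (Ideal.absNorm w.asIdeal : ℝ≥0∞)]
  exact ENNReal.rpow_le_rpow_of_exponent_le (le_trans (by norm_num) h1) hs.le

open Classical in
theorem ZB_insert (B : Finset (Pl K)) (w : Pl K) (s : ℝ) (hs : 1 < s) (hf : zetaE K s ≠ ∞) :
    ZB B s ≤ 2 * ZB (insert w B) s := by
  by_cases hw : w ∈ B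
  · rw [Finset.insert_eq_of_mem hw, two_mul]
    exact le_self_add
  have hZ : ZB B s ≠ ∞ := ne_top_of_le_ne_top hf (ZB_le B s)
  have h1 : ZB B s ≤ ZB (insert w B) s + 2⁻¹ * ZB B s := by
    have h2 : {m : Multiset (Pl K) | ∀ w ∈ m, w ∉ B} =
      {m : Multiset (Pl K) | ∀ v ∈ m, v ∉ insert w B} ∪ {m | (∀ v ∈ m, v ∉ B) ∧ w ∈ m} := by
      ext m
      simp only [Set.mem_ofPred_eq, Set.mem_union, Finset.mem_insert, not_or]
      constructor
      · intro h
        by_cases hm : w ∈ m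
        · exact Or.inr ⟨h, hm⟩
        · exact Or.inl fun v hv => ⟨fun e => hm (e ▸ hv), h v hv⟩
      · rintro (h | h)
        · exact fun v hv => (h v hv).2
        · exact h.1
    have h3 : ZB B s ≤ ZB (insert w B) s + ∑' m : {m : Multiset (Pl K) | (∀ v ∈ m, v ∉ B) ∧ w ∈ m}, wt s m.1 := by
      conv_lhs => unfold ZB
      rw [h2]
      exact ENNReal.tsum_union_le (wt s) _ _
    refine h3.trans (add_le_add_right ?_ _)
    have h4 : ∑' m : {m : Multiset (Pl K) | (∀ v ∈ m, v ∉ B) ∧ w ∈ m}, wt s m.1 ≤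
        ∑' m : {m : Multiset (Pl K) | ∀ v ∈ m, v ∉ B}, wt s (w ::ₘ m.1) := by
      refine ENNReal.tsum_le_tsum_comp_of_surjective (α := {m : Multiset (Pl K) | ∀ v ∈ m, v ∉ B})
        (f := fun m => (⟨w ::ₘ m.1, ?_, Multiset.mem_cons_self _ _⟩ : {m : Multiset (Pl K) | (∀ v ∈ m, v ∉ B) ∧ w ∈ m})) ?_
        (fun m => wt s m.1)
      · intro v hv
        rcases Multiset.mem_cons.1 hv with rfl | hv
        · exact hw
        · exact m.2 v hv
      · rintro ⟨m, hm1, hm2⟩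
        obtain ⟨t, ht⟩ := Multiset.exists_cons_of_mem hm2
        exact ⟨⟨t, fun v hv => hm1 v (ht ▸ Multiset.mem_cons_of_mem hv)⟩, Subtype.ext ht.symm⟩
    refine h4.trans ?_
    simp only [wt_cons]
    rw [ENNReal.tsum_mul_left]
    exact mul_le_mul_left (norm_half w s hs) _
  have h5 : ZB B s = 2⁻¹ * ZB B s + 2⁻¹ * ZB B s := by
    rw [← add_mul, ENNReal.inv_two_add_inv_two, one_mul]
  conv_lhs at h1 => rw [h5]
  have h6 : 2⁻¹ * ZB B s ≤ ZB (insert w B) s :=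
    (ENNReal.add_le_add_iff_right (ENNReal.mul_ne_top (by simp) hZ)).1 h1
  calc ZB B s = 2 * (2⁻¹ * ZB B s) := by
        rw [← mul_assoc, ENNReal.mul_inv_cancel (by simp) (by simp), one_mul]
    _ ≤ _ := by gcongr

theorem zeta_le_ZB (B : Finset (Pl K)) (s : ℝ) (hs : 1 < s) (hf : zetaE K s ≠ ∞) : zetaE K s ≤ 2 ^ B.card * ZB B s := by
  classical
  induction B using Finset.induction_on with
  | empty => rw [ZB_empty]; simp
  | insert w B hw ih =>
    refine ih.trans ?_
    rw [Finset.card_insert_of_notMem hw, pow_succ, mul_assoc]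
    gcongr
    exact ZB_insert B w s hs hf

theorem split_contra {E : Type} [Field E] [NumberField E] [hne : Nonempty (Pl E)] (B : Finset (Pl K)) (r : Pl E → Pl K)
    (h : ∀ w ∉ B, ∃ P Q : Pl E, P ≠ Q ∧ r P = w ∧ r Q = w ∧ Ideal.absNorm P.asIdeal = Ideal.absNorm w.asIdeal ∧
      Ideal.absNorm Q.asIdeal = Ideal.absNorm w.asIdeal) : False := by
  classical
  have h' : ∀ w, ∃ P Q : Pl E, w ∉ B → (P ≠ Q ∧ r P = w ∧ r Q = w ∧ Ideal.absNorm P.asIdeal = Ideal.absNorm w.asIdeal ∧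
      Ideal.absNorm Q.asIdeal = Ideal.absNorm w.asIdeal) := by
    intro w
    by_cases hw : w ∈ B
    · obtain ⟨P⟩ := hne
      exact ⟨P, P, fun h => absurd hw h⟩
    · obtain ⟨P, Q, h⟩ := h w hw
      exact ⟨P, Q, fun _ => h⟩
  choose p q hpq using h'
  refine zeta_contra K E ((2 ^ B.card) ^ 2) (by simp) ?_
  intro s hs hf
  calc zetaE K s ^ 2 ≤ (2 ^ B.card * ZB B s) ^ 2 := by gcongr; exact zeta_le_ZB B s hs hf
    _ = (2 ^ B.card) ^ 2 * ZB B s ^ 2 := by rw [mul_pow]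
    _ ≤ _ := by
      gcongr
      rw [zetaE_multiset (K := E), sq]
      have hw : ∀ (f : Pl K → Pl E) (hf : ∀ w ∉ B, Ideal.absNorm (f w).asIdeal = Ideal.absNorm w.asIdeal)
        (m : Multiset (Pl K)), (∀ w ∈ m, w ∉ B) → wt s (m.map f) = wt s m := by
        intro f hf m hm
        unfold wt
        rw [Multiset.map_map]
        congr 1
        apply Multiset.map_congr rfl
        intro w hw
        simp [hf w (hm w hw)]
      have e : ZB B s * ZB B s = ∑' x : {m : Multiset (Pl K) | ∀ w ∈ m, w ∉ B} × {m : Multiset (Pl K) | ∀ w ∈ m, w ∉ B},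
          wt s (x.1.1.map p + x.2.1.map q) := by
        unfold ZB
        rw [← ENNReal.tsum_mul_right]
        simp_rw [← ENNReal.tsum_mul_left]
        rw [← ENNReal.tsum_prod (f := fun (a b : {m : Multiset (Pl K) | ∀ w ∈ m, w ∉ B}) => wt s a.1 * wt s b.1)]
        refine tsum_congr fun x => ?_
        rw [wt_add, hw p (fun w hw => (hpq w hw).2.2.2.1) _ x.1.2, hw q (fun w hw => (hpq w hw).2.2.2.2) _ x.2.2]
      rw [e]
      refine ENNReal.tsum_comp_le_tsum_of_injective
        (f := fun x : {m : Multiset (Pl K) | ∀ w ∈ m, w ∉ B} × {m : Multiset (Pl K) | ∀ w ∈ m, w ∉ B} => x.1.1.map p + x.2.1.map q) ?_ _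
      have f1 : ∀ m : {m : Multiset (Pl K) | ∀ w ∈ m, w ∉ B}, (m.1.map p).filter (fun P => p (r P) = P) = m.1.map p := by
        intro m
        rw [Multiset.filter_eq_self]
        intro P hP
        obtain ⟨w, hw, rfl⟩ := Multiset.mem_map.1 hP
        rw [(hpq w (m.2 w hw)).2.1]
      have f2 : ∀ m : {m : Multiset (Pl K) | ∀ w ∈ m, w ∉ B}, (m.1.map q).filter (fun P => p (r P) = P) = 0 := by
        intro m
        rw [Multiset.filter_eq_nil]
        intro P hP
        obtain ⟨w, hw, rfl⟩ := Multiset.mem_map.1 hP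
        rw [(hpq w (m.2 w hw)).2.2.1]
        exact (hpq w (m.2 w hw)).1
      have g : ∀ (f : Pl K → Pl E) (hf : ∀ w ∉ B, r (f w) = w) (m : {m : Multiset (Pl K) | ∀ w ∈ m, w ∉ B}),
          (m.1.map f).map r = m.1 := by
        intro f hf m
        rw [Multiset.map_map]
        conv_rhs => rw [← Multiset.map_id m.1]
        apply Multiset.map_congr rfl
        intro w hw
        exact hf w (m.2 w hw)
      rintro ⟨a, b⟩ ⟨a', b'⟩ hab
      have h1 := congrArg (Multiset.filter (fun P => p (r P) = P)) hab
      simp only [Multiset.filter_add, f1, f2, add_zero] at h1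
      have h2 : b.1.map q = b'.1.map q := by
        have := hab
        simp only [h1] at this
        exact add_left_cancel this
      have ha := congrArg (Multiset.map r) h1
      have hb := congrArg (Multiset.map r) h2
      rw [g p (fun w hw => (hpq w hw).2.1), g p (fun w hw => (hpq w hw).2.1)] at ha
      rw [g q (fun w hw => (hpq w hw).2.2.1), g q (fun w hw => (hpq w hw).2.2.1)] at hb
      exact Prod.ext (Subtype.ext ha) (Subtype.ext hb)
end
end HCF

namespace HCF
open Module NumberField IsDedekindDomain WithZero
open scoped nonZeroDivisors Pointwise
section
set_option linter.style.haveILetI false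
variable {F L : Type} [Field F] [Field L] [NumberField F] [NumberField L] [Algebra F L]

theorem relNorm_und (Q : Pl L) : Ideal.relNorm (𝓞 F) Q.asIdeal = (und F Q).asIdeal ^ (Q.asIdeal.inertiaDeg (𝓞 F)) :=
  haveI := Q.isMaximal
  haveI := (und F Q).isMaximal
  Ideal.relNorm_eq_pow_of_isMaximal Q.asIdeal (und F Q).asIdeal

theorem card_stab [IsGalois F L] (Q : Pl L) : Nat.card (MulAction.stabilizer (L ≃ₐ[F] L) Q.asIdeal) =
    Q.asIdeal.ramificationIdx (𝓞 F) * Q.asIdeal.inertiaDeg (𝓞 F) := by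
  haveI := Q.isMaximal
  haveI := (und F Q).isMaximal
  haveI : Finite (und F Q).asIdeal.ResidueField := inferInstance
  haveI : PerfectField (und F Q).asIdeal.ResidueField := inferInstance
  rw [Ideal.card_stabilizer_eq (und F Q).asIdeal Q.asIdeal, Ideal.inertiaDegIn_eq_inertiaDeg _ Q.asIdeal (L ≃ₐ[F] L),
    Ideal.ramificationIdxIn_eq_ramificationIdx _ Q.asIdeal (L ≃ₐ[F] L)]

theorem relNorm_split [IsGalois F L] (Q : Pl L) (h : ∀ g : L ≃ₐ[F] L, g • Q = Q → g = 1) :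
    Ideal.relNorm (𝓞 F) Q.asIdeal = (und F Q).asIdeal := by
  have h1 : MulAction.stabilizer (L ≃ₐ[F] L) Q.asIdeal = ⊥ := by
    rw [eq_bot_iff]
    intro g hg
    exact h g (HeightOneSpectrum.ext hg)
  have h2 := card_stab (F := F) Q
  rw [h1, Subgroup.card_bot] at h2
  rw [relNorm_und, Nat.eq_one_of_mul_eq_one_left h2.symm, pow_one]

theorem relNorm_inert [IsGalois F L] (Q : Pl L) (h : ∀ g : L ≃ₐ[F] L, g • Q = Q)
    (hu : ∀ x : F, Q.valuation L (algebraMap F L x) = (und F Q).valuation F x) :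
    Ideal.relNorm (𝓞 F) Q.asIdeal = (und F Q).asIdeal ^ finrank F L := by
  have h1 : MulAction.stabilizer (L ≃ₐ[F] L) Q.asIdeal = ⊤ := by
    rw [eq_top_iff]
    intro g hg
    exact congrArg HeightOneSpectrum.asIdeal (h g)
  have h2 := card_stab (F := F) Q
  rw [h1, Subgroup.card_top, IsGalois.card_aut_eq_finrank] at h2
  have h3 : Q.asIdeal.ramificationIdx (𝓞 F) = 1 := by
    obtain ⟨x, hx⟩ := (und F Q).valuation_exists_uniformizer F
    have h4 := HeightOneSpectrum.valuation_liesOver L (und F Q) Q x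
    rw [hu, hx, ← exp_nsmul, exp_inj, Ideal.ramificationIdx'_eq_ramificationIdx _ _ (und F Q).ne_bot] at h4
    have h5 : ((Q.asIdeal.ramificationIdx (𝓞 F) : ℕ) : ℤ) = 1 := by
      simp only [nsmul_eq_mul] at h4
      linarith
    exact_mod_cast h5
  rw [relNorm_und, h2, h3, one_mul]

end
section
set_option linter.unusedSectionVars false
set_option linter.style.haveILetI false
variable {F K : Type} [Field F] [NumberField F] [Field K] [NumberField K] [Algebra F K] {ℓ : ℕ}

theorem kummer_stab {E : Type} [Field E] [NumberField E] [Algebra K E] (hl : ℓ.Prime) {ζ : K} (hζ : IsPrimitiveRoot ζ ℓ)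
    {u z : K} {θ : E} (hθ : θ ^ ℓ = algebraMap K E u) (hgen : ∀ g : E ≃ₐ[K] E, g θ = θ → g = 1)
    (P : Pl E) (h1 : (und K P).valuation K (ℓ : K) = 1) (h2 : (und K P).valuation K u = 1)
    (h3 : (und K P).valuation K (u - z ^ ℓ) < 1) (g : E ≃ₐ[K] E) (hg : g • P = P) : g = 1 := by
  have hl1 : P.valuation E (ℓ : E) = 1 := by
    have := (und_val_eq_one P (ℓ : K)).2 h1
    simpa using this
  have hθ1 : P.valuation E θ = 1 := by
    have := (und_val_eq_one P u).2 h2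
    rw [← hθ, map_pow, pow_eq_one_iff_of_nonneg zero_le hl.ne_zero] at this
    exact this
  have hθ0 : θ ≠ 0 := by rintro rfl; simp at hθ1
  have h4 := (und_val_lt_one P _).2 h3
  rw [map_sub, map_pow, ← hθ] at h4
  have hζE : IsPrimitiveRoot (algebraMap K E ζ) ℓ := hζ.map_of_injective (algebraMap K E).injective
  obtain ⟨k, hk⟩ := exists_root_close P hl hζE h4
  have hk' : P.valuation E (g θ - algebraMap K E ζ ^ k * algebraMap K E z) < 1 := by
    have := smul_val g P (θ - algebraMap K E ζ ^ k * algebraMap K E z)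
    rw [hg, map_sub, map_mul, map_pow, g.commutes, g.commutes] at this
    rw [this]; exact hk
  have h5 : P.valuation E (g θ - θ) < 1 := by
    have : g θ - θ = (g θ - algebraMap K E ζ ^ k * algebraMap K E z) - (θ - algebraMap K E ζ ^ k * algebraMap K E z) := by ring
    rw [this]
    exact (Valuation.map_sub _ _ _).trans_lt (max_lt hk' hk)
  by_contra hne
  have hη1 : g θ / θ ≠ 1 := fun h => hne (hgen g (by rwa [div_eq_one_iff_eq hθ0] at h))
  have hη : (g θ / θ) ^ ℓ = 1 := by
    rw [div_pow, ← map_pow, hθ, g.commutes, ← hθ, div_self (pow_ne_zero _ hθ0)]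
  have h6 := val_one_or_root P hη hη1 hl1
  have h7 : g θ - θ = (g θ / θ - 1) * θ := by field_simp
  rw [h7, map_mul, h6, hθ1, one_mul] at h5
  exact lt_irrefl _ h5

theorem kummer_detect (hl : ℓ.Prime) {ζ : K} (hζ : IsPrimitiveRoot ζ ℓ) (u : K) (hu : ∀ b : K, b ^ ℓ ≠ u)
    (B : Finset (Pl K)) (hB : ∀ w ∉ B, w.valuation K (ℓ : K) = 1 ∧ w.valuation K u = 1) :
    ∃ w ∉ B, ∀ z : K, ¬ w.valuation K (u - z ^ ℓ) < 1 := by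
  by_contra hcon
  push Not at hcon
  have hirr := X_pow_sub_C_irreducible_of_prime hl hu
  have hne : (primitiveRoots ℓ K).Nonempty := ⟨ζ, (mem_primitiveRoots hl.pos).2 hζ⟩
  let E := (Polynomial.X ^ ℓ - Polynomial.C u).SplittingField
  haveI : IsGalois K E := isGalois_of_isSplittingField_X_pow_sub_C hne hirr E
  haveI : FiniteDimensional K E := inferInstance
  haveI : CharZero E := charZero_of_injective_algebraMap (algebraMap K E).injective
  haveI : FiniteDimensional ℚ E := Module.Finite.trans K E
  haveI : NumberField E := ⟨⟩
  obtain ⟨θ, hθ⟩ : ∃ θ : E, θ ^ ℓ = algebraMap K E u := by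
    have hs := Polynomial.SplittingField.splits (Polynomial.X ^ ℓ - Polynomial.C u)
    obtain ⟨θ, h⟩ := Polynomial.Splits.exists_eval_eq_zero hs (by
      rw [Polynomial.degree_map, Polynomial.degree_X_pow_sub_C hl.pos]
      exact_mod_cast hl.ne_zero)
    refine ⟨θ, ?_⟩
    simp [sub_eq_zero] at h
    exact h
  have htop := IntermediateField.adjoin_root_eq_top_of_isSplittingField hne hirr (L := E) hθ
  have hgen : ∀ g : E ≃ₐ[K] E, g θ = θ → g = 1 := by
    intro g hg
    ext z
    have hz : z ∈ IntermediateField.adjoin K {θ} := by rw [htop]; trivial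
    refine IntermediateField.adjoin_induction K (p := fun z _ => g z = (1 : E ≃ₐ[K] E) z) ?_ ?_ ?_ ?_ ?_ hz
    · rintro _ rfl; exact hg
    · intro z; simp
    · intro a b _ _ ha hb; rw [map_add, map_add, ha, hb]
    · intro a _ ha; rw [map_inv₀, map_inv₀, ha]
    · intro a b _ _ ha hb; rw [map_mul, map_mul, ha, hb]
  have hfin : finrank K E = ℓ := finrank_of_isSplittingField_X_pow_sub_C hne hirr E
  obtain ⟨g, hg⟩ : ∃ g : E ≃ₐ[K] E, g ≠ 1 := by
    by_contra hc
    push Not at hc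
    have : Nat.card (E ≃ₐ[K] E) = 1 := Nat.card_eq_one_iff_exists.2 ⟨1, hc⟩
    rw [IsGalois.card_aut_eq_finrank, hfin] at this
    exact hl.one_lt.ne' this
  haveI : Nonempty (Pl E) := by
    obtain ⟨M, hM⟩ := Ideal.exists_maximal (𝓞 E)
    exact ⟨⟨M, hM.isPrime, Ring.ne_bot_of_isMaximal_of_not_isField hM (RingOfIntegers.not_isField E)⟩⟩
  refine split_contra B (und K : Pl E → Pl K) ?_
  intro w hw
  obtain ⟨P, rfl⟩ := und_surj (F := K) (L := E) w
  obtain ⟨z, hz⟩ := hcon _ hw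
  have hst : ∀ P' : Pl E, und K P' = und K P → ∀ g : E ≃ₐ[K] E, g • P' = P' → g = 1 := by
    intro P' hP' g hg
    have := hB _ hw
    rw [← hP'] at this hz
    exact kummer_stab hl hζ hθ hgen P' this.1 this.2 hz g hg
  have hnorm : ∀ P' : Pl E, und K P' = und K P → Ideal.absNorm P'.asIdeal = Ideal.absNorm (und K P).asIdeal := by
    intro P' hP'
    rw [← Ideal.absNorm_relNorm (𝓞 K) (𝓞 E), relNorm_split P' (hst P' hP'), hP']
  exact ⟨P, g • P, fun h => hg (hst P rfl g h.symm), rfl, und_smul g P, hnorm _ rfl, hnorm _ (und_smul g P)⟩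

theorem cong_pow (w : Pl K) {x y : K} (hx : w.valuation K x ≤ 1) (hy : w.valuation K y ≤ 1)
    (h : w.valuation K (x - y) < 1) (n : ℕ) : w.valuation K (x ^ n - y ^ n) < 1 := by
  rw [← Commute.geom_sum₂_mul (Commute.all x y), map_mul]
  refine lt_of_le_of_lt (mul_le_of_le_one_left' ?_) h
  apply Valuation.map_sum_le
  intro i _
  rw [map_mul, map_pow, map_pow]
  exact mul_le_one' (pow_le_one' hx _) (pow_le_one' hy _)

theorem exists_gen (w : Pl K) : ∃ γ : K, w.valuation K γ = 1 ∧ ∀ x : K, w.valuation K x = 1 →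
    ∃ a : ℕ, w.valuation K (x - γ ^ a) < 1 := by
  letI : Field (𝓞 K ⧸ w.asIdeal) := Ideal.Quotient.field _
  haveI : Finite (𝓞 K ⧸ w.asIdeal)ˣ := inferInstance
  haveI : IsCyclic (𝓞 K ⧸ w.asIdeal)ˣ := inferInstance
  haveI : IsCyclic (redU w.asIdeal).range := inferInstance
  obtain ⟨⟨_, γ, rfl⟩, hγ⟩ := IsCyclic.exists_zpow_surjective (G := (redU w.asIdeal).range)
  refine ⟨((γ : Kˣ) : K), γ.2 w le_rfl, ?_⟩
  intro x hx
  have hx0 : x ≠ 0 := by rintro rfl; simp at hx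
  let x' : Yn w.asIdeal := ⟨Units.mk0 x hx0, fun v hv => by rw [CM.le_self hv]; exact hx⟩
  obtain ⟨n, hn⟩ := hγ ⟨_, x', rfl⟩
  obtain ⟨a, ha⟩ := (Submonoid.mem_powers_iff (redU w.asIdeal x') (redU w.asIdeal γ)).1
    ((mem_powers_iff_mem_zpowers).2 ⟨n, congrArg Subtype.val hn⟩)
  refine ⟨a, ?_⟩
  rw [← map_pow] at ha
  have h4 := congrArg Units.val ha
  have h5 := val_sub_lt_of_red_eq h4.symm
  simpa [YnR, x'] using h5

namespace CM
variable (D : CM F K ℓ)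

theorem selfconj (hl : ℓ.Prime) (w : Pl K) (hw : D.τ • w = w) (h2 : w.valuation K (2 : K) = 1)
    (hlw : w.valuation K (ℓ : K) = 1) (u : F) (hu : w.valuation K (algebraMap F K u) = 1) :
    ∃ z : K, w.valuation K (algebraMap F K u - z ^ ℓ) < 1 := by
  obtain ⟨γ, hγ1, hγ⟩ := exists_gen w
  have hτ : ∀ z, w.valuation K (D.τ z) = w.valuation K z := by
    intro z
    have := D.τ_val w z
    rw [hw] at this
    exact this.symm
  have hζ1 : w.valuation K (D.ζ - 1) = 1 := val_one_or_root w D.hζ.pow_eq_one (D.hζ.ne_one hl.one_lt) hlw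
  have hζv : w.valuation K D.ζ = 1 := val_root_one w hl.ne_zero D.hζ.pow_eq_one
  obtain ⟨y, hy1, hy⟩ : ∃ y : K, w.valuation K y = 1 ∧ D.τ y = D.ζ * y := by
    rcases hl.eq_two_or_odd' with rfl | hodd
    · refine ⟨D.i, ?_, ?_⟩
      · exact val_root_one w (k := 4) (by norm_num) (by
          have := D.hi
          calc D.i ^ 4 = (D.i * D.i) * (D.i * D.i) := by ring
            _ = 1 := by rw [this]; ring)
      · rw [D.τi, D.hζ.eq_neg_one_of_two_right]; ring
    · have hz0 : D.ζ ≠ 0 := D.hζ.ne_zero hl.ne_zero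
      refine ⟨1 + D.ζ⁻¹, ?_, ?_⟩
      · have h3 := val_root_sub w hl D.hζ 2 (fun h => by
          have := (Nat.prime_dvd_prime_iff_eq hl Nat.prime_two).1 h
          subst this
          revert hodd; decide)
        have h4 : D.ζ ^ 2 - 1 = D.ζ * (1 + D.ζ⁻¹) * (D.ζ - 1) := by field_simp; ring
        rw [h4, map_mul, map_mul, hζ1, hζv] at h3
        simpa using h3
      · rw [map_add, map_one, map_inv₀, D.τζ]; field_simp; ring
  obtain ⟨a, ha⟩ := hγ _ hu
  obtain ⟨b, hb⟩ := hγ y hy1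
  have ha' : w.valuation K (algebraMap F K u - D.τ γ ^ a) < 1 := by
    have := hτ (algebraMap F K u - γ ^ a)
    rw [map_sub, D.τ.commutes, map_pow] at this
    rw [this]; exact ha
  have hb' : w.valuation K (D.ζ * y - D.τ γ ^ b) < 1 := by
    have := hτ (y - γ ^ b)
    rw [map_sub, hy, map_pow] at this
    rw [this]; exact hb
  have hγτ : w.valuation K (D.τ γ) = 1 := by rw [hτ, hγ1]
  have h5 : w.valuation K (γ ^ a - D.τ γ ^ a) < 1 := by
    have : γ ^ a - D.τ γ ^ a = (algebraMap F K u - D.τ γ ^ a) - (algebraMap F K u - γ ^ a) := by ring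
    rw [this]; exact (Valuation.map_sub _ _ _).trans_lt (max_lt ha' ha)
  have h6 : w.valuation K (D.ζ * γ ^ b - D.τ γ ^ b) < 1 := by
    have : D.ζ * γ ^ b - D.τ γ ^ b = (D.ζ * y - D.τ γ ^ b) - D.ζ * (y - γ ^ b) := by ring
    rw [this]; refine (Valuation.map_sub _ _ _).trans_lt (max_lt hb' ?_)
    rw [map_mul, hζv, one_mul]; exact hb
  have h7 := cong_pow w (by simp [hγ1]) (by simp [hγτ]) h5 b
  have h8 := cong_pow w (by simp [hγ1, hζv]) (by simp [hγτ]) h6 a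
  have h9 : w.valuation K (D.ζ ^ a - 1) < 1 := by
    have : (D.ζ ^ a - 1) * γ ^ (a * b) = ((D.ζ * γ ^ b) ^ a - (D.τ γ ^ b) ^ a) - ((γ ^ a) ^ b - (D.τ γ ^ a) ^ b) := by ring
    have h10 : w.valuation K ((D.ζ ^ a - 1) * γ ^ (a * b)) < 1 := by
      rw [this]; exact (Valuation.map_sub _ _ _).trans_lt (max_lt h8 h7)
    simpa [hγ1] using h10
  have hdvd : ℓ ∣ a := by
    by_contra hnd
    rw [val_root_sub w hl D.hζ a hnd, hζ1] at h9
    exact lt_irrefl _ h9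
  obtain ⟨k, rfl⟩ := hdvd
  exact ⟨γ ^ k, by rw [← pow_mul, mul_comm k]; exact ha⟩

theorem detect (hl : ℓ.Prime) (u : Fˣ) (hu : ∀ b : K, b ^ ℓ ≠ algebraMap F K u) (Bad : Set (Pl F)) (hBad : Bad.Finite) :
    ∃ w : Pl K, und F w ∉ Bad ∧ w.valuation K (2 : K) = 1 ∧ w.valuation K (ℓ : K) = 1 ∧ D.τ • w ≠ w ∧
      ∀ z : K, ¬ w.valuation K (algebraMap F K u - z ^ ℓ) < 1 := by
  have hu0 : algebraMap F K u ≠ 0 := by simp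
  have hl0 : (ℓ : K) ≠ 0 := by exact_mod_cast hl.ne_zero
  have hfin : ((⋃ v ∈ Bad, {w : Pl K | und F w = v}) ∪ {w | ord w (2 : K) ≠ 0} ∪ {w | ord w (ℓ : K) ≠ 0} ∪
      {w | ord w (algebraMap F K u) ≠ 0}).Finite :=
    (((hBad.biUnion fun v _ => finite_fiber v).union (finite_ord _ two_ne_zero)).union (finite_ord _ hl0)).union (finite_ord _ hu0)
  have hmem : ∀ w ∉ hfin.toFinset, und F w ∉ Bad ∧ w.valuation K (2 : K) = 1 ∧ w.valuation K (ℓ : K) = 1 ∧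
      w.valuation K (algebraMap F K u) = 1 := by
    intro w hw
    simp only [Set.Finite.mem_toFinset, Set.mem_union, Set.mem_iUnion, Set.mem_ofPred_eq, not_or, not_not, exists_prop] at hw
    refine ⟨fun h => hw.1.1.1 ⟨_, h, rfl⟩, (ord_eq_zero_iff w two_ne_zero).1 hw.1.1.2,
      (ord_eq_zero_iff w hl0).1 hw.1.2, (ord_eq_zero_iff w hu0).1 hw.2⟩
  obtain ⟨w, hw, h⟩ := kummer_detect hl D.hζ (algebraMap F K u) hu hfin.toFinset
    (fun w hw => ⟨(hmem w hw).2.2.1, (hmem w hw).2.2.2⟩)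
  obtain ⟨h1, h2, h3, h4⟩ := hmem w hw
  refine ⟨w, h1, h2, h3, fun hs => ?_, h⟩
  obtain ⟨z, hz⟩ := D.selfconj hl w hs h2 h3 u h4
  exact h z hz
end CM
end
end HCF


namespace HCF
open Module NumberField IsDedekindDomain WithZero
open scoped nonZeroDivisors Pointwise

section
set_option linter.unusedSectionVars false
set_option linter.style.haveILetI false
variable {F K : Type} [Field F] [NumberField F] [Field K] [NumberField K] [Algebra F K] {ℓ : ℕ}

theorem reps (S : Set (Pl K)) (hS : S.Finite) (H : Subgroup Kˣ) (hH : ∀ u ∈ H, ∀ v ∉ S, v.valuation K (u : K) = 1)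
    (hl : ℓ ≠ 0) : ∃ R : Finset Kˣ, (∀ r ∈ R, r ∈ H) ∧ ∀ u ∈ H, ∃ r ∈ R, ∃ z ∈ H, u = r * z ^ ℓ := by
  classical
  haveI : Finite S := hS
  let g0 : Additive H →+ (S → ℤ) :=
    { toFun := fun x s => dv K (.ofMul (x.toMul : Kˣ)) s
      map_zero' := by ext s; simp
      map_add' := by intro x y; ext s; simp [ofMul_mul] }
  let g : Additive H →ₗ[ℤ] (S → ℤ) := g0.toIntLinearMap
  let ι : Additive H →ₗ[ℤ] Additive Kˣ := (MonoidHom.toAdditive H.subtype).toIntLinearMap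
  let η : Additive (𝓞 K)ˣ →ₗ[ℤ] Additive Kˣ :=
    (MonoidHom.toAdditive (Units.map (algebraMap (𝓞 K) K).toMonoidHom)).toIntLinearMap
  haveI : IsNoetherian ℤ (LinearMap.range η) := inferInstance
  let j : LinearMap.ker g →ₗ[ℤ] LinearMap.range η := (ι.comp (LinearMap.ker g).subtype).codRestrict (LinearMap.range η) (by
    rintro ⟨x, hx⟩
    obtain ⟨u, hu⟩ := exists_unit (x.toMul : Kˣ) (by
      intro v
      by_cases hv : v ∈ S
      · rw [← ord_eq_zero_iff v (Units.ne_zero _)]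
        exact congrFun hx ⟨v, hv⟩
      · exact hH _ x.toMul.2 v hv)
    exact ⟨.ofMul u, congrArg Additive.ofMul hu⟩)
  have hj : Function.Injective j := by
    rintro ⟨x, hx⟩ ⟨y, hy⟩ h
    have h1 : ι x = ι y := congrArg (fun q : LinearMap.range η => (q : Additive Kˣ)) h
    apply Subtype.ext
    exact (Additive.toMul (α := H)).injective (Subtype.ext (congrArg Additive.toMul h1))
  haveI : IsNoetherian ℤ (LinearMap.ker g) := isNoetherian_of_injective j hj
  haveI : IsNoetherian ℤ (Additive H) := isNoetherian_of_range_eq_ker (LinearMap.ker g).subtype g (Submodule.range_subtype _)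
  haveI : Module.Finite ℤ (Additive H) := inferInstance
  haveI : Group.FG H := by
    rw [Group.fg_iff_monoid_fg, Monoid.fg_iff_add_fg, ← AddGroup.fg_iff_addMonoid_fg, ← Module.Finite.iff_addGroup_fg]; infer_instance
  haveI := Subgroup.finiteIndex_range_powMonoidHom_of_fg H hl
  haveI : Finite (H ⧸ (powMonoidHom (α := H) ℓ).range) := Subgroup.finite_quotient_of_finiteIndex
  haveI := Fintype.ofFinite (H ⧸ (powMonoidHom (α := H) ℓ).range)
  refine ⟨Finset.univ.image fun q : H ⧸ (powMonoidHom (α := H) ℓ).range => ((Quotient.out q : H) : Kˣ), ?_, ?_⟩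
  · intro r hr
    obtain ⟨q, _, rfl⟩ := Finset.mem_image.1 hr
    exact (Quotient.out q).2
  · intro u hu
    let q : H ⧸ (powMonoidHom (α := H) ℓ).range := QuotientGroup.mk ⟨u, hu⟩
    have hq : (QuotientGroup.mk (Quotient.out q) : H ⧸ (powMonoidHom (α := H) ℓ).range) = QuotientGroup.mk ⟨u, hu⟩ :=
      Quotient.out_eq q
    obtain ⟨z, hz⟩ := QuotientGroup.eq.1 hq
    refine ⟨_, Finset.mem_image_of_mem _ (Finset.mem_univ q), (z : Kˣ), z.2, ?_⟩
    have h2 := congrArg Subtype.val hz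
    simp only [powMonoidHom_apply, Subgroup.coe_pow, Subgroup.coe_mul, Subgroup.coe_inv] at h2
    rw [h2, mul_inv_cancel_left]

theorem clD_surj (c : Additive (ClassGroup (𝓞 K))) : ∃ E : Pl K →₀ ℤ, clD K E = c := by
  have : ∀ x : ClassGroup (𝓞 K), ∃ E : Pl K →₀ ℤ, clD K E = .ofMul x := by
    intro x
    refine ClassGroup.induction K (fun I => ?_) x
    have hfin := FractionalIdeal.finite_factors (K := K) (R := 𝓞 K) (I : FractionalIdeal (𝓞 K)⁰ K)
    rw [Filter.eventually_cofinite] at hfin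
    let E : Pl K →₀ ℤ := Finsupp.ofSupportFinite (fun v => FractionalIdeal.count K v (I : FractionalIdeal (𝓞 K)⁰ K)) hfin
    refine ⟨E, ?_⟩
    have h : (fid K E).toMul = I := frac_ext fun v => by rw [count_fid]; rfl
    change Additive.ofMul (ClassGroup.mk K (fid K E).toMul) = _
    rw [h]
  exact this c.toMul

namespace CM
variable (D : CM F K ℓ)

theorem exists_nonpow (D : CM F K ℓ) (hl : ℓ.Prime) : ∃ u : Fˣ, ∀ b : K, b ^ ℓ ≠ algebraMap F K u := by
  obtain ⟨M, hM⟩ := Ideal.exists_maximal (𝓞 F)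
  let v : Pl F := ⟨M, hM.isPrime, Ring.ne_bot_of_isMaximal_of_not_isField hM (RingOfIntegers.not_isField F)⟩
  obtain ⟨x, hx⟩ := v.valuation_exists_uniformizer F
  have hx0 : x ≠ 0 := by rintro rfl; rw [map_zero] at hx; exact exp_ne_zero hx.symm
  refine ⟨Units.mk0 x hx0, fun b hb => ?_⟩
  obtain ⟨y, hy⟩ := D.root_descend hl x hx0 b hb
  have hy' : v.valuation F x = v.valuation F y ^ ℓ := by
    rcases hy with h | h
    · rw [h, map_pow]
    · rw [h, Valuation.map_neg, map_pow]
  have hy0 : y ≠ 0 := by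
    rintro rfl
    rw [hx, map_zero, zero_pow hl.ne_zero] at hy'
    exact exp_ne_zero hy'
  rw [hx, val_eq_exp v hy0, ← exp_nsmul, exp_inj, nsmul_eq_mul] at hy'
  have : (ℓ : ℤ) ∣ 1 := ⟨ord v y, by linarith⟩
  have h1 : ℓ ∣ 1 := by exact_mod_cast this
  exact hl.one_lt.ne' (Nat.dvd_one.1 h1)

theorem choose_T (D : CM F K ℓ) [IsTotallyReal F] (hl : ℓ.Prime) (Bad : Set (Pl F)) (hBad : Bad.Finite) :
    ∃ T : Finset (Pl F), T.Nonempty ∧ (∀ v ∈ T, v ∉ Bad ∧ v.valuation F (2 : F) = 1 ∧ v.valuation F (ℓ : F) = 1) ∧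
      (∃ ws : Pl F → Pl K, ∀ v ∈ T, und F (ws v) = v ∧ D.τ • ws v ≠ ws v) ∧
      (RT F ℓ (T : Set (Pl F))).index * ℓ ^ (finrank ℚ F - 1) ≤ ℓ ^ T.card := by
  classical
  choose E hE using clD_surj (K := F)
  haveI : Finite (Additive (ClassGroup (𝓞 F))) := inferInstanceAs (Finite (ClassGroup (𝓞 F)))
  haveI := Fintype.ofFinite (Additive (ClassGroup (𝓞 F)))
  let S : Finset (Pl F) := Finset.univ.biUnion fun c => (E c).support
  let US : Subgroup Fˣ :=
    { carrier := {u | ∀ v ∉ S, v.valuation F (u : F) = 1}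
      mul_mem' := fun hx hy v hv => by rw [Units.val_mul, map_mul, hx v hv, hy v hv, one_mul]
      one_mem' := fun v hv => by simp
      inv_mem' := fun hx v hv => by rw [Units.val_inv_eq_inv_val, map_inv₀, hx v hv, inv_one] }
  obtain ⟨R, hR, hR'⟩ := reps (S : Set (Pl F)) S.finite_toSet US (fun u hu v hv => hu v hv) hl.ne_zero
  obtain ⟨u0, hu0⟩ := D.exists_nonpow hl
  have hdet : ∀ u : Fˣ, ∃ w : Pl K, (∀ b : K, b ^ ℓ ≠ algebraMap F K u) → und F w ∉ Bad ∪ S ∧ w.valuation K (2 : K) = 1 ∧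
      w.valuation K (ℓ : K) = 1 ∧ D.τ • w ≠ w ∧ ∀ z : K, ¬ w.valuation K (algebraMap F K u - z ^ ℓ) < 1 := by
    intro u
    by_cases hu : ∀ b : K, b ^ ℓ ≠ algebraMap F K u
    · obtain ⟨w, hw⟩ := D.detect hl u hu (Bad ∪ S) (hBad.union S.finite_toSet)
      exact ⟨w, fun _ => hw⟩
    · obtain ⟨w, hw⟩ := D.detect hl u0 hu0 (Bad ∪ S) (hBad.union S.finite_toSet)
      exact ⟨w, fun h => absurd h hu⟩
  choose w hw using hdet
  let R' : Finset Fˣ := (insert u0 R).filter fun u => ∀ b : K, b ^ ℓ ≠ algebraMap F K u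
  let T : Finset (Pl F) := R'.image fun u => und F (w u)
  have hT : ∀ v ∈ T, ∃ u, v = und F (w u) ∧ ∀ b : K, b ^ ℓ ≠ algebraMap F K u := by
    intro v hv
    obtain ⟨u, hu, rfl⟩ := Finset.mem_image.1 hv
    exact ⟨u, rfl, (Finset.mem_filter.1 hu).2⟩
  refine ⟨T, ?_, ?_, ?_, ?_⟩
  · exact ⟨_, Finset.mem_image_of_mem _ (Finset.mem_filter.2 ⟨Finset.mem_insert_self u0 R, hu0⟩)⟩
  · intro v hv
    obtain ⟨u, rfl, hu⟩ := hT v hv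
    obtain ⟨h1, h2, h3, _, _⟩ := hw u hu
    refine ⟨fun h => h1 (Or.inl h), ?_, ?_⟩
    · rw [← und_val_eq_one, map_ofNat]; exact h2
    · rw [← und_val_eq_one, map_natCast]; exact h3
  · have : ∀ v : Pl F, ∃ w : Pl K, v ∈ T → und F w = v ∧ D.τ • w ≠ w := by
      intro v
      by_cases hv : v ∈ T
      · obtain ⟨u, rfl, hu⟩ := hT v hv
        exact ⟨w u, fun _ => ⟨rfl, (hw u hu).2.2.2.1⟩⟩
      · exact ⟨w u0, fun h => absurd h hv⟩
    choose ws hws using this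
    exact ⟨ws, hws⟩
  · refine GT_bound D hl S T ?_ ?_ ?_
    · rw [Finset.disjoint_left]
      intro v hS hv
      obtain ⟨u, rfl, hu⟩ := hT v hv
      exact (hw u hu).1 (Or.inr hS)
    · intro c
      exact ⟨E c, hE c, Finset.subset_biUnion_of_mem (fun c => (E c).support) (Finset.mem_univ c)⟩
    · intro u hu hz
      obtain ⟨r, hr, y, _, rfl⟩ := hR' u hu
      by_contra hcon
      push Not at hcon
      have hr' : ∀ b : K, b ^ ℓ ≠ algebraMap F K r := by
        intro b hb
        refine hcon (b * algebraMap F K y) ?_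
        rw [mul_pow, hb]; simp
      have hmem : und F (w r) ∈ T := Finset.mem_image_of_mem _ (Finset.mem_filter.2 ⟨Finset.mem_insert_of_mem hr, hr'⟩)
      obtain ⟨z, hz⟩ := hz _ hmem
      obtain ⟨h1, _, _, _, h5⟩ := hw r hr'
      have hv : und F (w r) ∉ S := fun h => h1 (Or.inr h)
      have hyv : (und F (w r)).valuation F (y : F) = 1 := by
        have h6 := hu _ hv
        rw [Units.val_mul, map_mul, hR r hr _ hv, one_mul, Units.val_pow_eq_pow_val, map_pow,
          pow_eq_one_iff_of_nonneg zero_le hl.ne_zero] at h6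
        exact h6
      refine h5 (algebraMap F K (z / y)) ?_
      rw [← map_pow, ← map_sub, und_val_lt_one]
      have h7 : (r : F) - (z / y) ^ ℓ = (((r * y ^ ℓ : Fˣ) : F) - z ^ ℓ) / (y : F) ^ ℓ := by
        have := Units.ne_zero y
        push_cast
        rw [div_pow, eq_div_iff (pow_ne_zero _ this), sub_mul, div_mul_cancel₀ _ (pow_ne_zero _ this)]
      rw [h7, map_div₀, map_pow, hyv, one_pow, div_one]
      exact hz
end CM
end
end HCF


namespace HCF
open Module NumberField IsDedekindDomain WithZero
open scoped nonZeroDivisors Pointwise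

section
set_option linter.unusedSectionVars false
set_option linter.style.haveILetI false

theorem ext_gen_aux {G ι : Type*} [AddCommGroup G] [Finite G] (ℓ : ℕ) [Fact ℓ.Prime] [Module (ZMod ℓ) G] (p : G) (hp : p ≠ 0)
    (f : ι → G) (hf : AddSubgroup.closure (Set.range f) = ⊤) :
    ∃ U : Finset ι, ℓ ^ (U.card + 1) ≤ Nat.card G ∧ AddSubgroup.closure (insert p (f '' (U : Set ι))) = ⊤ := by
  classical
  let v : Option ι → G := fun o => o.elim p f
  have hs : LinearIndepOn (ZMod ℓ) v {none} := LinearIndepOn.singleton (R := ZMod ℓ) (v := v) (i := none) hp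
  obtain ⟨b, _, hsb, hsp, hli⟩ := exists_linearIndepOn_extension hs (Set.subset_univ _)
  haveI : Finite b := Finite.of_injective _ (LinearIndependent.injective hli)
  haveI := Fintype.ofFinite b
  have hnone : none ∈ b.toFinset := by simpa using hsb
  have hfi : Module.Finite (ZMod ℓ) G := Module.Finite.of_finite
  have h1 : Fintype.card b ≤ finrank (ZMod ℓ) G := LinearIndependent.fintype_card_le_finrank hli
  refine ⟨Finset.eraseNone b.toFinset, ?_, ?_⟩
  · have h2 : Nat.card G = ℓ ^ finrank (ZMod ℓ) G := by
      have h4 := Module.natCard_eq_pow_finrank (K := ZMod ℓ) (V := G)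
      rwa [Nat.card_zmod] at h4
    rw [h2]
    apply Nat.pow_le_pow_right (Fact.out : ℓ.Prime).pos
    rw [Finset.card_eraseNone_of_mem hnone, Set.toFinset_card]
    have : 0 < Fintype.card b := Fintype.card_pos_iff.2 ⟨⟨none, by simpa using hnone⟩⟩
    omega
  · set C := AddSubgroup.closure (insert p (f '' ((Finset.eraseNone b.toFinset : Finset ι) : Set ι))) with hC
    have h3 : Submodule.span (ZMod ℓ) (v '' b) ≤ AddSubgroup.toZModSubmodule ℓ C := by
      rw [Submodule.span_le]
      rintro _ ⟨o, ho, rfl⟩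
      cases o with
      | none => exact AddSubgroup.subset_closure (Set.mem_insert _ _)
      | some i =>
        refine AddSubgroup.subset_closure (Set.mem_insert_of_mem _ ⟨i, ?_, rfl⟩)
        simpa using ho
    rw [eq_top_iff, ← hf, AddSubgroup.closure_le]
    rintro _ ⟨i, rfl⟩
    exact h3 (hsp ⟨some i, trivial, rfl⟩)

theorem ext_gen {G ι : Type*} [AddCommGroup G] [Finite G] (ℓ : ℕ) [Fact ℓ.Prime] (h : ∀ x : G, ℓ • x = 0) (p : G) (hp : p ≠ 0)
    (f : ι → G) (hf : AddSubgroup.closure (Set.range f) = ⊤) :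
    ∃ U : Finset ι, ℓ ^ (U.card + 1) ≤ Nat.card G ∧ AddSubgroup.closure (insert p (f '' (U : Set ι))) = ⊤ := by
  letI : Module (ZMod ℓ) G := AddCommGroup.zmodModule h
  exact ext_gen_aux ℓ p hp f hf

variable {F K : Type} [Field F] [NumberField F] [Field K] [NumberField K] [Algebra F K] {ℓ : ℕ}

theorem moving (hl : ℓ.Prime) (T : Finset (Pl F)) (u : Pl F) (hu : u ∉ T) :
    ∃ y ∈ Xs (T : Set (Pl F)), ord u ((y : Fˣ) : F) = 1 ∧ ∀ v : Pl F, v ≠ u → v.valuation F (ℓ : F) ≠ 1 → ord v (y : F) = 0 := by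
  classical
  have hl0 : (ℓ : F) ≠ 0 := by exact_mod_cast hl.ne_zero
  have hfin := finite_ord (ℓ : F) hl0
  obtain ⟨x, hx⟩ := u.valuation_exists_uniformizer F
  obtain ⟨a, ha⟩ := HeightOneSpectrum.intValuation_exists_uniformizer u
  let s : Finset (Pl F) := insert u (T ∪ hfin.toFinset)
  obtain ⟨y, hy⟩ := IsDedekindDomain.exists_forall_sub_mem_ideal (s := s) (fun v : Pl F => v.asIdeal) (fun _ => 2)
    (fun v _ => v.prime) (fun v _ w _ h h' => h (HeightOneSpectrum.ext h')) (fun v => if v.1 = u then a else 1)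
  have hyu := hy u (Finset.mem_insert_self _ _)
  simp only [if_true] at hyu
  rw [← HeightOneSpectrum.valuation_of_algebraMap (K := F)] at ha
  have hval : u.valuation F (algebraMap (𝓞 F) F y) = exp (-1) := by
    have h1 : u.valuation F (algebraMap (𝓞 F) F (y - a)) < u.valuation F (algebraMap (𝓞 F) F a) := by
      rw [ha]
      refine ((vlepow u _ 2).2 hyu).trans_lt ?_
      rw [exp_lt_exp]; norm_num
    have h2 : algebraMap (𝓞 F) F y = algebraMap (𝓞 F) F (y - a) + algebraMap (𝓞 F) F a := by rw [← map_add, sub_add_cancel]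
    rw [h2, Valuation.map_add_eq_of_lt_right _ h1, ha]
  have hy0 : algebraMap (𝓞 F) F y ≠ 0 := by
    intro h; rw [h, map_zero] at hval; exact exp_ne_zero hval.symm
  have hoth : ∀ v ∈ s, v ≠ u → v.valuation F (algebraMap (𝓞 F) F y - 1) < 1 := by
    intro v hv hvu
    have h1 := hy v hv
    simp only [if_neg hvu] at h1
    rw [← map_one (algebraMap (𝓞 F) F), ← map_sub, vlt]
    exact Ideal.pow_le_self two_ne_zero h1
  refine ⟨Units.mk0 _ hy0, ?_, ?_, ?_⟩
  · intro v hv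
    exact hoth v (Finset.mem_insert_of_mem (Finset.mem_union_left _ hv)) (fun h => hu (h ▸ hv))
  · rw [Units.val_mk0]
    have := val_eq_exp u hy0
    rw [hval, exp_inj] at this
    linarith
  · intro v hv hvl
    rw [Units.val_mk0, ord_eq_zero_iff v hy0]
    apply val_eq_one_of_sub
    refine hoth v (Finset.mem_insert_of_mem (Finset.mem_union_right _ ?_)) hv
    rw [Set.Finite.mem_toFinset]
    exact fun h => hvl ((ord_eq_zero_iff v hl0).1 h)

theorem RT_nsmul (T : Set (Pl F)) (E : {v : Pl F // v ∉ T} →₀ ℤ) : ℓ • E ∈ RT F ℓ T :=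
  AddSubgroup.mem_sup_left ⟨E, rfl⟩

theorem RT_dvX (T : Set (Pl F)) (x : Additive (Xs T)) : dvX T x ∈ RT F ℓ T :=
  AddSubgroup.mem_sup_right ⟨x, rfl⟩

theorem RT_index (T : Finset (Pl F)) : (RT F ℓ (T : Set (Pl F))).index ≠ 0 := by
  intro h
  have := AddSubgroup.index_dvd_of_le (show (dvX (T : Set (Pl F))).range ≤ RT F ℓ (T : Set (Pl F)) from le_sup_right)
  rw [h, zero_dvd_iff] at this
  exact dvX_index T this

theorem gen_away (hl : ℓ.Prime) (T : Finset (Pl F)) :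
    AddSubgroup.closure ({E | ∃ u : {v : Pl F // v ∉ (T : Set (Pl F))}, u.1.valuation F (ℓ : F) = 1 ∧ E = Finsupp.single u (1 : ℤ)} ∪
      (RT F ℓ (T : Set (Pl F)) : Set ({v : Pl F // v ∉ (T : Set (Pl F))} →₀ ℤ))) = ⊤ := by
  classical
  set C := AddSubgroup.closure ({E | ∃ u : {v : Pl F // v ∉ (T : Set (Pl F))}, u.1.valuation F (ℓ : F) = 1 ∧ E = Finsupp.single u (1 : ℤ)} ∪
      (RT F ℓ (T : Set (Pl F)) : Set ({v : Pl F // v ∉ (T : Set (Pl F))} →₀ ℤ))) with hC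
  have hgood : ∀ E : {v : Pl F // v ∉ (T : Set (Pl F))} →₀ ℤ, (∀ u, E u ≠ 0 → Finsupp.single u 1 ∈ C) → E ∈ C := by
    intro E hE
    rw [← Finsupp.sum_single E]
    refine AddSubgroup.sum_mem _ fun u hu => ?_
    have : Finsupp.single u (E u) = E u • Finsupp.single u (1 : ℤ) := by simp
    rw [this]
    exact AddSubgroup.zsmul_mem _ (hE u (Finsupp.mem_support_iff.1 hu)) _
  have h1 : ∀ u : {v : Pl F // v ∉ (T : Set (Pl F))}, u.1.valuation F (ℓ : F) = 1 → Finsupp.single u 1 ∈ C :=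
    fun u hu => AddSubgroup.subset_closure (Or.inl ⟨u, hu, rfl⟩)
  have h2 : ∀ u : {v : Pl F // v ∉ (T : Set (Pl F))}, Finsupp.single u 1 ∈ C := by
    intro u
    by_cases hu : u.1.valuation F (ℓ : F) = 1
    · exact h1 u hu
    obtain ⟨y, hyX, hyu, hy⟩ := moving hl T u.1 u.2
    have h3 : dvX (T : Set (Pl F)) (.ofMul ⟨y, hyX⟩) ∈ C := AddSubgroup.subset_closure (Or.inr (RT_dvX _ _))
    have h4 : dvX (T : Set (Pl F)) (.ofMul ⟨y, hyX⟩) - Finsupp.single u 1 ∈ C := by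
      apply hgood
      intro v hv
      apply h1
      by_contra hvl
      rw [Finsupp.sub_apply, dvX_apply] at hv
      by_cases hvu : v = u
      · subst hvu
        rw [hyu, Finsupp.single_eq_same] at hv
        exact hv (sub_self _)
      · rw [hy v.1 (fun h => hvu (Subtype.ext h)) hvl, Finsupp.single_eq_of_ne hvu] at hv
        exact hv (sub_self _)
    have := AddSubgroup.sub_mem _ h3 h4
    rwa [sub_sub_cancel] at this
  rw [eq_top_iff]
  intro E _
  exact hgood E fun u _ => h2 u

theorem exists_U (hl : ℓ.Prime) (T : Finset (Pl F)) (p : {v : Pl F // v ∉ (T : Set (Pl F))})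
    (hp : Finsupp.single p (1 : ℤ) ∉ RT F ℓ (T : Set (Pl F))) :
    ∃ U : Finset {v : Pl F // v ∉ (T : Set (Pl F))}, ℓ ^ (U.card + 1) ≤ (RT F ℓ (T : Set (Pl F))).index ∧
      (∀ u ∈ U, u.1.valuation F (ℓ : F) = 1) ∧
      ∀ C : AddSubgroup ({v : Pl F // v ∉ (T : Set (Pl F))} →₀ ℤ), RT F ℓ (T : Set (Pl F)) ≤ C →
        Finsupp.single p (1 : ℤ) ∈ C → (∀ u ∈ U, Finsupp.single u (1 : ℤ) ∈ C) → C = ⊤ := by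
  classical
  haveI : Fact ℓ.Prime := ⟨hl⟩
  let R := RT F ℓ (T : Set (Pl F))
  haveI : R.FiniteIndex := ⟨RT_index T⟩
  haveI : Finite (({v : Pl F // v ∉ (T : Set (Pl F))} →₀ ℤ) ⧸ R) := AddSubgroup.finite_quotient_of_finiteIndex
  let q := QuotientAddGroup.mk' R
  let f : {u : {v : Pl F // v ∉ (T : Set (Pl F))} // u.1.valuation F (ℓ : F) = 1} →
    ({v : Pl F // v ∉ (T : Set (Pl F))} →₀ ℤ) ⧸ R := fun u => q (Finsupp.single u.1 1)
  obtain ⟨U, hU, hcl⟩ := ext_gen ℓ (G := ({v : Pl F // v ∉ (T : Set (Pl F))} →₀ ℤ) ⧸ R) (by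
      intro x
      obtain ⟨E, rfl⟩ := QuotientAddGroup.mk'_surjective R x
      rw [← map_nsmul]
      exact (QuotientAddGroup.eq_zero_iff _).2 (RT_nsmul _ E)) (q (Finsupp.single p 1))
      (fun h => hp ((QuotientAddGroup.eq_zero_iff _).1 h)) f (by
      rw [eq_top_iff, ← AddMonoidHom.range_eq_top.2 (QuotientAddGroup.mk'_surjective R), AddMonoidHom.range_eq_map,
        ← gen_away hl T, AddMonoidHom.map_closure, AddSubgroup.closure_le]
      rintro _ ⟨E, hE, rfl⟩
      rcases hE with ⟨u, hu, rfl⟩ | hE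
      · exact AddSubgroup.subset_closure ⟨⟨u, hu⟩, rfl⟩
      · have : QuotientAddGroup.mk' R E = 0 := (QuotientAddGroup.eq_zero_iff _).2 hE
        rw [this]; exact AddSubgroup.zero_mem _)
  refine ⟨U.map (Function.Embedding.subtype _), ?_, ?_, ?_⟩
  · rw [Finset.card_map]; exact hU
  · intro u hu
    obtain ⟨u', _, rfl⟩ := Finset.mem_map.1 hu
    exact u'.2
  · intro C hRC hpC hUC
    have h1 : C.map q = ⊤ := by
      rw [eq_top_iff, ← hcl, AddSubgroup.closure_le]
      rintro x (rfl | ⟨u, hu, rfl⟩)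
      · exact ⟨_, hpC, rfl⟩
      · exact ⟨_, hUC u.1 (Finset.mem_map_of_mem _ hu), rfl⟩
    rw [eq_top_iff]
    intro E _
    obtain ⟨E', hE', he⟩ : q E ∈ C.map q := by rw [h1]; trivial
    have h2 : -E' + E ∈ R := QuotientAddGroup.eq.1 he
    have := C.add_mem hE' (hRC h2)
    rwa [add_neg_cancel_left] at this
end
end HCF


namespace HCF
open Module NumberField IsDedekindDomain WithZero
open scoped nonZeroDivisors Pointwise

section
set_option linter.unusedSectionVars false
set_option linter.style.haveILetI false

/-- A totally real number field extension of `F`. -/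
structure Ext (F : Type) [Field F] where
  L : Type
  fld : Field L
  nf : NumberField L
  alg : Algebra F L
  tr : IsTotallyReal L

attribute [instance] Ext.fld Ext.nf Ext.alg Ext.tr

variable {F K : Type} [Field F] [NumberField F] [Field K] [NumberField K] [Algebra F K] {ℓ : ℕ}

namespace CM

/-- The local condition above `ℓ`. -/
def V (D : CM F K ℓ) (α : K) : Prop := ∃ β : K, ∀ w : Pl K, w.valuation K D.θ < 1 → w.valuation K (ℓ : K) < 1 →
  w.valuation K β ≤ 1 ∧ w.valuation K (α - β ^ ℓ) ≤ w.valuation K (D.ζ - 1) ^ ℓ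

/-- The splitting condition at `w`. -/
def Sp (D : CM F K ℓ) (w : Pl K) (α : K) : Prop := ∃ β : K, w.valuation K β = 1 ∧ w.valuation K (β * D.τ β - 1) < 1 ∧
  w.valuation K (α - β ^ ℓ) < 1

theorem V_div (D : CM F K ℓ) (T : Set (Pl F)) (hT : ∀ w : Pl K, w.valuation K (ℓ : K) < 1 → und F w ∉ T) (r z : Kˣ) (hz : z ∈ D.H T)
    (h : D.V (r * z ^ ℓ : K)) : D.V (r : K) := by
  obtain ⟨β, hβ⟩ := h
  refine ⟨β * (z : K)⁻¹, fun w h1 h2 => ?_⟩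
  have hz1 : w.valuation K (z : K) = 1 := hz.2 w (hT w h2)
  obtain ⟨h3, h4⟩ := hβ w h1 h2
  refine ⟨by rw [map_mul, map_inv₀, hz1, inv_one, mul_one]; exact h3, ?_⟩
  have h5 : (r : K) - (β * (z : K)⁻¹) ^ ℓ = (r * z ^ ℓ - β ^ ℓ) * ((z : K)⁻¹) ^ ℓ := by
    rw [mul_pow, sub_mul, mul_assoc, ← mul_pow (z : K), mul_inv_cancel₀ z.ne_zero, one_pow, mul_one]
  rw [h5, map_mul, map_pow, map_inv₀, hz1, inv_one, one_pow, mul_one]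
  exact h4

theorem Sp_div (D : CM F K ℓ) (T : Set (Pl F)) (w : Pl K) (hw : und F w ∉ T) (r z : Kˣ) (hz : z ∈ D.H T)
    (h : D.Sp w (r * z ^ ℓ : K)) : D.Sp w (r : K) := by
  obtain ⟨β, hβ, h3, h4⟩ := h
  have hz1 : w.valuation K (z : K) = 1 := hz.2 w hw
  have hz2 : (z : K) * D.τ z = 1 := hz.1
  refine ⟨β * (z : K)⁻¹, by rw [map_mul, map_inv₀, hz1, inv_one, mul_one]; exact hβ, ?_, ?_⟩
  · have : β * (z : K)⁻¹ * D.τ (β * (z : K)⁻¹) = β * D.τ β := by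
      rw [map_mul, map_inv₀]
      calc _ = β * D.τ β * ((z : K) * D.τ z)⁻¹ := by rw [mul_inv]; ring
        _ = _ := by rw [hz2]; simp
    rw [this]; exact h3
  · have h5 : (r : K) - (β * (z : K)⁻¹) ^ ℓ = (r * z ^ ℓ - β ^ ℓ) * ((z : K)⁻¹) ^ ℓ := by
      rw [mul_pow, sub_mul, mul_assoc, ← mul_pow (z : K), mul_inv_cancel₀ z.ne_zero, one_pow, mul_one]
    rw [h5, map_mul, map_pow, map_inv₀, hz1, inv_one, one_pow, mul_one]
    exact h4

/-- the prime data for `T` -/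
structure TD (D : CM F K ℓ) (T : Finset (Pl F)) : Prop where
  ne : T.Nonempty
  two : ∀ v ∈ T, v.valuation F (2 : F) = 1
  ell : ∀ v ∈ T, v.valuation F (ℓ : F) = 1
  ws : ∃ ws : Pl F → Pl K, ∀ v ∈ T, und F (ws v) = v ∧ D.τ • ws v ≠ ws v
  idx : (RT F ℓ (T : Set (Pl F))).index * ℓ ^ (finrank ℚ F - 1) ≤ ℓ ^ T.card

theorem TD.hT {D : CM F K ℓ} {T : Finset (Pl F)} (h : D.TD T) (w : Pl K) (hw : w.valuation K (ℓ : K) < 1) :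
    und F w ∉ (T : Set (Pl F)) := by
  intro hh
  have h1 := h.ell _ hh
  have h2 := (und_val_eq_one (F := F) w (ℓ : F)).2 h1
  rw [map_natCast] at h2
  exact hw.ne h2

theorem core_alpha (D : CM F K ℓ) [IsTotallyReal F] (hl : ℓ.Prime) (T : Finset (Pl F)) (hT : D.TD T)
    (U : Finset {v : Pl F // v ∉ (T : Set (Pl F))}) (hU : ℓ ^ (U.card + 1) ≤ (RT F ℓ (T : Set (Pl F))).index) :
    ∃ α : Kˣ, α ∈ D.H (T : Set (Pl F)) ∧ (∀ b : K, b ^ ℓ ≠ α) ∧ D.V (α : K) ∧ ∀ u ∈ U, ∃ w : Pl K, und F w = u.1 ∧ D.Sp w (α : K) := by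
  classical
  obtain ⟨ws, hws⟩ := hT.ws
  obtain ⟨A0, h0, h0', hA0⟩ := D.V_index hl (T : Set (Pl F)) hT.hT
  have hw : ∀ u : U, ∃ w : Pl K, und F w = u.1.1 := fun u => und_surj F K u.1.1
  choose w hw using hw
  have hA : ∀ u : U, und F (w u) ∉ (T : Set (Pl F)) := fun u => by rw [hw]; exact u.1.2
  choose A hA1 hA2 hA3 using fun u : U => D.split_index hl (T : Set (Pl F)) (w u) (hA u)
  have hi1 : (⨅ u, A u).index ≠ 0 := Subgroup.index_iInf_ne_zero hA1
  have hi2 : (⨅ u, A u).index ≤ ℓ ^ U.card := by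
    refine (Subgroup.index_iInf_le A).trans ?_
    calc _ ≤ ∏ u : U, ℓ := Finset.prod_le_prod' fun u _ => hA2 u
      _ = _ := by simp
  obtain ⟨α, hα, hα'⟩ := D.H_big hl T ws hws (A0 ⊓ ⨅ u, A u) (Subgroup.index_inf_ne_zero h0 hi1) (by
    refine (Subgroup.index_inf_le).trans ?_
    refine (Nat.mul_le_mul h0' hi2).trans (le_trans ?_ hT.idx)
    refine le_trans ?_ (Nat.mul_le_mul_right _ hU)
    rw [← pow_add, ← pow_add]
    apply Nat.pow_le_pow_right hl.pos
    have : 0 < finrank ℚ F := finrank_pos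
    omega)
  refine ⟨α.1, α.2, hα', hA0 α hα.1, fun u hu => ⟨w ⟨u, hu⟩, hw _, hA3 ⟨u, hu⟩ α ?_⟩⟩
  exact (Subgroup.mem_iInf.1 hα.2) _

theorem H_S (D : CM F K ℓ) (T : Finset (Pl F)) : {w : Pl K | und F w ∈ (T : Set (Pl F))}.Finite := by
  have : {w : Pl K | und F w ∈ (T : Set (Pl F))} = ⋃ v ∈ (T : Set (Pl F)), {w : Pl K | und F w = v} := by
    ext w; simp
  rw [this]
  exact T.finite_toSet.biUnion fun v _ => finite_fiber v

theorem core_rep (D : CM F K ℓ) [IsTotallyReal F] (hl : ℓ.Prime) (T : Finset (Pl F)) (hT : D.TD T) :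
    ∃ R : Finset Kˣ, (∀ r ∈ R, r ∈ D.H (T : Set (Pl F))) ∧ ∀ (U : Finset {v : Pl F // v ∉ (T : Set (Pl F))}),
      ℓ ^ (U.card + 1) ≤ (RT F ℓ (T : Set (Pl F))).index →
      ∃ r ∈ R, (∀ b : K, b ^ ℓ ≠ r) ∧ D.V (r : K) ∧ ∀ u ∈ U, ∃ w : Pl K, und F w = u.1 ∧ D.Sp w (r : K) := by
  obtain ⟨R, hR, hR'⟩ := reps (ℓ := ℓ) {w : Pl K | und F w ∈ (T : Set (Pl F))} (D.H_S T) (D.H (T : Set (Pl F)))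
    (fun u hu v hv => hu.2 v hv) hl.ne_zero
  refine ⟨R, hR, fun U hU => ?_⟩
  obtain ⟨α, hα, h1, h2, h3⟩ := D.core_alpha hl T hT U hU
  obtain ⟨r, hr, z, hz, rfl⟩ := hR' α hα
  push_cast at h1 h2 h3
  refine ⟨r, hr, fun b hb => h1 (b * z) (by rw [mul_pow, hb]), D.V_div _ hT.hT r z hz h2, fun u hu => ?_⟩
  obtain ⟨w, hw, hw'⟩ := h3 u hu
  exact ⟨w, hw, D.Sp_div _ w (by rw [hw]; exact u.2) r z hz hw'⟩

end CM

theorem RT_le (T : Set (Pl F)) (C : AddSubgroup ({v : Pl F // v ∉ T} →₀ ℤ)) (h1 : ∀ u, (ℓ : ℤ) • Finsupp.single u (1 : ℤ) ∈ C)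
    (h2 : (dvX T).range ≤ C) : RT F ℓ T ≤ C := by
  refine sup_le ?_ h2
  rintro _ ⟨f, rfl⟩
  induction f using Finsupp.induction_linear with
  | zero => rw [map_zero]; exact zero_mem _
  | add f g hf hg => rw [map_add]; exact add_mem hf hg
  | single u a =>
    have : nsmulAddMonoidHom ℓ (Finsupp.single u a) = a • ((ℓ : ℤ) • Finsupp.single u (1 : ℤ)) := by
      simp [mul_comm]
    rw [this]
    exact zsmul_mem (h1 u) _

theorem all_or_triv {G : Type*} [Group G] [Finite G] (hl : ℓ.Prime) (hG : Nat.card G = ℓ) {X : Type*} [MulAction G X] (x : X) :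
    (∀ g : G, g • x = x) ∨ ∀ g : G, g • x = x → g = 1 := by
  haveI : Fact (Nat.card G).Prime := ⟨hG ▸ hl⟩
  rcases (MulAction.stabilizer G x).eq_bot_or_eq_top_of_prime_card with h | h
  · right
    intro g hg
    have : g ∈ MulAction.stabilizer G x := hg
    rwa [h, Subgroup.mem_bot] at this
  · left
    intro g
    have : g ∈ MulAction.stabilizer G x := by rw [h]; trivial
    exact this

theorem CM.core (D : CM F K ℓ) [IsTotallyReal F] (hl : ℓ.Prime) (T : Finset (Pl F)) (hT : D.TD T) :
    ∃ (ι : Type) (_ : Finite ι) (E : ι → Ext F), ∀ p : {v : Pl F // v ∉ (T : Set (Pl F))}, Finsupp.single p (1 : ℤ) ∉ RT F ℓ (T : Set (Pl F)) →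
      ∃ i, ∀ Q : Pl (E i).L, und F Q = p.1 → Ideal.relNorm (𝓞 F) Q.asIdeal = p.1.asIdeal ^ ℓ := by
  classical
  haveI : Fact ℓ.Prime := ⟨hl⟩
  obtain ⟨R, hR, hR'⟩ := D.core_rep hl T hT
  let ι := {r : R // (∀ b : K, b ^ ℓ ≠ r.1) ∧ D.V ((r.1 : Kˣ) : K)}
  have hk := fun r : ι => kum D hl (T : Set (Pl F)) ((r.1.1 : Kˣ) : K) (hR _ r.1.2).1 (hR _ r.1.2).2 r.2.1 r.2.2
  choose L fld nf alg tr h1 h2 h3 h4 h5 using hk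
  refine ⟨ι, inferInstance, fun r => ⟨L r, fld r, nf r, alg r, tr r⟩, fun p hp => ?_⟩
  obtain ⟨U, hU, hUl, hUC⟩ := exists_U hl T p hp
  obtain ⟨r, hr, hr1, hr2, hr3⟩ := hR' U hU
  let j : ι := ⟨⟨r, hr⟩, hr1, hr2⟩
  letI := fld j; letI := nf j; letI := alg j; letI := tr j; haveI := h1 j
  suffices hs : ∀ Q : Pl (L j), und F Q = p.1 → Ideal.relNorm (𝓞 F) Q.asIdeal = p.1.asIdeal ^ ℓ from ⟨j, hs⟩
  intro Q hQ
  obtain ⟨σ, hσ⟩ := h2 j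
  obtain ⟨v0, hv0⟩ := hT.ne
  rcases all_or_triv (G := L j ≃ₐ[F] L j) hl (by rw [IsGalois.card_aut_eq_finrank, h3 j]) Q with ha | ht
  · have h6 := relNorm_inert Q ha (h4 j Q (by rw [hQ]; exact p.2))
    rw [hQ, h3 j] at h6
    exact h6
  · exfalso
    refine at_main σ hσ ℓ (h3 j) T hT.ell v0 hv0 (hT.two _ hv0) (h4 j) ?_
    intro u
    rw [hUC (AddSubgroup.closure _) ?_ ?_ ?_]
    · trivial
    · refine RT_le _ _ (fun u => AddSubgroup.subset_closure (Or.inl (Or.inl ⟨u, rfl⟩))) ?_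
      exact fun x hx => AddSubgroup.subset_closure (Or.inr hx)
    · exact AddSubgroup.subset_closure (Or.inl (Or.inr ⟨p, ⟨Q, hQ, ht⟩, rfl⟩))
    · intro u hu
      obtain ⟨w, hw, hw'⟩ := hr3 u hu
      obtain ⟨Q', hQ', ht'⟩ := h5 j w (by rw [hw]; exact u.2) (by
        have := (und_val_eq_one (F := F) w (ℓ : F)).2 (by rw [hw]; exact hUl u hu)
        rwa [map_natCast] at this) hw'
      exact AddSubgroup.subset_closure (Or.inl (Or.inr ⟨u, ⟨Q', hQ'.trans hw, ht'⟩, rfl⟩))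

/-- classes from `RT` are `ℓ`-th powers -/
theorem RT_class (T : Set (Pl F)) (p : {v : Pl F // v ∉ T}) (hp : Finsupp.single p (1 : ℤ) ∈ RT F ℓ T) :
    ∃ c : ClassGroup (𝓞 F), ClassGroup.mk0 ⟨p.1.asIdeal, mem_nonZeroDivisors_of_ne_zero p.1.ne_bot⟩ = c ^ ℓ := by
  classical
  obtain ⟨_, ⟨f, rfl⟩, _, ⟨x, rfl⟩, h⟩ := AddSubgroup.mem_sup.1 hp
  have h1 : Finsupp.mapDomain Subtype.val (dvX T x) = dv F (.ofMul (x.toMul : Fˣ)) := by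
    ext v
    by_cases hv : v ∈ T
    · rw [Finsupp.mapDomain_of_notMem_range]
      · rw [dv_apply]
        symm
        have := (mem_Xs.1 x.toMul.2) v hv
        exact (ord_eq_zero_iff v (Units.ne_zero _)).2 (val_eq_one_of_sub this)
      · rintro ⟨u, rfl⟩; exact u.2 hv
    · exact Finsupp.mapDomain_apply Subtype.val_injective (dvX T x) ⟨v, hv⟩
  have h2 := congrArg (fun D => clD F (Finsupp.mapDomain Subtype.val D)) h
  simp only [Finsupp.mapDomain_add, Finsupp.mapDomain_single, map_add, clD_single, h1] at h2
  rw [(clD_eq_zero_iff _).2 ⟨_, rfl⟩, add_zero] at h2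
  refine ⟨(clD F (Finsupp.mapDomain Subtype.val f)).toMul, ?_⟩
  apply Additive.ofMul.injective
  rw [← h2]
  have h3 : Finsupp.mapDomain Subtype.val (nsmulAddMonoidHom ℓ f) = ℓ • Finsupp.mapDomain Subtype.val f := by
    simp [Finsupp.mapDomain_smul]
  rw [h3, map_nsmul]
  rfl

end
end HCF


namespace HCF
open Module NumberField IsDedekindDomain WithZero
open scoped nonZeroDivisors Pointwise

section
set_option linter.unusedSectionVars false
set_option linter.style.haveILetI false

section norm
variable (F L : Type) [Field F] [NumberField F] [Field L] [NumberField L] [Algebra F L]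

/-- The class of the relative norm of an ideal. -/
noncomputable def NC : (Ideal (𝓞 L))⁰ →* ClassGroup (𝓞 F) where
  toFun I := ClassGroup.mk0 ⟨Ideal.relNorm (𝓞 F) (I : Ideal (𝓞 L)), mem_nonZeroDivisors_of_ne_zero
    (fun h => nonZeroDivisors.coe_ne_zero I ((Ideal.relNorm_eq_bot_iff (R := 𝓞 F)).1 h))⟩
  map_one' := by
    rw [ClassGroup.mk0_eq_one_iff]
    simp only [OneMemClass.coe_one, map_one]
    rw [Ideal.one_eq_top]
    infer_instance
  map_mul' I J := by
    rw [← map_mul]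
    congr 1
    apply Subtype.ext
    simp

theorem NC_apply (I : (Ideal (𝓞 L))⁰) (J : (Ideal (𝓞 F))⁰) (h : (J : Ideal (𝓞 F)) = Ideal.relNorm (𝓞 F) (I : Ideal (𝓞 L))) :
    NC F L I = ClassGroup.mk0 J := by
  change ClassGroup.mk0 _ = _
  congr 1
  exact Subtype.ext h.symm

theorem NC_ext (G : Subgroup (ClassGroup (𝓞 F)))
    (h : ∀ P : Pl L, NC F L ⟨P.asIdeal, mem_nonZeroDivisors_of_ne_zero P.ne_bot⟩ ∈ G) (I : (Ideal (𝓞 L))⁰) : NC F L I ∈ G := by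
  obtain ⟨I, hI⟩ := I
  have hI0 : I ≠ 0 := nonZeroDivisors.ne_zero hI
  induction I using UniqueFactorizationMonoid.induction_on_prime with
  | h₁ => exact absurd rfl hI0
  | h₂ x hx =>
    have : (⟨x, hI⟩ : (Ideal (𝓞 L))⁰) = 1 := Subtype.ext (by simpa [Ideal.isUnit_iff] using hx)
    rw [this, map_one]; exact one_mem _
  | h₃ a p ha hp ih =>
    have hp0 := mem_nonZeroDivisors_of_ne_zero hp.ne_zero
    have ha0 := mem_nonZeroDivisors_of_ne_zero ha
    have : (⟨p * a, hI⟩ : (Ideal (𝓞 L))⁰) = ⟨p, hp0⟩ * ⟨a, ha0⟩ := rfl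
    rw [this, map_mul]
    exact mul_mem (h ⟨p, Ideal.isPrime_of_prime hp, hp.ne_zero⟩) (ih ha0 ha)

theorem NC_tower (N : Type) [Field N] [NumberField N] [Algebra F N] [Algebra L N] [IsScalarTower F L N] (I : (Ideal (𝓞 N))⁰)
    (J : (Ideal (𝓞 L))⁰) (h : (J : Ideal (𝓞 L)) = Ideal.relNorm (𝓞 L) (I : Ideal (𝓞 N))) : NC F N I = NC F L J := by
  change ClassGroup.mk0 _ = ClassGroup.mk0 _
  congr 1
  apply Subtype.ext
  simp only [h]
  exact (Ideal.relNorm_relNorm (𝓞 F) (𝓞 L) (I : Ideal (𝓞 N))).symm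

end norm

variable {F K : Type} [Field F] [NumberField F] [Field K] [NumberField K] [Algebra F K] {ℓ : ℕ}

theorem compositum [IsTotallyReal F] (ι : Type) [Finite ι] (E : ι → Ext F) : ∃ M : Ext F, ∀ i, Nonempty ((E i).L →ₐ[F] M.L) := by
  classical
  obtain ⟨φ⟩ : Nonempty (F →+* ℂ) := inferInstance
  letI : Algebra F ℂ := φ.toAlgebra
  let f : ∀ i, (E i).L →ₐ[F] ℂ := fun i => IsAlgClosed.lift
  let M : IntermediateField F ℂ := ⨆ i, (f i).fieldRange
  haveI : ∀ i, FiniteDimensional F (f i).fieldRange := fun i => by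
    haveI : FiniteDimensional F (E i).L := inferInstance
    exact inferInstanceAs (FiniteDimensional F (f i).toLinearMap.range)
  haveI : FiniteDimensional F M := IntermediateField.finiteDimensional_iSup_of_finite
  haveI : NumberField M := NumberField.of_module_finite F M
  let g : ∀ i, (E i).L →ₐ[F] M := fun i => (f i).codRestrict M.toSubalgebra fun x =>
    (le_iSup (fun i => (f i).fieldRange) i) ⟨x, rfl⟩
  let R : IntermediateField F M := (maximalRealSubfield M).toIntermediateField fun x => by
    rw [mem_maximalRealSubfield_iff]
    intro ψ
    exact (totReal_iff F).1 inferInstance (ψ.comp (algebraMap F M)) x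
  have h1 : M ≤ IntermediateField.lift R := by
    refine iSup_le fun i => ?_
    rintro _ ⟨x, rfl⟩
    have h2 : g i x ∈ R := by
      change g i x ∈ maximalRealSubfield M
      rw [mem_maximalRealSubfield_iff]
      intro ψ
      exact (totReal_iff (E i).L).1 (E i).tr (ψ.comp (g i).toRingHom) x
    exact (IntermediateField.mem_lift (g i x)).2 h2
  have htr : IsTotallyReal M := by
    rw [totReal_iff]
    intro ψ x
    have h2 : x ∈ R := (IntermediateField.mem_lift x).1 (h1 x.2)
    exact ((mem_maximalRealSubfield_iff _).1 h2) ψ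
  exact ⟨⟨M, inferInstance, inferInstance, inferInstance, htr⟩, fun i => ⟨g i⟩⟩

theorem NC_pow {F L : Type} [Field F] [NumberField F] [Field L] [NumberField L] [Algebra F L] (P : Pl L) (p : Pl F) (n : ℕ)
    (h : Ideal.relNorm (𝓞 F) P.asIdeal = p.asIdeal ^ n) :
    NC F L ⟨P.asIdeal, mem_nonZeroDivisors_of_ne_zero P.ne_bot⟩ = ClassGroup.mk0 ⟨p.asIdeal, mem_nonZeroDivisors_of_ne_zero p.ne_bot⟩ ^ n := by
  rw [← map_pow]
  apply NC_apply
  simp [h]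

theorem CM.main (D : CM F K ℓ) [IsTotallyReal F] (hl : ℓ.Prime) : ∃ M : Ext F, ∀ I : (Ideal (𝓞 M.L))⁰, ∃ c, NC F M.L I = c ^ ℓ := by
  classical
  obtain ⟨T1, a1, a2, a3, a4⟩ := D.choose_T hl ∅ Set.finite_empty
  obtain ⟨T2, b1, b2, b3, b4⟩ := D.choose_T hl T1 T1.finite_toSet
  obtain ⟨ι1, _, E1, h1⟩ := D.core hl T1 ⟨a1, fun v hv => (a2 v hv).2.1, fun v hv => (a2 v hv).2.2, a3, a4⟩
  obtain ⟨ι2, _, E2, h2⟩ := D.core hl T2 ⟨b1, fun v hv => (b2 v hv).2.1, fun v hv => (b2 v hv).2.2, b3, b4⟩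
  obtain ⟨M, hM⟩ := compositum (ι1 ⊕ ι2) (Sum.elim E1 E2)
  have key : ∀ (T : Finset (Pl F)) (ι : Type) (E : ι → Ext F) (_ : ∀ p : {v : Pl F // v ∉ (T : Set (Pl F))},
      Finsupp.single p (1 : ℤ) ∉ RT F ℓ (T : Set (Pl F)) →
      ∃ i, ∀ Q : Pl (E i).L, und F Q = p.1 → Ideal.relNorm (𝓞 F) Q.asIdeal = p.1.asIdeal ^ ℓ)
      (_ : ∀ i, Nonempty ((E i).L →ₐ[F] M.L)) (P : Pl M.L), und F P ∉ T →
      ∃ c, NC F M.L ⟨P.asIdeal, mem_nonZeroDivisors_of_ne_zero P.ne_bot⟩ = c ^ ℓ := by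
    intro T ι E hE hM P hP
    by_cases hp : Finsupp.single (⟨und F P, hP⟩ : {v : Pl F // v ∉ (T : Set (Pl F))}) (1 : ℤ) ∈ RT F ℓ (T : Set (Pl F))
    · obtain ⟨c, hc⟩ := RT_class _ _ hp
      refine ⟨c ^ P.asIdeal.inertiaDeg (𝓞 F), ?_⟩
      rw [NC_pow P (und F P) _ (relNorm_und P), hc, pow_right_comm]
    · obtain ⟨i, hi⟩ := hE _ hp
      obtain ⟨g⟩ := hM i
      letI : Algebra (E i).L M.L := g.toRingHom.toAlgebra
      haveI : IsScalarTower F (E i).L M.L := IsScalarTower.of_algebraMap_eq fun x => (g.commutes x).symm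
      have h3 := hi (und (E i).L P) (und_und F (E i).L M.L P)
      have h4 := relNorm_und (F := (E i).L) P
      have h5 := Ideal.relNorm_relNorm (𝓞 F) (𝓞 (E i).L) P.asIdeal
      rw [h4, map_pow, h3, ← pow_mul] at h5
      refine ⟨ClassGroup.mk0 ⟨(und F P).asIdeal, mem_nonZeroDivisors_of_ne_zero (und F P).ne_bot⟩ ^
        P.asIdeal.inertiaDeg (𝓞 (E i).L),
        (NC_pow P (und F P) _ h5.symm).trans ?_⟩
      rw [mul_comm, pow_mul]
  refine ⟨M, fun I => ?_⟩
  have := NC_ext F M.L (powMonoidHom ℓ : ClassGroup (𝓞 F) →* _).range (fun P => ?_) I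
  · obtain ⟨c, hc⟩ := this
    exact ⟨c, hc.symm⟩
  · by_cases hP : und F P ∈ T1
    · obtain ⟨c, hc⟩ := key T2 ι2 E2 h2 (fun i => hM (Sum.inr i)) P (fun h => (b2 _ h).1 hP)
      exact ⟨c, hc.symm⟩
    · obtain ⟨c, hc⟩ := key T1 ι1 E1 h1 (fun i => hM (Sum.inl i)) P hP
      exact ⟨c, hc.symm⟩

end
end HCF


namespace HCF
open Module NumberField IsDedekindDomain WithZero
open scoped nonZeroDivisors Pointwise

section
set_option linter.unusedSectionVars false
set_option linter.style.haveILetI false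

section setup
variable (F : Type) [Field F] [NumberField F] [IsTotallyReal F] [Algebra F ℂ] (ℓ : ℕ)

/-- the generators -/
noncomputable def gset : Set ℂ := {Complex.I, ((Real.sqrt (8 * ℓ - 1) : ℝ) : ℂ), Complex.exp (2 * Real.pi * Complex.I / ℓ)}

/-- the CM field -/
noncomputable def KK : IntermediateField F ℂ := IntermediateField.adjoin F (gset ℓ)

theorem sq_sqrt' (hl : ℓ.Prime) : ((Real.sqrt (8 * ℓ - 1) : ℝ) : ℂ) ^ 2 = 8 * ℓ - 1 := by
  have h1 : (1 : ℝ) ≤ ℓ := by exact_mod_cast hl.one_lt.le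
  have : (Real.sqrt (8 * ℓ - 1) : ℝ) ^ 2 = 8 * ℓ - 1 := Real.sq_sqrt (by linarith)
  exact_mod_cast congrArg (fun x : ℝ => (x : ℂ)) this

theorem KK_fd (hl : ℓ.Prime) : FiniteDimensional F (KK F ℓ) := by
  haveI : Finite (gset ℓ) := by unfold gset; infer_instance
  apply IntermediateField.finiteDimensional_adjoin
  intro x hx
  rcases hx with rfl | rfl | rfl
  · exact ⟨Polynomial.X ^ 2 + 1, by monicity!, by simp⟩
  · refine ⟨Polynomial.X ^ 2 - Polynomial.C (8 * ℓ - 1 : F), by monicity!, ?_⟩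
    have h8 : algebraMap F ℂ 8 = 8 := map_ofNat _ 8
    simp [sq_sqrt' ℓ hl, h8]
  · refine ⟨Polynomial.X ^ ℓ - 1, Polynomial.monic_X_pow_sub_C 1 hl.ne_zero, ?_⟩
    simp [(Complex.isPrimitiveRoot_exp ℓ hl.ne_zero).pow_eq_one]

variable {F} in
theorem emb_conj (ψ : F →+* ℂ) (x : F) : starRingEnd ℂ (ψ x) = ψ x := (totReal_iff F).1 inferInstance ψ x

/-- complex conjugation as an algebra map -/
noncomputable def cj : ℂ →ₐ[F] ℂ := { starRingEnd ℂ with commutes' := fun x => emb_conj (algebraMap F ℂ) x }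

theorem cj_apply (x : ℂ) : cj F x = starRingEnd ℂ x := rfl

theorem conj_unity {z : ℂ} {n : ℕ} (hn : n ≠ 0) (hz : z ^ n = 1) : starRingEnd ℂ z = z⁻¹ :=
  (Complex.inv_eq_conj (Complex.norm_eq_one_of_pow_eq_one hz hn)).symm

theorem cj_mem (hl : ℓ.Prime) {x : ℂ} (hx : x ∈ KK F ℓ) : starRingEnd ℂ x ∈ KK F ℓ := by
  have h : KK F ℓ ≤ (KK F ℓ).comap (cj F) := by
    refine IntermediateField.adjoin_le_iff.2 ?_
    rintro _ (rfl | rfl | rfl)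
    · change starRingEnd ℂ _ ∈ KK F ℓ
      rw [Complex.conj_I]
      exact neg_mem (IntermediateField.subset_adjoin _ _ (Or.inl rfl))
    · change starRingEnd ℂ _ ∈ KK F ℓ
      rw [Complex.conj_ofReal]
      exact IntermediateField.subset_adjoin _ _ (Or.inr (Or.inl rfl))
    · change starRingEnd ℂ _ ∈ KK F ℓ
      rw [conj_unity hl.ne_zero (Complex.isPrimitiveRoot_exp ℓ hl.ne_zero).pow_eq_one]
      exact inv_mem (IntermediateField.subset_adjoin _ _ (Or.inr (Or.inr rfl)))
  exact h hx

theorem KK_conj (hl : ℓ.Prime) (ψ : KK F ℓ →+* ℂ) (x : KK F ℓ) : ψ ⟨starRingEnd ℂ x, cj_mem F ℓ hl x.2⟩ = starRingEnd ℂ (ψ x) := by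
  let cK : KK F ℓ →+* KK F ℓ := 
    { toFun := fun x => ⟨starRingEnd ℂ x, cj_mem F ℓ hl x.2⟩
      map_one' := Subtype.ext (by simp)
      map_zero' := Subtype.ext (by simp)
      map_add' := fun x y => Subtype.ext (by simp)
      map_mul' := fun x y => Subtype.ext (by simp) }
  let E : IntermediateField F (KK F ℓ) := (RingHom.eqLocusField (ψ.comp cK) ((starRingEnd ℂ).comp ψ)).toIntermediateField fun x => by
    change ψ (cK (algebraMap F (KK F ℓ) x)) = starRingEnd ℂ (ψ (algebraMap F (KK F ℓ) x))
    have h1 := emb_conj (ψ.comp (algebraMap F (KK F ℓ))) x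
    have h2 : cK (algebraMap F (KK F ℓ) x) = algebraMap F (KK F ℓ) x := Subtype.ext (emb_conj (algebraMap F ℂ) x)
    rw [h2]; exact h1.symm
  have hE : KK F ℓ ≤ IntermediateField.lift E := by
    refine IntermediateField.adjoin_le_iff.2 ?_
    intro y hy
    have hyK : y ∈ KK F ℓ := IntermediateField.subset_adjoin _ _ hy
    suffices h : (⟨y, hyK⟩ : KK F ℓ) ∈ E from (IntermediateField.mem_lift (⟨y, hyK⟩ : KK F ℓ)).2 h
    change ψ (cK ⟨y, hyK⟩) = starRingEnd ℂ (ψ ⟨y, hyK⟩)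
    rcases hy with rfl | rfl | rfl
    · have h1 : cK ⟨Complex.I, hyK⟩ = -⟨Complex.I, hyK⟩ := Subtype.ext (Complex.conj_I)
      have h2 : ψ ⟨Complex.I, hyK⟩ * ψ ⟨Complex.I, hyK⟩ = -1 := by
        rw [← map_mul, ← map_one ψ, ← map_neg]
        exact congrArg ψ (Subtype.ext Complex.I_mul_I)
      rw [h1, map_neg]
      have h3 : (ψ ⟨Complex.I, hyK⟩ - Complex.I) * (ψ ⟨Complex.I, hyK⟩ + Complex.I) = 0 := by
        ring_nf; rw [Complex.I_sq, pow_two, h2]; ring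
      rcases mul_eq_zero.1 h3 with h | h
      · rw [sub_eq_zero.1 h, Complex.conj_I]
      · rw [eq_neg_of_add_eq_zero_left h, map_neg, Complex.conj_I]
    · set s : ℝ := Real.sqrt (8 * ℓ - 1) with hs
      have h1 : cK ⟨(s : ℂ), hyK⟩ = ⟨(s : ℂ), hyK⟩ := Subtype.ext (Complex.conj_ofReal s)
      have h2 : ψ ⟨(s : ℂ), hyK⟩ ^ 2 = (s : ℂ) ^ 2 := by
        rw [sq_sqrt' ℓ hl, ← map_pow]
        have : (⟨(s : ℂ), hyK⟩ : KK F ℓ) ^ 2 = 8 * ℓ - 1 := Subtype.ext (by push_cast; exact sq_sqrt' ℓ hl)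
        have h8 : ψ 8 = 8 := map_ofNat _ 8
        rw [this]; simp [h8]
      rw [h1]
      rcases sq_eq_sq_iff_eq_or_eq_neg.1 h2 with h | h
      · rw [h, Complex.conj_ofReal]
      · rw [h, map_neg, Complex.conj_ofReal]
    · have hz := (Complex.isPrimitiveRoot_exp ℓ hl.ne_zero).pow_eq_one
      set z := Complex.exp (2 * Real.pi * Complex.I / ℓ) with hzz
      have h1 : cK ⟨z, hyK⟩ = ⟨z, hyK⟩⁻¹ := Subtype.ext (conj_unity hl.ne_zero hz)
      have h2 : ψ ⟨z, hyK⟩ ^ ℓ = 1 := by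
        rw [← map_pow, ← map_one ψ]
        exact congrArg ψ (Subtype.ext hz)
      rw [h1, map_inv₀, conj_unity hl.ne_zero h2]
  exact (IntermediateField.mem_lift x).1 (hE x.2)

end setup

theorem exists_CM (F : Type) [Field F] [NumberField F] [IsTotallyReal F] (ℓ : ℕ) (hl : ℓ.Prime) :
    ∃ (E : Ext F) (K : Type) (_ : Field K) (_ : NumberField K) (_ : Algebra E.L K), Nonempty (CM E.L K ℓ) := by
  obtain ⟨φ⟩ : Nonempty (F →+* ℂ) := inferInstance
  letI : Algebra F ℂ := φ.toAlgebra
  haveI := KK_fd F ℓ hl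
  haveI : NumberField (KK F ℓ) := NumberField.of_module_finite F (KK F ℓ)
  let F1 := maximalRealSubfield (KK F ℓ)
  have hF1 : ∀ x, x ∈ F1 ↔ starRingEnd ℂ (x : ℂ) = x := by
    intro x
    refine ⟨fun h => (mem_maximalRealSubfield_iff x).1 h (KK F ℓ).val.toRingHom, fun h => ?_⟩
    rw [mem_maximalRealSubfield_iff]
    intro ψ
    have h1 := KK_conj F ℓ hl ψ x
    have h2 : (⟨starRingEnd ℂ x, cj_mem F ℓ hl x.2⟩ : KK F ℓ) = x := Subtype.ext h
    rw [h2] at h1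
    exact h1.symm
  let alg : Algebra F F1 := ((algebraMap F (KK F ℓ)).codRestrict F1 fun x => by
    rw [hF1]; exact emb_conj (algebraMap F ℂ) x).toAlgebra
  refine ⟨⟨F1, inferInstance, inferInstance, alg, inferInstance⟩, KK F ℓ, inferInstance, inferInstance, inferInstanceAs (Algebra F1 (KK F ℓ)), ⟨?_⟩⟩
  change CM F1 (KK F ℓ) ℓ
  have m1 : Complex.I ∈ KK F ℓ := IntermediateField.subset_adjoin _ _ (Or.inl rfl)
  have m2 : ((Real.sqrt (8 * ℓ - 1) : ℝ) : ℂ) ∈ KK F ℓ := IntermediateField.subset_adjoin _ _ (Or.inr (Or.inl rfl))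
  have m3 : Complex.exp (2 * Real.pi * Complex.I / ℓ) ∈ KK F ℓ := IntermediateField.subset_adjoin _ _ (Or.inr (Or.inr rfl))
  have hz := Complex.isPrimitiveRoot_exp ℓ hl.ne_zero
  have hsq := sq_sqrt' ℓ hl
  set s : ℝ := Real.sqrt (8 * ℓ - 1) with hs
  have m4 : (1 + Complex.I * (s : ℂ)) / 2 ∈ KK F ℓ := div_mem (add_mem (one_mem _) (mul_mem m1 m2)) (ofNat_mem _ 2)
  have h2 : starRingEnd ℂ 2 = 2 := map_ofNat _ 2
  have hc : starRingEnd ℂ ((1 + Complex.I * (s : ℂ)) / 2) = (1 - Complex.I * (s : ℂ)) / 2 := by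
    have h2 : starRingEnd ℂ 2 = 2 := map_ofNat _ 2
    simp [Complex.conj_ofReal, sub_eq_add_neg, h2]
  exact
    { τ := 
        { toFun := fun x => ⟨starRingEnd ℂ x, cj_mem F ℓ hl x.2⟩
          invFun := fun x => ⟨starRingEnd ℂ x, cj_mem F ℓ hl x.2⟩
          left_inv := fun x => Subtype.ext (by simp)
          right_inv := fun x => Subtype.ext (by simp)
          map_add' := fun x y => Subtype.ext (by simp)
          map_mul' := fun x y => Subtype.ext (by simp)
          commutes' := fun x => Subtype.ext ((hF1 x.1).1 x.2) }
      i := ⟨Complex.I, m1⟩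
      ζ := ⟨_, m3⟩
      θ := ⟨_, m4⟩
      hi := Subtype.ext Complex.I_mul_I
      τi := Subtype.ext Complex.conj_I
      gen := by
        intro z
        let zb : KK F ℓ := ⟨starRingEnd ℂ z, cj_mem F ℓ hl z.2⟩
        refine ⟨⟨(z + zb) / 2, (hF1 _).2 ?_⟩, ⟨-((z - zb) / 2 * ⟨Complex.I, m1⟩), (hF1 _).2 ?_⟩, ?_⟩
        · change starRingEnd ℂ (((z : ℂ) + starRingEnd ℂ (z : ℂ)) / 2) = ((z : ℂ) + starRingEnd ℂ (z : ℂ)) / 2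
          simp [h2, add_comm]
        · change starRingEnd ℂ (-(((z : ℂ) - starRingEnd ℂ (z : ℂ)) / 2 * Complex.I)) = -(((z : ℂ) - starRingEnd ℂ (z : ℂ)) / 2 * Complex.I)
          simp [h2]; ring
        · apply Subtype.ext
          change (z : ℂ) = (z + starRingEnd ℂ (z : ℂ)) / 2 + -((z - starRingEnd ℂ (z : ℂ)) / 2 * Complex.I) * Complex.I
          linear_combination ((z - starRingEnd ℂ (z : ℂ)) / 2) * Complex.I_sq
      hζ := IsPrimitiveRoot.of_map_of_injective (f := (KK F ℓ).val) hz (KK F ℓ).val.injective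
      τζ := Subtype.ext (conj_unity hl.ne_zero hz.pow_eq_one)
      θ1 := by
        apply Subtype.ext
        change (1 + Complex.I * (s : ℂ)) / 2 + starRingEnd ℂ ((1 + Complex.I * (s : ℂ)) / 2) = 1
        rw [hc]; ring
      θ2 := by
        apply Subtype.ext
        change (1 + Complex.I * (s : ℂ)) / 2 * starRingEnd ℂ ((1 + Complex.I * (s : ℂ)) / 2) = (2 : ℂ) * ((ℓ : KK F ℓ) : ℂ)
        rw [hc]
        push_cast
        linear_combination (-(s : ℂ) ^ 2 / 4) * Complex.I_sq + hsq / 4 }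

end
end HCF


namespace HCF
open Module NumberField IsDedekindDomain WithZero
open scoped nonZeroDivisors Pointwise

section
set_option linter.unusedSectionVars false
set_option linter.style.haveILetI false

theorem NC_span (F L : Type) [Field F] [NumberField F] [Field L] [NumberField L] [Algebra F L] (x : 𝓞 L)
    (hx : Ideal.span {x} ∈ (Ideal (𝓞 L))⁰) : NC F L ⟨Ideal.span {x}, hx⟩ = 1 := by
  change ClassGroup.mk0 _ = 1
  rw [ClassGroup.mk0_eq_one_iff]
  simp only [Ideal.relNorm_singleton]
  exact ⟨⟨_, rfl⟩⟩

theorem NC_congr (F L : Type) [Field F] [NumberField F] [Field L] [NumberField L] [Algebra F L] (I J : (Ideal (𝓞 L))⁰)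
    (h : ClassGroup.mk0 I = ClassGroup.mk0 J) : NC F L I = NC F L J := by
  obtain ⟨x, y, hx, hy, h⟩ := ClassGroup.mk0_eq_mk0_iff.1 h
  have hx' : Ideal.span {x} ∈ (Ideal (𝓞 L))⁰ := mem_nonZeroDivisors_of_ne_zero (by simpa using hx)
  have hy' : Ideal.span {y} ∈ (Ideal (𝓞 L))⁰ := mem_nonZeroDivisors_of_ne_zero (by simpa using hy)
  have h1 : (⟨_, hx'⟩ : (Ideal (𝓞 L))⁰) * I = ⟨_, hy'⟩ * J := Subtype.ext h
  have h2 := congrArg (NC F L) h1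
  rwa [map_mul, map_mul, NC_span, NC_span, one_mul, one_mul] at h2

/-- norms of ideal classes are `n`-th powers -/
def PowN (F L : Type) [Field F] [NumberField F] [Field L] [NumberField L] [Algebra F L] (n : ℕ) : Prop :=
  ∀ I : (Ideal (𝓞 L))⁰, ∃ c, NC F L I = c ^ n

theorem PowN_comp (F L N : Type) [Field F] [NumberField F] [Field L] [NumberField L] [Algebra F L]
    [Field N] [NumberField N] [Algebra F N] [Algebra L N] [IsScalarTower F L N] (n m : ℕ) (h1 : PowN F L n) (h2 : PowN L N m) :
    PowN F N (m * n) := by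
  intro I
  have hJ : Ideal.relNorm (𝓞 L) (I : Ideal (𝓞 N)) ∈ (Ideal (𝓞 L))⁰ := mem_nonZeroDivisors_of_ne_zero
    (fun h => nonZeroDivisors.coe_ne_zero I ((Ideal.relNorm_eq_bot_iff (R := 𝓞 L)).1 h))
  obtain ⟨c, hc⟩ := h2 I
  obtain ⟨C, rfl⟩ := ClassGroup.mk0_surjective c
  rw [NC_apply L N I ⟨_, hJ⟩ rfl, ← map_pow] at hc
  obtain ⟨d, hd⟩ := h1 C
  refine ⟨d, ?_⟩
  rw [NC_tower F L N I ⟨_, hJ⟩ rfl, NC_congr F L _ _ hc, map_pow, hd, ← pow_mul, mul_comm]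

theorem PowN_ext (F : Type) [Field F] [NumberField F] (E : Ext F) (E' : Ext E.L) (n m : ℕ) (h1 : PowN F E.L n) (h2 : PowN E.L E'.L m) :
    ∃ M : Ext F, PowN F M.L (m * n) := by
  letI : Algebra F E'.L := ((algebraMap E.L E'.L).comp (algebraMap F E.L)).toAlgebra
  haveI : IsScalarTower F E.L E'.L := IsScalarTower.of_algebraMap_eq fun x => rfl
  exact ⟨⟨E'.L, inferInstance, inferInstance, inferInstance, inferInstance⟩, PowN_comp F E.L E'.L n m h1 h2⟩

theorem main_prime (F : Type) [Field F] [NumberField F] [IsTotallyReal F] (ℓ : ℕ) (hl : ℓ.Prime) : ∃ M : Ext F, PowN F M.L ℓ := by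
  obtain ⟨E, K, _, _, _, ⟨D⟩⟩ := exists_CM F ℓ hl
  obtain ⟨M, hM⟩ := D.main hl
  obtain ⟨M', hM'⟩ := PowN_ext F E M 1 ℓ (fun I => ⟨_, (pow_one _).symm⟩) hM
  exact ⟨M', by rwa [mul_one] at hM'⟩

theorem main_nat (F : Type) [Field F] [NumberField F] [IsTotallyReal F] (n : ℕ) (hn : n ≠ 0) : ∃ M : Ext F, PowN F M.L n := by
  induction n using induction_on_primes with
  | zero => exact absurd rfl hn
  | one => exact ⟨⟨F, inferInstance, inferInstance, inferInstance, inferInstance⟩, fun I => ⟨_, (pow_one _).symm⟩⟩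
  | prime_mul p a hp ih =>
    obtain ⟨E, hE⟩ := ih (right_ne_zero_of_mul hn)
    obtain ⟨E', hE'⟩ := main_prime E.L p hp
    exact PowN_ext F E E' a p hE hE'

theorem main_triv (F : Type) [Field F] [NumberField F] [IsTotallyReal F] : ∃ M : Ext F, ∀ I, NC F M.L I = 1 := by
  obtain ⟨M, hM⟩ := main_nat F (Nat.card (ClassGroup (𝓞 F))) Nat.card_pos.ne'
  refine ⟨M, fun I => ?_⟩
  obtain ⟨c, hc⟩ := hM I
  rw [hc, pow_card_eq_one']

end
end HCF

open HCF in
theorem stmt_5_aux (F : IntermediateField ℚ ℂ) [FiniteDimensional ℚ F] (hF : TotallyReal F) :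
    ∃ (L : IntermediateField ℚ ℂ) (_ : FiniteDimensional ℚ L) (h : F ≤ L), TotallyReal L ∧
      ∀ I : (Ideal (𝓞 L))⁰, ∃ J : (Ideal (𝓞 F))⁰, (J : Ideal (𝓞 F)) = idealNorm F L h (I : Ideal (𝓞 L)) ∧ ClassGroup.mk0 J = 1 := by
  haveI : IsTotallyReal F := (totReal_iff F).2 fun φ x => Complex.conj_eq_iff_im.2 (hF φ x)
  obtain ⟨M, hM⟩ := main_triv F
  let f : M.L →ₐ[F] ℂ := IsAlgClosed.lift
  let L : IntermediateField ℚ ℂ := (f.toRingHom.toRatAlgHom).fieldRange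
  have hfL : ∀ x, f x ∈ L := fun x => ⟨x, rfl⟩
  have h : F ≤ L := fun x hx => ⟨algebraMap F M.L ⟨x, hx⟩, f.commutes ⟨x, hx⟩⟩
  let e : M.L ≃+* L := (RingEquiv.ofBijective (f.toRingHom.codRestrict L hfL)
    ⟨RingHom.injective _, fun ⟨y, x, hx⟩ => ⟨x, Subtype.ext hx⟩⟩)
  haveI hfd : FiniteDimensional ℚ L := inferInstanceAs (FiniteDimensional ℚ (f.toRingHom.toRatAlgHom).toLinearMap.range)
  refine ⟨L, hfd, h, ?_, ?_⟩
  · intro φ x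
    have := (totReal_iff M.L).1 inferInstance (φ.comp e.toRingHom) (e.symm x)
    rw [Complex.conj_eq_iff_im] at this
    simpa using this
  intro I
  letI algFL : Algebra F L := (IntermediateField.inclusion h).toRingHom.toAlgebra
  letI algML : Algebra M.L L := e.toRingHom.toAlgebra
  haveI : IsScalarTower F M.L L := IsScalarTower.of_algebraMap_eq fun x => Subtype.ext (f.commutes x).symm
  have hI : Ideal.relNorm (𝓞 F) (I : Ideal (𝓞 L)) ∈ (Ideal (𝓞 F))⁰ := mem_nonZeroDivisors_of_ne_zero
    (fun h => nonZeroDivisors.coe_ne_zero I ((Ideal.relNorm_eq_bot_iff (R := 𝓞 F)).1 h))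
  have hI' : Ideal.relNorm (𝓞 M.L) (I : Ideal (𝓞 L)) ∈ (Ideal (𝓞 M.L))⁰ := mem_nonZeroDivisors_of_ne_zero
    (fun h => nonZeroDivisors.coe_ne_zero I ((Ideal.relNorm_eq_bot_iff (R := 𝓞 M.L)).1 h))
  refine ⟨⟨_, hI⟩, ?_, ?_⟩
  · change Ideal.span (Algebra.intNorm (𝓞 F) (𝓞 L) '' (I : Ideal (𝓞 L))) = Ideal.span _
    congr 1
    ext y
    constructor
    · rintro ⟨x, hx, rfl⟩
      exact ⟨x, hx, Algebra.algebraMap_intNorm (A := 𝓞 F) (B := 𝓞 L) (K := F) (L := L) x⟩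
    · rintro ⟨x, hx, hy⟩
      refine ⟨x, hx, ?_⟩
      apply RingOfIntegers.ext
      exact (Algebra.algebraMap_intNorm (A := 𝓞 F) (B := 𝓞 L) (K := F) (L := L) x).trans hy.symm
  · rw [← NC_apply F L I ⟨_, hI⟩ rfl, NC_tower F M.L L I ⟨_, hI'⟩ rfl, hM]

/-- A norm-compatible family of ideal classes `c_F ∈ Cl(𝓞_F)`, indexed by
the totally real subfields `F` of `ℂ` of finite degree over `ℚ`, is trivial: each `c_F`
is the trivial class. (Norm-compatibility: if `F ⊆ L` then the class of the relative
norm of any ideal representing `c_L` is `c_F`.) -/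
theorem stmt_5
    (c : ∀ F : IntermediateField ℚ ℂ, ClassGroup (𝓞 F))
    (hc : ∀ (F L : IntermediateField ℚ ℂ) [FiniteDimensional ℚ F] [FiniteDimensional ℚ L],
      TotallyReal F → TotallyReal L → ∀ h : F ≤ L,
      ∀ I : (Ideal (𝓞 L))⁰, ClassGroup.mk0 I = c L →
        ∀ J : (Ideal (𝓞 F))⁰, (J : Ideal (𝓞 F)) = idealNorm F L h I →
          ClassGroup.mk0 J = c F) :
    ∀ (F : IntermediateField ℚ ℂ) [FiniteDimensional ℚ F], TotallyReal F → c F = 1 := by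
  intro F _ hF
  obtain ⟨L, hfd, h, hL, hN⟩ := stmt_5_aux F hF
  obtain ⟨I, hI⟩ := ClassGroup.mk0_surjective (c L)
  obtain ⟨J, hJ, hJ1⟩ := hN I
  rw [← hc F L hF hL h I hI J hJ, hJ1]
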